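/- arXiv:1904.12801 — 2 statements merged into one kernel-verified Lean document; each statement's English description precedes it below -/
import Mathlib

section
/- Let p be a prime and Q a connected quandle with Nat.card Q = p^3. If Q is faithful, then Q is latin: for every a ∈ Q the map b ↦ b ◃ a is a bijection of Q. -/
open Quandles

/-- Left multiplication by `a` as a permutation of the quandle. -/
def QL {Q : Type*} [Quandle Q] (a : Q) : Equiv.Perm Q := Rack.act' a

/-- The displacement group of a quandle: the subgroup of `Equiv.Perm Q`
generated by `{L a * (L b)⁻¹ : a, b ∈ Q}`. -/
def Dis (Q : Type*) [Quandle Q] : Subgroup (Equiv.Perm Q) :=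
  Subgroup.closure {g : Equiv.Perm Q | ∃ a b : Q, g = QL a * (QL b)⁻¹}


section kazarin

open Polynomial

set_option linter.unusedSectionVars false

variable {KK : Type} [Field KK] [CharZero KK] [IsAlgClosed KK] [Algebra.IsAlgebraic ℚ KK]

lemma kz_norm_root (o : ℕ) (ho : 0 < o) (f : KK →+* ℂ) (z : KK) (hz : z ^ o = 1) : ‖f z‖ = 1 := by
  have h : ‖f z‖ ^ o = 1 := by rw [← norm_pow, ← map_pow, hz, map_one, norm_one]
  exact (pow_eq_one_iff_of_nonneg (norm_nonneg _) ho.ne').1 h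

lemma kz_avg (s : Multiset KK) (o : ℕ) (ho : 0 < o) (hs : ∀ z ∈ s, z ^ o = 1) (b : KK)
    (hb : IsIntegral ℤ b) (hb0 : b ≠ 0) (hsum : s.sum = (s.card : KK) * b) :
    ∀ z ∈ s, z = b := by
  intro z0 hz0
  have hcard : (0:ℝ) < s.card := by
    have := Multiset.card_pos_iff_exists_mem.2 ⟨z0, hz0⟩
    exact_mod_cast this
  have hbound : ∀ f : KK →+* ℂ, ‖f b‖ ≤ 1 := by
    intro f
    have h1 : ‖f s.sum‖ ≤ s.card := by
      rw [map_multiset_sum]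
      refine (norm_multiset_sum_le _).trans ?_
      rw [Multiset.map_map]
      have : Multiset.map (norm ∘ ⇑f) s = Multiset.map (fun _ => (1:ℝ)) s :=
        Multiset.map_congr rfl (fun z hz => kz_norm_root o ho f z (hs z hz))
      rw [this]; simp
    rw [hsum, map_mul, norm_mul, map_natCast] at h1
    simp only [Complex.norm_natCast] at h1
    nlinarith
  have hroot : ∃ (n : ℕ) (_ : 0 < n), b ^ n = 1 := by
    have hbi : IsIntegral ℚ b := hb.tower_top
    have : FiniteDimensional ℚ (IntermediateField.adjoin ℚ {b}) :=
      IntermediateField.adjoin.finiteDimensional hbi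
    have : NumberField (IntermediateField.adjoin ℚ {b}) := {}
    let b' : IntermediateField.adjoin ℚ {b} := ⟨b, IntermediateField.mem_adjoin_simple_self ℚ b⟩
    have hinj : Function.Injective (algebraMap (IntermediateField.adjoin ℚ {b}) KK) :=
      FaithfulSMul.algebraMap_injective _ _
    have hmap : algebraMap (IntermediateField.adjoin ℚ {b}) KK b' = b := rfl
    obtain ⟨n, hn, h⟩ := NumberField.Embeddings.pow_eq_one_of_norm_le_one
      (IntermediateField.adjoin ℚ {b}) ℂ (x := b') (fun h => hb0 (by rw [← hmap, h, map_zero]))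
      ((isIntegral_algHom_iff ((algebraMap (IntermediateField.adjoin ℚ {b}) KK).toIntAlgHom) hinj).1
        (by simpa using hb))
      (fun f => by
        have := hbound (NumberField.ComplexEmbedding.lift KK f)
        have h2 := NumberField.ComplexEmbedding.lift_algebraMap_apply KK f b'
        rw [hmap] at h2
        rwa [h2] at this)
    exact ⟨n, hn, by rw [← hmap, ← map_pow, h, map_one]⟩
  obtain ⟨n, hn, hbn⟩ := hroot
  let f : KK →+* ℂ := (IsAlgClosed.lift (R := ℚ) (S := KK) (M := ℂ)).toRingHom
  have hfb : ‖f b‖ = 1 := kz_norm_root n hn f b hbn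
  -- real parts
  let g : KK → ℝ := fun z => ((starRingEnd ℂ) (f b) * f z).re
  have hg1 : ∀ z ∈ s, g z ≤ 1 := by
    intro z hz
    refine (Complex.re_le_norm _).trans ?_
    rw [norm_mul, Complex.norm_conj, hfb, kz_norm_root o ho f z (hs z hz)]; norm_num
  have hgsum : (s.map g).sum = s.card := by
    have h1 : (s.map g).sum = ((starRingEnd ℂ) (f b) * f s.sum).re := by
      rw [map_multiset_sum, ← Multiset.sum_map_mul_left]
      have := map_multiset_sum Complex.reAddGroupHom (s.map (fun z => (starRingEnd ℂ) (f b) * f z))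
      simp only [Complex.coe_reAddGroupHom, Multiset.map_map] at this ⊢
      rw [this]; rfl
    rw [h1, hsum, map_mul, map_natCast]
    have : (starRingEnd ℂ) (f b) * (↑s.card * f b) = (s.card : ℂ) := by
      have h2 : (starRingEnd ℂ) (f b) * f b = 1 := by
        rw [mul_comm, Complex.mul_conj, Complex.normSq_eq_norm_sq, hfb]; norm_num
      linear_combination (s.card : ℂ) * h2
    rw [this]; simp
  have hgz : g z0 = 1 := by
    obtain ⟨t, rfl⟩ := Multiset.exists_cons_of_mem hz0
    have h3 : (t.map g).sum ≤ t.card := by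
      have := Multiset.sum_le_card_nsmul (t.map g) 1 (by
        intro x hx
        obtain ⟨z, hz, rfl⟩ := Multiset.mem_map.1 hx
        exact hg1 z (Multiset.mem_cons_of_mem hz))
      simpa using this
    have h4 := hg1 z0 hz0
    simp only [Multiset.map_cons, Multiset.sum_cons, Multiset.card_cons] at hgsum
    push_cast at hgsum
    linarith
  have hz1 : (starRingEnd ℂ) (f b) * f z0 = 1 := by
    have hn1 : ‖(starRingEnd ℂ) (f b) * f z0‖ = 1 := by
      rw [norm_mul, Complex.norm_conj, hfb, kz_norm_root o ho f z0 (hs z0 hz0)]; norm_num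
    have hsq := Complex.sq_norm ((starRingEnd ℂ) (f b) * f z0)
    rw [hn1, Complex.normSq_apply] at hsq
    change ((starRingEnd ℂ) (f b) * f z0).re = 1 at hgz
    rw [hgz] at hsq
    apply Complex.ext
    · simpa using hgz
    · have : ((starRingEnd ℂ) (f b) * f z0).im * ((starRingEnd ℂ) (f b) * f z0).im = 0 := by linarith
      simpa using this
  have h2 : (starRingEnd ℂ) (f b) * f b = 1 := by
    rw [mul_comm, Complex.mul_conj, Complex.normSq_eq_norm_sq, hfb]; norm_num
  apply f.injective
  have hne : (starRingEnd ℂ) (f b) ≠ 0 := left_ne_zero_of_mul_eq_one h2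
  exact mul_left_cancel₀ hne (hz1.trans h2.symm)

lemma kz_root_eval {n : ℕ} (A : Matrix (Fin n) (Fin n) KK) (q : KK[X]) (hq : aeval A q = 0)
    (μ : KK) (hμ : μ ∈ A.charpoly.roots) : q.eval μ = 0 := by
  have h1 : μ ∈ spectrum KK A := by
    rw [Matrix.mem_spectrum_iff_isRoot_charpoly]
    exact isRoot_of_mem_roots hμ
  rcases Nat.eq_zero_or_pos n with h | h
  · subst h
    simp [Matrix.charpoly] at hμ
  have : Nonempty (Fin n) := ⟨⟨0, h⟩⟩
  have h2 := spectrum.subset_polynomial_aeval A q ⟨μ, h1, rfl⟩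
  rw [hq, spectrum.zero_eq] at h2
  simpa using h2

/-- finite order matrix with integral nonzero normalised trace is scalar -/
lemma kz_scalar {n : ℕ} (W : Matrix (Fin n) (Fin n) KK) (o : ℕ) (ho : 0 < o) (hW : W ^ o = 1)
    (b : KK) (hb : IsIntegral ℤ b) (hb0 : b ≠ 0) (htr : W.trace = (n : KK) * b) :
    W = algebraMap KK _ b := by
  have hsplit : W.charpoly.Splits := IsAlgClosed.splits _
  have hcard : W.charpoly.roots.card = n := by
    rw [← hsplit.natDegree_eq_card_roots, Matrix.charpoly_natDegree_eq_dim, Fintype.card_fin]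
  have hann : aeval W (X ^ o - 1 : KK[X]) = 0 := by simp [hW]
  have hroots : ∀ z ∈ W.charpoly.roots, z ^ o = 1 := by
    intro z hz
    have := kz_root_eval W _ hann z hz
    simpa [sub_eq_zero] using this
  have hall := kz_avg W.charpoly.roots o ho hroots b hb hb0 (by
    rw [← Matrix.trace_eq_sum_roots_charpoly_of_splits hsplit, hcard, htr])
  rcases Nat.eq_zero_or_pos n with h | h
  · subst h; exact Subsingleton.elim _ _
  have hch : W.charpoly = (X - C b) ^ n := by
    rw [hsplit.eq_prod_roots_of_monic (Matrix.charpoly_monic W),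
      Multiset.eq_replicate.2 ⟨hcard, hall⟩]
    simp
  have hsq : Squarefree (X ^ o - 1 : KK[X]) := by
    have : (X ^ o - 1 : KK[X]).Separable := by
      have := separable_X_pow_sub_C (F := KK) (n := o) 1 (by exact_mod_cast ho.ne') one_ne_zero
      simpa using this
    exact this.squarefree
  have hm1 : minpoly KK W ∣ (X - C b) := by
    have h1 : Squarefree (minpoly KK W) := hsq.squarefree_of_dvd (minpoly.dvd _ _ hann)
    rw [← h1.dvd_pow_iff_dvd h.ne', ← hch]
    exact Matrix.minpoly_dvd_charpoly W
  obtain ⟨q, hq⟩ := hm1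
  have : aeval W (X - C b) = 0 := by rw [hq, map_mul, minpoly.aeval, zero_mul]
  simpa [sub_eq_zero] using this

lemma kz_trace_integral {n : ℕ} (W : Matrix (Fin n) (Fin n) KK) (o : ℕ) (ho : 0 < o)
    (hW : W ^ o = 1) : IsIntegral ℤ W.trace := by
  have hann : aeval W (X ^ o - 1 : KK[X]) = 0 := by simp [hW]
  rw [Matrix.trace_eq_sum_roots_charpoly]
  apply IsIntegral.multiset_sum
  intro z hz
  have := kz_root_eval W _ hann z hz
  have hz1 : z ^ o = 1 := by simpa [sub_eq_zero] using this
  exact IsIntegral.of_pow ho (by rw [hz1]; exact isIntegral_one)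

lemma kz_burnside {D : Type*} [Group D] [Finite D] (φ : D ≃* D) (B : Finset D)
    (hB : ∀ b, b ∈ B ↔ ∃ x, b = x * (φ x)⁻¹) (p a : ℕ) (hp : p.Prime) (hcard : B.card = p ^ a)
    {n : ℕ} (r : D →* Matrix (Fin n) (Fin n) KK)
    (hirr : ∀ A : Matrix (Fin n) (Fin n) KK, (∀ d, A * r d = r d * A) → ∃ c : KK, A = algebraMap KK _ c)
    (V : Matrix (Fin n) (Fin n) KK) (hUV : (∑ b ∈ B, r b) * V = 1) (hpn : ¬ p ∣ n) :
    ∀ d, r (φ d) = r d := by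
  classical
  have hn : 0 < n := Nat.pos_of_ne_zero (fun h => hpn (h ▸ dvd_zero p))
  have : Nonempty (Fin n) := ⟨⟨0, hn⟩⟩
  have hpa : (p ^ a : KK) ≠ 0 := by exact_mod_cast pow_ne_zero a hp.ne_zero
  set U := ∑ b ∈ B, r b with hU
  have hVU : V * U = 1 := mul_eq_one_comm.1 hUV
  have hrel : ∀ d, r d * U = U * r (φ d) := by
    intro d
    rw [hU, Finset.mul_sum, Finset.sum_mul]
    refine Finset.sum_bij' (fun b _ => d * b * (φ d)⁻¹) (fun b _ => d⁻¹ * b * φ d) ?_ ?_ ?_ ?_ ?_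
    · intro b hb
      obtain ⟨x, rfl⟩ := (hB b).1 hb
      exact (hB _).2 ⟨d * x, by rw [map_mul]; group⟩
    · intro b hb
      obtain ⟨x, rfl⟩ := (hB b).1 hb
      exact (hB _).2 ⟨d⁻¹ * x, by rw [map_mul, map_inv]; group⟩
    · intro b _; group
    · intro b _; group
    · intro b _
      rw [← map_mul, ← map_mul]; congr 1; group
  have hphi : ∀ d, r (φ d) = V * r d * U := by
    intro d
    rw [mul_assoc, hrel, ← mul_assoc, hVU, one_mul]
  have htr : (n : KK) = p ^ a * V.trace := by
    have h1 : (U * V).trace = n := by rw [hUV]; simp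
    rw [← h1, hU, Finset.sum_mul, Matrix.trace_sum]
    have h2 : ∀ b ∈ B, (r b * V).trace = V.trace := by
      intro b hb
      obtain ⟨x, rfl⟩ := (hB b).1 hb
      rw [← map_inv, map_mul, hphi]
      have : r x * (V * r x⁻¹ * U) * V = r x * (V * r x⁻¹) := by
        rw [mul_assoc, mul_assoc (V * r x⁻¹), hUV, mul_one]
      rw [this, Matrix.trace_mul_comm, mul_assoc, ← map_mul]
      simp
    rw [Finset.sum_congr rfl h2, Finset.sum_const, hcard, nsmul_eq_mul]
    push_cast; rfl
  -- a power of U is scalar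
  obtain ⟨o, ho, hφo⟩ : ∃ o : ℕ, 0 < o ∧ ∀ d, (φ : D → D)^[o] d = d := by
    have : Finite (MulAut D) := Finite.of_injective (fun f : MulAut D => (f : D → D)) DFunLike.coe_injective
    refine ⟨orderOf (φ : MulAut D), orderOf_pos (φ : MulAut D), fun d => ?_⟩
    have h1 := pow_orderOf_eq_one (φ : MulAut D)
    have h2 : ∀ m : ℕ, ∀ d, (φ : D → D)^[m] d = ((φ : MulAut D) ^ m) d := by
      intro m
      induction m with
      | zero => intro d; simp
      | succ k ih => intro d; rw [Function.iterate_succ_apply, ih, pow_succ]; rfl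
    rw [h2, h1]; rfl
  have hrelm : ∀ m : ℕ, ∀ d, r d * U ^ m = U ^ m * r ((φ : D → D)^[m] d) := by
    intro m
    induction m with
    | zero => intro d; simp
    | succ k ih =>
      intro d
      rw [pow_succ', ← mul_assoc, hrel, mul_assoc, ih, Function.iterate_succ_apply, mul_assoc]
  obtain ⟨c, hc⟩ := hirr (U ^ o) (fun d => by rw [hrelm, hφo])
  obtain ⟨w, hw⟩ := IsAlgClosed.exists_pow_nat_eq c ho
  have hUint : IsIntegral ℤ U := by
    let f : MonoidAlgebra ℤ D →ₐ[ℤ] Matrix (Fin n) (Fin n) KK := MonoidAlgebra.lift ℤ _ D r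
    have h1 : f (∑ b ∈ B, MonoidAlgebra.of ℤ D b) = U := by
      rw [map_sum, hU]
      refine Finset.sum_congr rfl (fun b _ => ?_)
      simp [f]
    rw [← h1]
    exact (Algebra.IsIntegral.isIntegral (R := ℤ) _).map f
  have hcint : IsIntegral ℤ c := by
    have h1 : IsIntegral ℤ (algebraMap KK (Matrix (Fin n) (Fin n) KK) c) := hc ▸ hUint.pow o
    exact (isIntegral_algebraMap_iff (FaithfulSMul.algebraMap_injective _ _)).1 h1
  have hwint : IsIntegral ℤ w := IsIntegral.of_pow ho (hw ▸ hcint)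
  have hcomm : Commute U V := hUV.trans hVU.symm
  have hUVo : U ^ o * V ^ o = 1 := by rw [← hcomm.mul_pow, hUV, one_pow]
  have hw0 : w ≠ 0 := by
    rintro rfl
    rw [zero_pow ho.ne'] at hw
    rw [hc, ← hw, map_zero, zero_mul] at hUVo
    exact zero_ne_one hUVo
  have hWo : (w • V) ^ o = 1 := by
    rw [_root_.smul_pow, hw, Algebra.smul_def, ← hc, hUVo]
  have hWint := kz_trace_integral (w • V) o ho hWo
  have hnb : (w • V).trace = (n : KK) * (w / p ^ a) := by
    rw [Matrix.trace_smul, smul_eq_mul, htr]; field_simp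
  have hbint : IsIntegral ℤ (w / p ^ a : KK) := by
    have hco : IsCoprime (n : ℤ) ((p ^ a : ℕ) : ℤ) := by
      rw [Nat.isCoprime_iff_coprime]
      exact (((Nat.Prime.coprime_iff_not_dvd hp).2 hpn).pow_left a).symm
    obtain ⟨x, y, hxy⟩ := hco
    have hxy' : (x : KK) * n + y * p ^ a = 1 := by exact_mod_cast congrArg (Int.cast : ℤ → KK) hxy
    have : (w / p ^ a : KK) = x * (w • V).trace + y * w := by
      rw [hnb]
      field_simp
      linear_combination (-1 : KK) * hxy'
    rw [this]
    exact ((isIntegral_algebraMap (R := ℤ) (x := x)).mul hWint).add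
      ((isIntegral_algebraMap (R := ℤ) (x := y)).mul hwint)
  have hsc := kz_scalar (w • V) o ho hWo _ hbint (div_ne_zero hw0 hpa) hnb
  intro d
  have h3 : (w • V) * r d = r d * (w • V) := by
    rw [hsc, Algebra.commutes]
  have h4 : V * r d = r d * V := by
    rw [Matrix.smul_mul, Matrix.mul_smul] at h3
    exact smul_right_injective _ hw0 h3
  rw [hphi, h4, mul_assoc, hVU, mul_one]


lemma kz_restrict_root {V : Type*} [AddCommGroup V] [Module KK V] [FiniteDimensional KK V]
    (F : Module.End KK V) (W : Submodule KK V) (hW : ∀ x ∈ W, F x ∈ W) (g : KK[X])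
    (hann : ∀ x ∈ W, aeval F g x = 0) (μ : KK) (hμ : μ ∈ (F.restrict hW).charpoly.roots) :
    g.eval μ = 0 := by
  have h1 : Module.End.HasEigenvalue (F.restrict hW) μ := by
    rw [Module.End.hasEigenvalue_iff_isRoot_charpoly]
    exact isRoot_of_mem_roots hμ
  obtain ⟨v, hv⟩ := h1.exists_hasEigenvector
  have hv1 : F (v : V) = μ • (v : V) := by
    have := hv.apply_eq_smul
    simpa using congrArg Subtype.val this
  have hv0 : (v : V) ≠ 0 := fun h => hv.2 (Subtype.ext h)
  have hv2 : Module.End.HasEigenvector F μ (v : V) :=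
    ⟨Module.End.mem_eigenspace_iff.2 hv1, hv0⟩
  have h3 := Module.End.aeval_apply_of_hasEigenvector (p := g) hv2
  rw [hann _ v.2] at h3
  exact (smul_eq_zero.1 h3.symm).resolve_right hv0

lemma kz_lift_multiset {α β : Type*} (f : α → β) (P : α → Prop) (s : Multiset β)
    (h : ∀ x ∈ s, ∃ y, P y ∧ f y = x) : ∃ s' : Multiset α, s'.map f = s ∧ ∀ y ∈ s', P y := by
  induction s using Multiset.induction_on with
  | empty => exact ⟨0, by simp⟩
  | cons a s ih =>
    obtain ⟨s', h1, h2⟩ := ih (fun x hx => h x (Multiset.mem_cons_of_mem hx))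
    obtain ⟨y, hy, rfl⟩ := h a (Multiset.mem_cons_self _ _)
    refine ⟨y ::ₘ s', by simp [h1], ?_⟩
    intro z hz
    rcases Multiset.mem_cons.1 hz with rfl | hz
    · exact hy
    · exact h2 z hz

lemma kz_charpoly_restrict {V : Type*} [AddCommGroup V] [Module KK V] [FiniteDimensional KK V]
    (F : Module.End KK V) (W W' : Submodule KK V) (hc : IsCompl W W') (hW : ∀ x ∈ W, F x ∈ W)
    (hW' : ∀ x ∈ W', F x ∈ W') :
    F.charpoly = (F.restrict hW).charpoly * (F.restrict hW').charpoly := by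
  rw [← LinearMap.charpoly_prodMap,
    ← LinearEquiv.charpoly_conj (Submodule.prodEquivOfIsCompl W W' hc)]
  congr 1
  apply LinearMap.ext
  intro x
  obtain ⟨y, rfl⟩ := (Submodule.prodEquivOfIsCompl W W' hc).surjective x
  simp [LinearEquiv.conj_apply]

lemma kz_count {O : Type*} [CommRing O] [IsDomain O] [Algebra O KK]
    (hinj : Function.Injective (algebraMap O KK)) {k : Type*} [Field k] (f : O →+* k)
    {ι : Type*} [Fintype ι] [DecidableEq ι] (A : Matrix ι ι O) (E : Matrix ι ι KK)
    (hE : E * E = E) (hcomm : A.map (algebraMap O KK) * E = E * A.map (algebraMap O KK))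
    {J : Type*} (t : J → O) (S S' : Finset J)
    (hS : ∀ i ∈ S, f (t i) ≠ 0) (hS' : ∀ i ∈ S', f (t i) = 0)
    (h1 : aeval (A.map (algebraMap O KK)) (∏ i ∈ S, (X - C (algebraMap O KK (t i)))) * E = 0)
    (h2 : aeval (A.map (algebraMap O KK)) (∏ i ∈ S', (X - C (algebraMap O KK (t i)))) * (1 - E) = 0) :
    ∃ m : ℕ, E.trace = m ∧ m + (A.map f).charpoly.rootMultiplicity 0 = Fintype.card ι := by
  classical
  set A' := A.map (algebraMap O KK) with hA'
  set F : Module.End KK (ι → KK) := Matrix.toLinAlgEquiv' A' with hF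
  set e : Module.End KK (ι → KK) := Matrix.toLinAlgEquiv' E with he
  have hee : IsIdempotentElem e := by
    change e * e = e
    rw [he, ← map_mul, hE]
  have hFe : F * e = e * F := by rw [hF, he, ← map_mul, ← map_mul, hcomm]
  have hcompl := LinearMap.IsIdempotentElem.isCompl hee
  have hW : ∀ x ∈ LinearMap.range e, F x ∈ LinearMap.range e := by
    rintro _ ⟨y, rfl⟩
    exact ⟨F y, (LinearMap.congr_fun hFe y).symm⟩
  have hW' : ∀ x ∈ LinearMap.ker e, F x ∈ LinearMap.ker e := by
    intro x hx
    have := LinearMap.congr_fun hFe x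
    simp only [Module.End.mul_apply, LinearMap.mem_ker] at *
    rw [← this, hx, map_zero]
  have hch := kz_charpoly_restrict F _ _ hcompl hW hW'
  have haev : ∀ q : KK[X], Matrix.toLinAlgEquiv' (aeval A' q) = aeval F q := by
    intro q
    exact (aeval_algHom_apply (Matrix.toLinAlgEquiv' : Matrix ι ι KK ≃ₐ[KK] _) A' q).symm
  have hr1 : ∀ x ∈ (F.restrict hW).charpoly.roots, ∃ y, f y ≠ 0 ∧ algebraMap O KK y = x := by
    intro μ hμ
    have := kz_restrict_root F _ hW (∏ i ∈ S, (X - C (algebraMap O KK (t i)))) (by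
      rintro _ ⟨y, rfl⟩
      have h3 := congrArg (fun M => Matrix.toLinAlgEquiv' M y) h1
      simp only [map_mul, map_zero, haev] at h3
      exact h3) μ hμ
    rw [eval_prod, Finset.prod_eq_zero_iff] at this
    obtain ⟨i, hi, h⟩ := this
    exact ⟨t i, hS i hi, (sub_eq_zero.1 (by simpa using h)).symm⟩
  have hr2 : ∀ x ∈ (F.restrict hW').charpoly.roots, ∃ y, f y = 0 ∧ algebraMap O KK y = x := by
    intro μ hμ
    have := kz_restrict_root F _ hW' (∏ i ∈ S', (X - C (algebraMap O KK (t i)))) (by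
      intro y hy
      have h3 := congrArg (fun M => Matrix.toLinAlgEquiv' M y) h2
      simp only [map_mul, map_zero, haev, map_sub, map_one] at h3
      rw [← he] at h3
      simp only [Module.End.mul_apply, LinearMap.sub_apply, Module.End.one_apply,
        LinearMap.mem_ker.1 hy, sub_zero] at h3
      exact h3) μ hμ
    rw [eval_prod, Finset.prod_eq_zero_iff] at this
    obtain ⟨i, hi, h⟩ := this
    exact ⟨t i, hS' i hi, (sub_eq_zero.1 (by simpa using h)).symm⟩
  obtain ⟨s1, hs1, hs1f⟩ := kz_lift_multiset _ _ _ hr1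
  obtain ⟨s2, hs2, hs2f⟩ := kz_lift_multiset _ _ _ hr2
  have hsp1 : (F.restrict hW).charpoly.Splits := IsAlgClosed.splits _
  have hsp2 : (F.restrict hW').charpoly.Splits := IsAlgClosed.splits _
  have hchO : A.charpoly = (s2.map (fun a => X - C a)).prod * (s1.map (fun a => X - C a)).prod := by
    apply map_injective _ hinj
    rw [← Matrix.charpoly_map, ← hA', ← Matrix.charpoly_toLin']
    change F.charpoly = _
    rw [hch, hsp1.eq_prod_roots_of_monic (LinearMap.charpoly_monic _),
      hsp2.eq_prod_roots_of_monic (LinearMap.charpoly_monic _), ← hs1, ← hs2, Polynomial.map_mul,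
      Polynomial.map_multiset_prod, Polynomial.map_multiset_prod]
    simp [Multiset.map_map, mul_comm]
  have hroots : (A.map f).charpoly.roots = s2.map f + s1.map f := by
    rw [Matrix.charpoly_map, hchO, Polynomial.map_mul,
      Polynomial.map_multiset_prod, Polynomial.map_multiset_prod]
    have : ∀ s : Multiset O, Multiset.map (Polynomial.map f) (Multiset.map (fun a => X - C a) s) =
        Multiset.map (fun a => X - C a) (s.map f) := by
      intro s; simp [Multiset.map_map]
    rw [this, this, ← Multiset.prod_add, ← Multiset.map_add, roots_multiset_prod_X_sub_C]
  have hmult : (A.map f).charpoly.rootMultiplicity 0 = s2.card := by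
    rw [← count_roots, hroots, Multiset.count_add]
    have e1 : Multiset.count 0 (s1.map f) = 0 := by
      rw [Multiset.count_eq_zero]
      intro h
      obtain ⟨y, hy, h⟩ := Multiset.mem_map.1 h
      exact hs1f y hy h
    have e2 : s2.map f = Multiset.replicate s2.card 0 := by
      rw [Multiset.eq_replicate]
      refine ⟨by simp, ?_⟩
      intro b hb
      obtain ⟨y, hy, rfl⟩ := Multiset.mem_map.1 hb
      exact hs2f y hy
    rw [e1, e2, Multiset.count_replicate_self]; simp
  have hc1 : s1.card = Module.finrank KK (LinearMap.range e) := by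
    have := hsp1.natDegree_eq_card_roots
    rw [LinearMap.charpoly_natDegree, ← hs1] at this
    simpa using this.symm
  have hc2 : s2.card = Module.finrank KK (LinearMap.ker e) := by
    have := hsp2.natDegree_eq_card_roots
    rw [LinearMap.charpoly_natDegree, ← hs2] at this
    simpa using this.symm
  refine ⟨Module.finrank KK (LinearMap.range e), ?_, ?_⟩
  · have h3 := (LinearMap.IsIdempotentElem.isProj_range e hee).trace
    rw [← h3, he]
    exact (Matrix.trace_toLin'_eq E).symm
  · rw [hmult, hc2, LinearMap.finrank_range_add_finrank_ker]; simp

open Classical in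
/-- The monomial representation induced from a linear character of a subgroup. -/
noncomputable def kzInd {D : Type*} [Group D] [Finite D] (Y : Subgroup D) [Fintype (D ⧸ Y)] [DecidableEq (D ⧸ Y)]
    {R : Type*} [CommRing R] (l : Y →* R) : D →* Matrix (D ⧸ Y) (D ⧸ Y) R where
  toFun d := Matrix.of fun i j => if h : i.out⁻¹ * d * j.out ∈ Y then l ⟨_, h⟩ else 0
  map_one' := by
    ext i j
    have hiff : i.out⁻¹ * 1 * j.out ∈ Y ↔ i = j := by
      rw [mul_one, ← QuotientGroup.eq, QuotientGroup.out_eq', QuotientGroup.out_eq']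
    rw [Matrix.of_apply, Matrix.one_apply]
    by_cases hij : i = j
    · subst hij
      rw [dif_pos (hiff.2 rfl), if_pos rfl]
      have : (⟨i.out⁻¹ * 1 * i.out, hiff.2 rfl⟩ : Y) = 1 := Subtype.ext (by simp)
      rw [this, map_one]
    · rw [dif_neg (fun h => hij (hiff.1 h)), if_neg hij]
  map_mul' d d' := by
    ext i k
    rw [Matrix.mul_apply]
    simp only [Matrix.of_apply]
    set j0 : D ⧸ Y := ((d' * k.out : D) : D ⧸ Y) with hj0
    have hj0mem : j0.out⁻¹ * d' * k.out ∈ Y := by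
      rw [mul_assoc, ← QuotientGroup.eq, QuotientGroup.out_eq']
    rw [Finset.sum_eq_single j0]
    · rw [dif_pos hj0mem]
      have hprod : i.out⁻¹ * (d * d') * k.out = (i.out⁻¹ * d * j0.out) * (j0.out⁻¹ * d' * k.out) := by
        group
      by_cases h : i.out⁻¹ * d * j0.out ∈ Y
      · have h' : i.out⁻¹ * (d * d') * k.out ∈ Y := hprod ▸ Y.mul_mem h hj0mem
        rw [dif_pos h, dif_pos h', ← map_mul]
        congr 1
        exact Subtype.ext hprod
      · have h' : ¬ i.out⁻¹ * (d * d') * k.out ∈ Y := by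
          rw [hprod, Subgroup.mul_mem_cancel_right _ hj0mem]; exact h
        rw [dif_neg h, dif_neg h', zero_mul]
    · intro j _ hj
      rw [dif_neg (c := j.out⁻¹ * d' * k.out ∈ Y), mul_zero]
      intro h
      apply hj
      rw [mul_assoc, ← QuotientGroup.eq, QuotientGroup.out_eq'] at h
      exact h
    · intro h; exact absurd (Finset.mem_univ _) h

lemma kzInd_map {D : Type*} [Group D] [Finite D] (Y : Subgroup D) [Fintype (D ⧸ Y)] [DecidableEq (D ⧸ Y)]
    {R R' : Type*} [CommRing R] [CommRing R'] (f : R →+* R') (l : Y →* R) (d : D) :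
    (kzInd Y l d).map f = kzInd Y ((f : R →* R').comp l) d := by
  ext i j
  simp only [kzInd, MonoidHom.coe_mk, OneHom.coe_mk, Matrix.map_apply, Matrix.of_apply]
  split_ifs <;> simp

lemma kzInd_trace {D : Type*} [Group D] [Fintype D] (Y : Subgroup D) [Fintype (D ⧸ Y)] [DecidableEq (D ⧸ Y)] [Fintype Y]
    {R : Type*} [CommRing R] (l : Y →* R) (e : MonoidAlgebra R D)
    (he : ∀ x d, e.coeff (x * d * x⁻¹) = e.coeff d) :
    (MonoidAlgebra.lift R (Matrix (D ⧸ Y) (D ⧸ Y) R) D (kzInd Y l) e).trace =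
      (Fintype.card (D ⧸ Y) : R) * ∑ c : Y, e.coeff c * l c := by
  classical
  have h1 : MonoidAlgebra.lift R (Matrix (D ⧸ Y) (D ⧸ Y) R) D (kzInd Y l) e
      = ∑ d : D, e.coeff d • kzInd Y l d := by
    rw [MonoidAlgebra.lift_apply, Finsupp.sum_fintype]
    simp
  rw [h1, Matrix.trace_sum]
  simp only [Matrix.trace_smul]
  simp only [Matrix.trace, Matrix.diag_apply, smul_eq_mul, Finset.mul_sum]
  rw [Finset.sum_comm]
  have h2 : ∀ i : D ⧸ Y, ∑ d : D, e.coeff d * kzInd Y l d i i = ∑ c : Y, e.coeff c * l c := by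
    intro i
    rw [← Equiv.sum_comp (MulAut.conj i.out).toEquiv]
    have h3 : ∀ d : D, e.coeff ((MulAut.conj i.out).toEquiv d) *
        kzInd Y l ((MulAut.conj i.out).toEquiv d) i i =
        if h : d ∈ Y then e.coeff d * l ⟨d, h⟩ else 0 := by
      intro d
      have hd : i.out⁻¹ * (i.out * d * i.out⁻¹) * i.out = d := by group
      simp only [MulEquiv.toEquiv_eq_coe, MulEquiv.coe_toEquiv, MulAut.conj_apply, he]
      simp only [kzInd, MonoidHom.coe_mk, OneHom.coe_mk, Matrix.of_apply, hd]
      split_ifs <;> simp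
    rw [Finset.sum_congr rfl (fun d _ => h3 d)]
    symm
    refine Fintype.sum_of_injective (Subtype.val : Y → D) Subtype.val_injective _ _ ?_ ?_
    · intro d hd
      rw [dif_neg]
      intro h
      exact hd ⟨⟨d, h⟩, rfl⟩
    · intro c
      rw [dif_pos c.2]
  rw [Finset.sum_congr rfl (fun i _ => h2 i)]
  simp [Finset.mul_sum]

lemma kz_central_coeff {D : Type*} [Group D] (e : MonoidAlgebra KK D)
    (hc : ∀ x, x * e = e * x) (x d : D) : e.coeff (x * d * x⁻¹) = e.coeff d := by
  have h := hc (MonoidAlgebra.single x 1)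
  have h2 := congrArg (fun z : MonoidAlgebra KK D => z.coeff (x * d)) h
  simp only [MonoidAlgebra.coeff_single_mul_apply, MonoidAlgebra.coeff_mul_single_apply] at h2
  simpa using h2.symm

lemma kz_vanish {O : Type*} [CommRing O] [IsDomain O] [Algebra O KK]
    (hinj : Function.Injective (algebraMap O KK))
    (hintegral : ∀ x : KK, IsIntegral ℤ x → ∃ o : O, algebraMap O KK o = x)
    {k : Type*} [Field k] (f : O →+* k) (r : ℕ) (hr : r.Prime) [CharP k r]
    {D : Type*} [Group D] [Finite D] (e : MonoidAlgebra KK D) (hee : e * e = e)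
    (hc : ∀ x, x * e = e * x) {J' : Type*} [Fintype J'] (x : J' → D) (T : MonoidAlgebra KK D)
    (hT : T = ∑ j, MonoidAlgebra.of KK D (x j))
    {J : Type*} (t : J → O) (S S' : Finset J)
    (hS : ∀ i ∈ S, f (t i) ≠ 0) (hS' : ∀ i ∈ S', f (t i) = 0)
    (h1 : aeval T (∏ i ∈ S, (X - C (algebraMap O KK (t i)))) * e = 0)
    (h2 : aeval T (∏ i ∈ S', (X - C (algebraMap O KK (t i)))) * (1 - e) = 0)
    (y : D) (hy : orderOf y = r) : e.coeff y = 0 := by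
  classical
  have := Fintype.ofFinite D
  set Y := Subgroup.zpowers y with hY
  have := Fintype.ofFinite (D ⧸ Y)
  have := Fintype.ofFinite Y
  set A1 : Matrix (D ⧸ Y) (D ⧸ Y) k := ∑ j, kzInd Y (1 : Y →* k) (x j) with hA1
  set m := Fintype.card (D ⧸ Y) - A1.charpoly.rootMultiplicity 0 with hm
  have hcardY : Nat.card Y = r := by rw [hY, Nat.card_zpowers, hy]
  have hpos : (Fintype.card (D ⧸ Y) : KK) ≠ 0 := by
    have : Fintype.card (D ⧸ Y) ≠ 0 := Fintype.card_ne_zero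
    exact_mod_cast this
  have key : ∀ z : KK, z ^ r = 1 →
      (Fintype.card (D ⧸ Y) : KK) * ∑ i ∈ Finset.range r, e.coeff (y ^ i) * z ^ i = m := by
    intro z hz
    obtain ⟨o, ho⟩ := hintegral z ⟨X ^ r - 1, monic_X_pow_sub_C 1 hr.ne_zero, by simp [hz]⟩
    have hor : o ^ r = 1 := hinj (by rw [map_pow, ho, hz, map_one])
    have hfo : f o = 1 := by
      have : (f o) ^ r = 1 := by rw [← map_pow, hor, map_one]
      have := Fact.mk hr
      have h3 : (f o - 1) ^ r = 0 := by rw [sub_pow_char]; simp [*]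
      exact sub_eq_zero.1 (pow_eq_zero_iff hr.ne_zero |>.1 h3)
    set ou : Oˣ := Units.ofPowEqOne o r hor hr.ne_zero with hou
    have hgen : ∀ c : Y, c ∈ Subgroup.zpowers (⟨y, Subgroup.mem_zpowers y⟩ : Y) := by
      rintro ⟨c, hc⟩
      obtain ⟨n, rfl⟩ := Subgroup.mem_zpowers_iff.1 hc
      exact Subgroup.mem_zpowers_iff.2 ⟨n, Subtype.ext (by simp)⟩
    set lu : Y →* Oˣ := monoidHomOfForallMemZpowers hgen (g' := ou) (by
      rw [Subgroup.orderOf_mk, hy]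
      exact orderOf_dvd_of_pow_eq_one (Units.ext (by simp [hou]))) with hlu
    set l : Y →* O := (Units.coeHom O).comp lu with hl
    have hly : l ⟨y, Subgroup.mem_zpowers y⟩ = o := by
      rw [hl, MonoidHom.comp_apply, hlu, monoidHomOfForallMemZpowers_apply_gen]; simp [hou]
    have hlpow : ∀ i : ℕ, l (⟨y, Subgroup.mem_zpowers y⟩ ^ i) = o ^ i := by
      intro i; rw [map_pow, hly]
    set l' : Y →* KK := ((algebraMap O KK : O →+* KK) : O →* KK).comp l with hl'
    have hfl : ((f : O →+* k) : O →* k).comp l = 1 := by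
      ext c
      obtain ⟨n, rfl⟩ := mem_powers_iff_mem_zpowers.2 (hgen c)
      change f (l (⟨y, Subgroup.mem_zpowers y⟩ ^ n)) = 1
      rw [hlpow, map_pow, hfo, one_pow]
    set A : Matrix (D ⧸ Y) (D ⧸ Y) O := ∑ j, kzInd Y l (x j) with hA
    have hAf : A.map f = A1 := by
      change f.mapMatrix A = A1
      rw [hA, map_sum]
      refine Finset.sum_congr rfl fun j _ => ?_
      change (kzInd Y l (x j)).map f = _
      rw [kzInd_map, hfl]
    set G := MonoidAlgebra.lift KK (Matrix (D ⧸ Y) (D ⧸ Y) KK) D (kzInd Y l') with hG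
    have hAK : A.map (algebraMap O KK) = G T := by
      change (algebraMap O KK).mapMatrix A = _
      rw [hA, map_sum, hT, map_sum]
      refine Finset.sum_congr rfl fun j _ => ?_
      change (kzInd Y l (x j)).map (algebraMap O KK) = _
      rw [kzInd_map, hG, MonoidAlgebra.lift_of]
    obtain ⟨n, hn1, hn2⟩ := kz_count hinj f A (G e) (by rw [← map_mul, hee])
      (by rw [hAK, ← map_mul, ← map_mul, hc]) t S S' hS hS'
      (by rw [hAK, aeval_algHom_apply, ← map_mul, h1, map_zero])
      (by rw [hAK, aeval_algHom_apply, ← map_one G, ← map_sub, ← map_mul, h2, map_zero])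
    rw [hAf] at hn2
    have hnm : n = m := by omega
    rw [← hnm, ← hn1, hG, kzInd_trace Y l' e (kz_central_coeff e hc)]
    congr 1
    symm
    have hbij : Function.Bijective (fun i : Fin r => ((⟨y, Subgroup.mem_zpowers y⟩ : Y) ^ (i : ℕ))) := by
      rw [Fintype.bijective_iff_injective_and_card]
      constructor
      · intro i j hij
        have h3 : y ^ (i : ℕ) = y ^ (j : ℕ) := by simpa using congrArg Subtype.val hij
        rw [pow_inj_mod, hy, Nat.mod_eq_of_lt i.2, Nat.mod_eq_of_lt j.2] at h3
        exact Fin.ext h3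
      · rw [Fintype.card_fin, ← Nat.card_eq_fintype_card, hcardY]
    rw [Finset.sum_range, ← Function.Bijective.sum_comp hbij]
    refine Finset.sum_congr rfl fun i _ => ?_
    rw [hl', MonoidHom.comp_apply, hlpow]
    simp [ho]
  set P : KK[X] := ∑ i ∈ Finset.range r, C (e.coeff (y ^ i)) * X ^ i
    - C ((m : KK) / (Fintype.card (D ⧸ Y) : KK)) with hP
  have hPr : ∀ z : KK, z ^ r = 1 → P.eval z = 0 := by
    intro z hz
    rw [hP, eval_sub, eval_finsetSum, eval_C, sub_eq_zero, eq_div_iff hpos, ← key z hz, mul_comm]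
    simp
  have hdeg : P.natDegree < r := by
    have h3 : P.natDegree ≤ r - 1 := by
      refine (natDegree_sub_le_iff_left (by simp)).2 ?_
      refine natDegree_sum_le_of_forall_le _ _ fun i hi => ?_
      have := Finset.mem_range.1 hi
      exact (natDegree_C_mul_X_pow_le _ _).trans (by omega)
    have := hr.pos
    omega
  have hP0 : P = 0 := by
    have : NeZero r := ⟨hr.ne_zero⟩
    obtain ⟨ζ, hζ⟩ := HasEnoughRootsOfUnity.exists_primitiveRoot KK r
    refine Polynomial.eq_zero_of_natDegree_lt_card_of_eval_eq_zero' P (nthRootsFinset r (1:KK)) ?_ ?_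
    · intro z hz
      exact hPr z ((mem_nthRootsFinset hr.pos 1).1 hz)
    · rw [hζ.card_nthRootsFinset]; exact hdeg
  have h3 : P.coeff 1 = e.coeff y := by
    rw [hP, coeff_sub, finsetSum_coeff, coeff_C]
    simp [coeff_X_pow, hr.one_lt]
  rw [← h3, hP0, coeff_zero]


lemma kz_nonint (q : ℕ) (hq : q.Prime) (x : KK) (hx : IsIntegral ℤ x) : (q : KK) * x ≠ 1 := by
  intro h
  have hq0 : (q : KK) ≠ 0 := by exact_mod_cast hq.ne_zero
  have h1 : x = algebraMap ℚ KK (1 / q) := by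
    simp only [one_div, map_inv₀, map_natCast]
    field_simp
    rw [mul_comm]; exact h
  rw [h1, isIntegral_algebraMap_iff (algebraMap ℚ KK).injective, IsIntegrallyClosed.isIntegral_iff] at hx
  obtain ⟨y, hy⟩ := hx
  have hq0 : (q : ℚ) ≠ 0 := by exact_mod_cast hq.ne_zero
  have h2 : (y * q : ℤ) = 1 := by
    have : (y : ℚ) = 1 / q := by simpa using hy
    have : (y : ℚ) * q = 1 := by rw [this]; field_simp
    exact_mod_cast this
  have h3 : (q : ℤ) ∣ 1 := ⟨y, by rw [mul_comm, h2]⟩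
  have h4 : q ∣ 1 := by exact_mod_cast h3
  exact hq.one_lt.ne' (Nat.dvd_one.1 h4)

lemma kz_reg_trace {D : Type*} [Group D] [Fintype D] {N : ℕ} (n : Fin N → ℕ)
    (Ψ : MonoidAlgebra KK D ≃ₐ[KK] ((i : Fin N) → Matrix (Fin (n i)) (Fin (n i)) KK))
    (w : MonoidAlgebra KK D) :
    (Fintype.card D : KK) * w.coeff 1 = ∑ i, (n i : KK) * (Ψ w i).trace := by
  classical
  have h1 : LinearMap.trace KK _ (LinearMap.mulLeft KK w) = (Fintype.card D : KK) * w.coeff 1 := by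
    rw [LinearMap.trace_eq_matrix_trace KK (MonoidAlgebra.basis D KK)]
    simp only [Matrix.trace, Matrix.diag_apply, LinearMap.toMatrix_apply, LinearMap.mulLeft_apply]
    have : ∀ d : D, ((MonoidAlgebra.basis D KK).repr (w * (MonoidAlgebra.basis D KK) d)) d = w.coeff 1 := by
      intro d
      simp [MonoidAlgebra.basis]
    rw [Finset.sum_congr rfl (fun d _ => this d)]
    simp
  have h2 : LinearMap.trace KK _ (LinearMap.mulLeft KK (Ψ w)) = ∑ i, (n i : KK) * (Ψ w i).trace := by
    rw [LinearMap.trace_eq_matrix_trace KK (Pi.basis fun i => Matrix.stdBasis KK (Fin (n i)) (Fin (n i)))]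
    simp only [Matrix.trace, Matrix.diag_apply, LinearMap.toMatrix_apply, LinearMap.mulLeft_apply]
    rw [Fintype.sum_sigma]
    refine Finset.sum_congr rfl fun i _ => ?_
    rw [Fintype.sum_prod_type, Finset.mul_sum]
    refine Finset.sum_congr rfl fun a _ => ?_
    have : ∀ b, ((Pi.basis fun i => Matrix.stdBasis KK (Fin (n i)) (Fin (n i))).repr
        (Ψ w * (Pi.basis fun i => Matrix.stdBasis KK (Fin (n i)) (Fin (n i))) ⟨i, (a, b)⟩)) ⟨i, (a, b)⟩
        = Ψ w i a a := by
      intro b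
      rw [Pi.basis_repr, Pi.mul_apply, Pi.basis_apply, Pi.single_eq_same, Matrix.stdBasis_eq_single]
      simp [Matrix.stdBasis]
    simp only [this]
    simp
  rw [← h1, ← h2, ← LinearMap.trace_conj' (LinearMap.mulLeft KK w) Ψ.toLinearEquiv]
  congr 1
  refine LinearMap.ext fun v => ?_
  simp [LinearEquiv.conj_apply]

lemma kz_matrix_scalar {n : ℕ} (A : Matrix (Fin n) (Fin n) KK) (h : ∀ M, A * M = M * A) :
    ∃ c : KK, A = algebraMap KK _ c := by
  obtain ⟨c, hc⟩ := Matrix.mem_range_scalar_of_commute_single (M := A) (fun i j _ => (h _).symm)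
  exact ⟨c, by rw [← hc]; rfl⟩

lemma kz_twist {D : Type*} [Group D] (φ : D ≃* D) (B : Finset D)
    (hB : ∀ b, b ∈ B ↔ ∃ x, b = x * (φ x)⁻¹) (d : D) :
    ∃ σ : Equiv.Perm D, (∀ b, b ∈ B ↔ σ b ∈ B) ∧ ∀ b, d * b = σ b * φ d := by
  refine ⟨(Equiv.mulLeft d).trans (Equiv.mulRight (φ d)⁻¹), ?_, ?_⟩
  · intro b
    simp only [Equiv.trans_apply, Equiv.coe_mulLeft, Equiv.coe_mulRight]
    rw [hB, hB]
    constructor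
    · rintro ⟨x, rfl⟩; exact ⟨d * x, by simp [mul_assoc]⟩
    · rintro ⟨x, hx⟩; refine ⟨d⁻¹ * x, ?_⟩
      have : b = d⁻¹ * (d * b * (φ d)⁻¹) * φ d := by group
      rw [this, hx]; simp [mul_assoc]
  · intro b; simp

lemma kz_T_central {D : Type*} [Group D] (φ : D ≃* D) (B : Finset D)
    (hB : ∀ b, b ∈ B ↔ ∃ x, b = x * (φ x)⁻¹) (v : MonoidAlgebra KK D) :
    v * ((∑ b ∈ B, MonoidAlgebra.of KK D b) * (∑ b ∈ B, MonoidAlgebra.of KK D b⁻¹)) =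
    ((∑ b ∈ B, MonoidAlgebra.of KK D b) * (∑ b ∈ B, MonoidAlgebra.of KK D b⁻¹)) * v := by
  induction v using MonoidAlgebra.induction_on with
  | of d =>
    obtain ⟨σ, hσ1, hσ2⟩ := kz_twist φ B hB d
    have h1 : MonoidAlgebra.of KK D d * (∑ b ∈ B, MonoidAlgebra.of KK D b) =
        (∑ b ∈ B, MonoidAlgebra.of KK D b) * MonoidAlgebra.of KK D (φ d) := by
      rw [Finset.mul_sum, Finset.sum_mul]
      refine Finset.sum_bij (fun b _ => σ b) (fun b hb => (hσ1 b).1 hb) (fun _ _ _ _ h => σ.injective h) ?_ ?_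
      · intro b hb; exact ⟨σ.symm b, (hσ1 _).2 (by simpa using hb), by simp⟩
      · intro b _; rw [← map_mul, ← map_mul, hσ2]
    have h2 : MonoidAlgebra.of KK D (φ d) * (∑ b ∈ B, MonoidAlgebra.of KK D b⁻¹) =
        (∑ b ∈ B, MonoidAlgebra.of KK D b⁻¹) * MonoidAlgebra.of KK D d := by
      rw [Finset.mul_sum, Finset.sum_mul]
      refine Finset.sum_bij (fun b _ => σ b) (fun b hb => (hσ1 b).1 hb) (fun _ _ _ _ h => σ.injective h) ?_ ?_
      · intro b hb; exact ⟨σ.symm b, (hσ1 _).2 (by simpa using hb), by simp⟩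
      · intro b _; rw [← map_mul, ← map_mul]
        congr 1
        have := hσ2 b
        rw [eq_inv_mul_iff_mul_eq, ← mul_assoc, ← this]; group
    rw [← mul_assoc, h1, mul_assoc, h2, ← mul_assoc]
  | add x y hx hy => rw [add_mul, mul_add, hx, hy]
  | smul r x hx => rw [smul_mul_assoc, hx, mul_smul_comm]


lemma kz_residue (r : ℕ) (hr : r.Prime) : ∃ (k : Type) (_ : Field k) (_ : CharP k r)
    (_ : integralClosure ℤ KK →+* k), True := by
  have hne : Ideal.span {(r : integralClosure ℤ KK)} ≠ ⊤ := by
    intro h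
    rw [Ideal.span_singleton_eq_top] at h
    obtain ⟨u, hu⟩ := h
    have h1 : (r : integralClosure ℤ KK) * ((u⁻¹ : (integralClosure ℤ KK)ˣ) : integralClosure ℤ KK) = 1 := by
      rw [← hu]; simp
    refine kz_nonint (KK := KK) r hr (((u⁻¹ : (integralClosure ℤ KK)ˣ) : integralClosure ℤ KK) : KK)
      (((u⁻¹ : (integralClosure ℤ KK)ˣ) : integralClosure ℤ KK)).2 ?_
    have := congrArg Subtype.val h1
    simpa using this
  obtain ⟨M, hM, hle⟩ := Ideal.exists_le_maximal _ hne
  let _ : Field (integralClosure ℤ KK ⧸ M) := Ideal.Quotient.field M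
  have hr0 : (r : integralClosure ℤ KK ⧸ M) = 0 := by
    rw [← map_natCast (Ideal.Quotient.mk M), Ideal.Quotient.eq_zero_iff_mem]
    exact hle (Ideal.mem_span_singleton_self _)
  refine ⟨integralClosure ℤ KK ⧸ M, inferInstance, ?_, Ideal.Quotient.mk M, trivial⟩
  have h2 := ringChar.dvd hr0
  rcases (Nat.dvd_prime hr).1 h2 with h | h
  · exact absurd h CharP.ringChar_ne_one
  · exact h ▸ ringChar.charP _

lemma kz_contra (KK : Type) [Field KK] [CharZero KK] [IsAlgClosed KK] [Algebra.IsAlgebraic ℚ KK]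
    {D : Type*} [Group D] [Finite D] (φ : D ≃* D) (B : Finset D)
    (hB : ∀ b, b ∈ B ↔ ∃ x, b = x * (φ x)⁻¹) (p a : ℕ) (hp : p.Prime) (hcard : B.card = p ^ a)
    (hgen : Subgroup.closure (B : Set D) = ⊤) (r : ℕ) (hr : r.Prime) (hrp : r ≠ p)
    (y : D) (hy : orderOf y = r) : False := by
  classical
  have := Fintype.ofFinite D
  obtain ⟨N, n, hn, ⟨Ψ⟩⟩ :=
    IsSemisimpleRing.exists_algEquiv_pi_matrix_of_isAlgClosed KK (MonoidAlgebra KK D)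
  obtain ⟨k, hk1, hk2, f, -⟩ := kz_residue (KK := KK) r hr
  let ρ : (i : Fin N) → MonoidAlgebra KK D →ₐ[KK] Matrix (Fin (n i)) (Fin (n i)) KK := fun i =>
    (Pi.evalAlgHom KK (fun i => Matrix (Fin (n i)) (Fin (n i)) KK) i).comp Ψ.toAlgHom
  have hρ : ∀ i w, ρ i w = Ψ w i := fun i w => rfl
  have hsurj : ∀ i M, ∃ w, ρ i w = M := by
    intro i M
    refine ⟨Ψ.symm (Pi.single i M), ?_⟩
    rw [hρ]; simp
  let rg : (i : Fin N) → D →* Matrix (Fin (n i)) (Fin (n i)) KK := fun i =>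
    ((ρ i : MonoidAlgebra KK D →* _)).comp (MonoidAlgebra.of KK D)
  have hrg : ∀ i d, rg i d = ρ i (MonoidAlgebra.of KK D d) := fun i d => rfl
  have hirr : ∀ i A, (∀ d, A * rg i d = rg i d * A) → ∃ c, A = algebraMap KK _ c := by
    intro i A hA
    refine kz_matrix_scalar A fun M => ?_
    obtain ⟨w, rfl⟩ := hsurj i M
    induction w using MonoidAlgebra.induction_on with
    | of d => exact hA d
    | add x y hx hy => rw [map_add, mul_add, add_mul, hx, hy]
    | smul c x hx => rw [map_smul, mul_smul_comm, hx, smul_mul_assoc]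
  have htriv : ∀ i, (∀ d, rg i d = 1) → ∀ w, ρ i w = algebraMap KK _ (MonoidAlgebra.lift KK KK D 1 w) := by
    intro i hi w
    induction w using MonoidAlgebra.induction_on with
    | of d => rw [← hrg, hi, MonoidAlgebra.lift_of]; simp
    | add x y hx hy => rw [map_add, map_add, map_add, hx, hy]
    | smul c x hx => rw [map_smul, map_smul, hx, Algebra.algebraMap_eq_smul_one, Algebra.algebraMap_eq_smul_one, smul_eq_mul, mul_smul]
  have htriv1 : ∀ i, (∀ d, rg i d = 1) → n i = 1 := by
    intro i hi
    by_contra hne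
    have hpos := (hn i).pos
    have h2 : 1 < n i := by omega
    obtain ⟨w, hw⟩ := hsurj i (Matrix.single ⟨0, by omega⟩ ⟨1, h2⟩ 1)
    rw [htriv i hi] at hw
    have := congrFun (congrFun hw ⟨0, by omega⟩) ⟨1, h2⟩
    simp [Matrix.algebraMap_matrix_apply] at this
  have huniq : ∀ i j, (∀ d, rg i d = 1) → (∀ d, rg j d = 1) → i = j := by
    intro i j hi hj
    by_contra hne
    have h1 := htriv i hi (Ψ.symm (Pi.single i 1))
    have h2 := htriv j hj (Ψ.symm (Pi.single i 1))
    rw [hρ, AlgEquiv.apply_symm_apply] at h1 h2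
    rw [Pi.single_eq_same] at h1
    rw [Pi.single_eq_of_ne (Ne.symm hne)] at h2
    have h3 : MonoidAlgebra.lift KK KK D 1 (Ψ.symm (Pi.single i 1)) = 0 := by
      have := hn j
      exact (map_eq_zero_iff _ (FaithfulSMul.algebraMap_injective KK (Matrix (Fin (n j)) (Fin (n j)) KK))).1 h2.symm
    rw [h3, map_zero] at h1
    have := hn i
    exact one_ne_zero h1
  -- the trivial component
  obtain ⟨i0, hi0⟩ : ∃ i0, ∀ d, rg i0 d = 1 := by
    set av : MonoidAlgebra KK D := ∑ d : D, MonoidAlgebra.of KK D d with hav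
    have hl : ∀ d, MonoidAlgebra.of KK D d * av = av := by
      intro d
      rw [hav, Finset.mul_sum, ← Equiv.sum_comp (Equiv.mulLeft d) (fun d => MonoidAlgebra.of KK D d)]
      simp only [← map_mul, Equiv.coe_mulLeft]
    have hrr : ∀ d, av * MonoidAlgebra.of KK D d = av := by
      intro d
      rw [hav, Finset.sum_mul]
      rw [← Equiv.sum_comp (Equiv.mulRight d) (fun d => MonoidAlgebra.of KK D d)]
      simp only [← map_mul, Equiv.coe_mulRight]
    have hav0 : av ≠ 0 := by
      intro h
      have h1 : MonoidAlgebra.lift KK KK D 1 av = 0 := by rw [h, map_zero]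
      rw [hav, map_sum] at h1
      simp at h1
    have : ∃ i, ρ i av ≠ 0 := by
      by_contra! h
      apply hav0
      apply Ψ.injective
      rw [map_zero]
      funext i
      exact h i
    obtain ⟨i, hi⟩ := this
    refine ⟨i, fun d => ?_⟩
    obtain ⟨c, hc⟩ := hirr i (ρ i av) (fun d => by rw [hrg, ← map_mul, ← map_mul, hl, hrr])
    have hc0 : c ≠ 0 := by rintro rfl; exact hi (by rw [hc, map_zero])
    have h1 : rg i d * ρ i av = ρ i av := by rw [hrg, ← map_mul, hl]
    rw [hc, Algebra.algebraMap_eq_smul_one, mul_smul_comm, mul_one] at h1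
    exact smul_right_injective _ hc0 h1
  -- the central element
  set u : MonoidAlgebra KK D := ∑ b ∈ B, MonoidAlgebra.of KK D b with hu
  set u' : MonoidAlgebra KK D := ∑ b ∈ B, MonoidAlgebra.of KK D b⁻¹ with hu'
  set T := u * u' with hT
  have hTc : ∀ v, v * T = T * v := kz_T_central φ B hB
  let x : B × B → D := fun q => (q.1 : D) * (q.2 : D)⁻¹
  have hTx : T = ∑ q : B × B, MonoidAlgebra.of KK D (x q) := by
    rw [hT, hu, hu', Fintype.sum_prod_type, Finset.sum_mul, ← Finset.sum_coe_sort B]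
    refine Finset.sum_congr rfl fun b _ => ?_
    rw [Finset.mul_sum, ← Finset.sum_coe_sort B]
    refine Finset.sum_congr rfl fun b' _ => ?_
    rw [← map_mul]
  have ht : ∀ i, ∃ t : integralClosure ℤ KK, ρ i T = algebraMap KK _ (algebraMap (integralClosure ℤ KK) KK t) := by
    intro i
    obtain ⟨c, hc⟩ := hirr i (ρ i T) (fun d => by rw [hrg, ← map_mul, ← map_mul, hTc])
    have hintegral : IsIntegral ℤ c := by
      have h1 : IsIntegral ℤ (∑ q : B × B, MonoidAlgebra.of ℤ D (x q)) := IsIntegral.of_finite ℤ _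
      have h2 := h1.map (MonoidAlgebra.lift ℤ (Matrix (Fin (n i)) (Fin (n i)) KK) D (rg i))
      have h3 : MonoidAlgebra.lift ℤ (Matrix (Fin (n i)) (Fin (n i)) KK) D (rg i)
          (∑ q : B × B, MonoidAlgebra.of ℤ D (x q)) = algebraMap KK _ c := by
        rw [← hc, hTx, map_sum, map_sum]
        refine Finset.sum_congr rfl fun q _ => ?_
        rw [MonoidAlgebra.lift_of, hrg]
      rw [h3] at h2
      have := hn i
      exact (isIntegral_algebraMap_iff
        (FaithfulSMul.algebraMap_injective KK (Matrix (Fin (n i)) (Fin (n i)) KK))).1 h2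
    exact ⟨⟨c, hintegral⟩, hc⟩
  choose t ht using ht
  set S : Finset (Fin N) := Finset.univ.filter (fun i => f (t i) ≠ 0) with hS
  set S' : Finset (Fin N) := Finset.univ.filter (fun i => f (t i) = 0) with hS'
  set e : MonoidAlgebra KK D := Ψ.symm (fun i => if i ∈ S then 1 else 0) with he
  have hΨe : ∀ i, ρ i e = if i ∈ S then 1 else 0 := by
    intro i; rw [hρ, he, AlgEquiv.apply_symm_apply]
  have hext : ∀ v w, (∀ i, ρ i v = ρ i w) → v = w := by
    intro v w h
    exact Ψ.injective (funext h)
  have hee : e * e = e := by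
    refine hext _ _ fun i => ?_
    rw [map_mul, hΨe]; split_ifs <;> simp
  have hec : ∀ v, v * e = e * v := by
    intro v
    refine hext _ _ fun i => ?_
    rw [map_mul, map_mul, hΨe]; split_ifs <;> simp
  have hann : ∀ (R : Finset (Fin N)) (i), i ∈ R →
      ρ i (aeval T (∏ i ∈ R, (X - C (algebraMap (integralClosure ℤ KK) KK (t i))))) = 0 := by
    intro R i hi
    rw [← aeval_algHom_apply, ht i, aeval_algebraMap_apply, aeval_def, eval₂_finsetProd,
      Finset.prod_eq_zero hi, map_zero]
    simp
  have hv := kz_vanish (KK := KK) (O := integralClosure ℤ KK) Subtype.val_injective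
    (fun z hz => ⟨⟨z, hz⟩, rfl⟩) f r hr e hee hec x T hTx t S S'
    (fun i hi => (Finset.mem_filter.1 hi).2) (fun i hi => (Finset.mem_filter.1 hi).2)
    (by
      refine hext _ _ fun i => ?_
      rw [map_mul, map_zero, hΨe]
      by_cases hi : i ∈ S
      · rw [hann S i hi, zero_mul]
      · rw [if_neg hi, mul_zero])
    (by
      refine hext _ _ fun i => ?_
      rw [map_mul, map_zero, map_sub, map_one, hΨe]
      by_cases hi : i ∈ S
      · rw [if_pos hi, sub_self, mul_zero]
      · have hi' : i ∈ S' := by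
          rw [hS', Finset.mem_filter]
          refine ⟨Finset.mem_univ _, ?_⟩
          by_contra h
          exact hi (Finset.mem_filter.2 ⟨Finset.mem_univ _, h⟩)
        rw [hann S' i hi', zero_mul]) y hy
  have hi0S : i0 ∈ S := by
    rw [hS, Finset.mem_filter]
    refine ⟨Finset.mem_univ _, ?_⟩
    have h1 := ht i0
    rw [htriv i0 hi0] at h1
    have := hn i0
    have h2 := FaithfulSMul.algebraMap_injective KK (Matrix (Fin (n i0)) (Fin (n i0)) KK) h1
    have h3 : MonoidAlgebra.lift KK KK D 1 T = ((p ^ a * p ^ a : ℕ) : KK) := by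
      rw [hT, map_mul, hu, hu', map_sum, map_sum]
      simp [hcard]
    have h4 : t i0 = ((p ^ a * p ^ a : ℕ) : integralClosure ℤ KK) := by
      apply Subtype.val_injective
      rw [h3] at h2
      exact h2.symm.trans (map_natCast (algebraMap (integralClosure ℤ KK) KK) _).symm
    rw [h4, map_natCast, Ne, CharP.cast_eq_zero_iff k r]
    intro h
    rw [← pow_add] at h
    exact hrp ((Nat.prime_dvd_prime_iff_eq hr hp).1 (hr.dvd_of_dvd_pow h))
  have hSn : ∀ i ∈ S, i ≠ i0 → p ∣ n i := by
    intro i hi hne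
    by_contra hpn
    have hti : algebraMap (integralClosure ℤ KK) KK (t i) ≠ 0 := by
      intro h
      have : t i = 0 := Subtype.val_injective h
      exact (Finset.mem_filter.1 hi).2 (by rw [this, map_zero])
    have hUV : (∑ b ∈ B, rg i b) * ((algebraMap (integralClosure ℤ KK) KK (t i))⁻¹ • ρ i u') = 1 := by
      have h1 : (∑ b ∈ B, rg i b) = ρ i u := by rw [hu, map_sum]; rfl
      rw [h1, mul_smul_comm, ← map_mul, ← hT, ht i,
        Algebra.algebraMap_eq_smul_one (A := Matrix (Fin (n i)) (Fin (n i)) KK), smul_smul,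
        inv_mul_cancel₀ hti, one_smul]
    have h2 := kz_burnside φ B hB p a hp hcard (rg i) (hirr i) _ hUV hpn
    apply hne
    refine huniq _ _ (fun d => ?_) hi0
    have h3 : Subgroup.closure (B : Set D) ≤ (rg i).toHomUnits.ker := by
      rw [Subgroup.closure_le]
      intro b hb
      obtain ⟨z, rfl⟩ := (hB b).1 hb
      rw [SetLike.mem_coe, MonoidHom.mem_ker]
      ext1
      rw [MonoidHom.coe_toHomUnits, map_mul, ← h2 z, ← map_mul]
      simp
    have h4 : d ∈ (rg i).toHomUnits.ker := h3 (hgen ▸ Subgroup.mem_top d)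
    rw [MonoidHom.mem_ker] at h4
    have := congrArg Units.val h4
    simpa using this
  have htr := kz_reg_trace n Ψ (e * MonoidAlgebra.of KK D y⁻¹)
  have hco : (e * MonoidAlgebra.of KK D y⁻¹).coeff 1 = e.coeff y := by
    rw [MonoidAlgebra.of_apply, MonoidAlgebra.coeff_mul_single_apply]; simp
  rw [hco, hv, mul_zero] at htr
  have h5 : ∀ i, (n i : KK) * (Ψ (e * MonoidAlgebra.of KK D y⁻¹) i).trace =
      if i ∈ S then (n i : KK) * (rg i y⁻¹).trace else 0 := by
    intro i
    rw [← hρ, map_mul, hΨe, ← hrg]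
    split_ifs <;> simp
  rw [Finset.sum_congr rfl (fun i _ => h5 i), ← Finset.sum_filter, Finset.filter_mem_eq_inter,
    Finset.univ_inter, ← Finset.add_sum_erase _ _ hi0S] at htr
  have h6 : (n i0 : KK) * (rg i0 y⁻¹).trace = 1 := by
    rw [hi0, Matrix.trace_one, htriv1 i0 hi0]; simp
  have hc : ∀ i, ∃ c : ℕ, i ∈ S.erase i0 → n i = p * c := by
    intro i
    by_cases hi : i ∈ S.erase i0
    · obtain ⟨c, hc⟩ := hSn i (Finset.mem_of_mem_erase hi) (Finset.ne_of_mem_erase hi)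
      exact ⟨c, fun _ => hc⟩
    · exact ⟨0, fun h => absurd h hi⟩
  choose c hc using hc
  have h7 : ∑ i ∈ S.erase i0, (n i : KK) * (rg i y⁻¹).trace =
      p * ∑ i ∈ S.erase i0, (c i : KK) * (rg i y⁻¹).trace := by
    rw [Finset.mul_sum]
    refine Finset.sum_congr rfl fun i hi => ?_
    have h8 : (n i : KK) = p * c i := by rw [← Nat.cast_mul, ← hc i hi]
    rw [h8, mul_assoc]
  rw [h6, h7] at htr
  refine kz_nonint (KK := KK) p hp (-∑ i ∈ S.erase i0, (c i : KK) * (rg i y⁻¹).trace) ?_ ?_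
  · refine IsIntegral.neg (IsIntegral.sum _ fun i _ => IsIntegral.mul ?_ ?_)
    · exact_mod_cast isIntegral_algebraMap (R := ℤ) (A := KK) (x := (c i : ℤ))
    · refine kz_trace_integral _ r hr.pos ?_
      rw [← map_pow, inv_pow, ← hy, pow_orderOf_eq_one]; simp
  · linear_combination htr

end kazarin

lemma kz_main {D : Type*} [Group D] [Finite D] (φ : D ≃* D) (B : Finset D)
    (hB : ∀ b, b ∈ B ↔ ∃ x, b = x * (φ x)⁻¹) (p a : ℕ) (hp : p.Prime) (hcard : B.card = p ^ a)
    (hgen : Subgroup.closure (B : Set D) = ⊤) : IsPGroup p D := by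
  have halg : Algebra.IsAlgebraic ℚ (AlgebraicClosure ℚ) := by
    have h := AlgebraicClosure.isAlgebraic ℚ
    convert h using 1
    · rfl
    · exact Subsingleton.elim _ _
  have hpr := Fact.mk hp
  rw [IsPGroup.iff_card]
  have hD : Nat.card D ≠ 0 := Nat.card_pos.ne'
  refine ⟨_, Nat.eq_prime_pow_of_unique_prime_dvd hD ?_⟩
  intro r hr hd
  by_contra hrp
  have := Fact.mk hr
  obtain ⟨y, hy⟩ := exists_prime_orderOf_dvd_card' r hd
  exact kz_contra (AlgebraicClosure ℚ) φ B hB p a hp hcard hgen r hr hrp y hy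

lemma qg_supp {D : Type*} [Group D] [Finite D] (p : ℕ) (hp : p.Prime) (hD : IsPGroup p D)
    (K : Subgroup D) (hK : K ⊔ commutator D = ⊤) : K = ⊤ := by
  have := Fact.mk hp
  have hnil : Group.IsNilpotent D := hD.isNilpotent
  rcases eq_top_or_exists_le_coatom K with h | ⟨M, hM, hKM⟩
  · exact h
  exfalso
  have hMn : M.Normal :=
    Subgroup.NormalizerCondition.normal_of_coatom M Group.normalizerCondition_of_isNilpotent hM
  have hnt : Nontrivial (D ⧸ M) := QuotientGroup.nontrivial_iff.2 hM.1
  have hc := (hD.to_quotient M).center_nontrivial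
  obtain ⟨z, hz⟩ := exists_ne (1 : Subgroup.center (D ⧸ M))
  obtain ⟨d, hd⟩ := QuotientGroup.mk_surjective (z : D ⧸ M)
  have hlt : M < (Subgroup.center (D ⧸ M)).comap (QuotientGroup.mk' M) := by
    refine lt_of_le_of_ne ?_ ?_
    · intro m hm
      rw [Subgroup.mem_comap, QuotientGroup.mk'_apply, (QuotientGroup.eq_one_iff m).2 hm]
      exact Subgroup.one_mem _
    · intro h
      have h1 : d ∈ M := by
        rw [h, Subgroup.mem_comap, QuotientGroup.mk'_apply, hd]; exact z.2
      apply hz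
      apply Subtype.ext
      rw [← hd, (QuotientGroup.eq_one_iff d).2 h1]; rfl
  have htop := hM.2 _ hlt
  have hcomm : commutator D ≤ M := by
    rw [commutator_def, Subgroup.commutator_le]
    intro g _ h _
    rw [← QuotientGroup.eq_one_iff, ← QuotientGroup.mk'_apply, map_commutatorElement,
      commutatorElement_eq_one_iff_mul_comm]
    have h1 : g ∈ (Subgroup.center (D ⧸ M)).comap (QuotientGroup.mk' M) := htop ▸ Subgroup.mem_top g
    exact (Subgroup.mem_center_iff.1 (Subgroup.mem_comap.1 h1) _).symm
  apply hM.1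
  rw [eq_top_iff, ← hK]
  exact sup_le hKM hcomm

open scoped commutatorElement in
lemma qg_fpf {D : Type*} [Group D] [Finite D] (φ : D ≃* D)
    (hgen : Subgroup.closure {b : D | ∃ x, b = x * (φ x)⁻¹} = ⊤) (N : Subgroup D) [N.Normal]
    (hcN : commutator D ≤ N) (hφ : ∀ n ∈ N, φ n ∈ N) (w : D) (hw : w * (φ w)⁻¹ ∈ N) : w ∈ N := by
  have hcomm : ∀ u v : D ⧸ N, u * v = v * u := by
    intro u v
    obtain ⟨g, rfl⟩ := QuotientGroup.mk_surjective u
    obtain ⟨h, rfl⟩ := QuotientGroup.mk_surjective v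
    rw [← QuotientGroup.mk_mul, ← QuotientGroup.mk_mul, QuotientGroup.eq]
    apply hcN
    have : (g * h)⁻¹ * (h * g) = ⁅h⁻¹, g⁻¹⁆ := by rw [commutatorElement_def]; group
    rw [this, commutator_def]
    exact Subgroup.commutator_mem_commutator (Subgroup.mem_top _) (Subgroup.mem_top _)
  let ψ : D →* D ⧸ N := MonoidHom.mk' (fun w => ((w * (φ w)⁻¹ : D) : D ⧸ N)) (by
    intro u v
    simp only [map_mul, mul_inv_rev, QuotientGroup.mk_mul, QuotientGroup.mk_inv]
    rw [hcomm ((φ v : D ⧸ N)⁻¹) ((φ u : D ⧸ N)⁻¹)]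
    rw [mul_assoc, ← mul_assoc (v : D ⧸ N), hcomm (v : D ⧸ N) ((φ u : D ⧸ N)⁻¹)]
    simp only [mul_assoc])
  have hψ : ∀ w, ψ w = ((w * (φ w)⁻¹ : D) : D ⧸ N) := fun _ => rfl
  have hrange : ψ.range = ⊤ := by
    have h1 : Subgroup.closure {b : D | ∃ x, b = x * (φ x)⁻¹} ≤ ψ.range.comap (QuotientGroup.mk' N) := by
      rw [Subgroup.closure_le]
      rintro _ ⟨x, rfl⟩
      exact ⟨x, rfl⟩
    rw [eq_top_iff]
    intro u _
    obtain ⟨g, rfl⟩ := QuotientGroup.mk_surjective u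
    exact h1 (hgen ▸ Subgroup.mem_top g)
  have hle : N ≤ ψ.ker := by
    intro n hn
    rw [MonoidHom.mem_ker, hψ, QuotientGroup.eq_one_iff]
    exact N.mul_mem hn (N.inv_mem (hφ n hn))
  have hidx : ψ.ker.index = N.index := by
    rw [Subgroup.index_ker, hrange, Subgroup.card_top, Subgroup.index]
  have h2 := Subgroup.relIndex_mul_index hle
  rw [hidx] at h2
  have h3 : N.relIndex ψ.ker = 1 := by
    have : N.index ≠ 0 := Subgroup.index_ne_zero_of_finite
    exact (Nat.mul_eq_right this).1 h2
  rw [Subgroup.relIndex_eq_one] at h3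
  apply h3
  rw [MonoidHom.mem_ker, hψ, QuotientGroup.eq_one_iff]
  exact hw

lemma qg_main {D : Type*} [Group D] [Finite D] [Nontrivial D] (p : ℕ) (hp : p.Prime)
    (hD : IsPGroup p D) (φ : D ≃* D)
    (hgen : Subgroup.closure {b : D | ∃ x, b = x * (φ x)⁻¹} = ⊤) (H : Subgroup D)
    (hH : ∀ h ∈ H, φ h = h) (hHZ : ∀ z ∈ H, z ∈ Subgroup.center D → z = 1)
    (hidx : H.index = p ^ 3) (x y : D) (hxy : y * φ.symm (y⁻¹ * x) * x⁻¹ ∈ H) :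
    ∃ h ∈ H, ∃ z ∈ Subgroup.center D, y⁻¹ * x = h * z := by
  have hpr := Fact.mk hp
  set N : Subgroup D := commutator D ⊔ Subgroup.center D with hN
  have hNn : N.Normal := inferInstance
  have hφN : ∀ (φ : D ≃* D), ∀ n ∈ N, φ n ∈ N := by
    intro φ
    have h1 : N ≤ N.comap φ.toMonoidHom := by
      rw [hN]
      refine sup_le ?_ ?_
      · refine le_trans ?_ (Subgroup.comap_mono le_sup_left)
        exact (Subgroup.characteristic_iff_le_comap.1 inferInstance φ)
      · refine le_trans ?_ (Subgroup.comap_mono le_sup_right)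
        exact (Subgroup.characteristic_iff_le_comap.1 inferInstance φ)
    exact fun n hn => h1 hn
  have hfpf := qg_fpf φ hgen N le_sup_left (hφN φ)
  have hHN : H ≤ N := by
    intro h hh
    apply hfpf
    rw [hH h hh, mul_inv_cancel]
    exact N.one_mem
  set K := H ⊔ Subgroup.center D with hK
  have hKN : K ≤ N := sup_le hHN le_sup_right
  have hKne : K.index ≠ p ^ 3 := by
    intro h
    have h1 := Subgroup.relIndex_mul_index (le_sup_left : H ≤ K)
    rw [h, hidx] at h1
    have h2 : H.relIndex K = 1 := (Nat.mul_eq_right (pow_ne_zero _ hp.ne_zero)).1 h1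
    rw [Subgroup.relIndex_eq_one] at h2
    have := hD.center_nontrivial
    obtain ⟨z, hz⟩ := exists_ne (1 : Subgroup.center D)
    exact hz (Subtype.ext (hHZ z (h2 (le_sup_right (a := H) z.2)) z.2))
  have hKd : K.index ∣ p ^ 3 := hidx ▸ Subgroup.index_dvd_of_le (le_sup_left : H ≤ K)
  obtain ⟨j, hj, hKj⟩ := (Nat.dvd_prime_pow hp).1 hKd
  have hj2 : j ≤ 2 := by
    by_contra h
    have : j = 3 := by omega
    exact hKne (this ▸ hKj)
  have hNK : N ≤ K := by
    obtain ⟨i, hi, hNi⟩ := (Nat.dvd_prime_pow hp).1 (hKj ▸ Subgroup.index_dvd_of_le hKN)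
    by_cases hi2 : i = j
    · have h1 := Subgroup.relIndex_mul_index hKN
      rw [hNi, hKj, hi2] at h1
      exact Subgroup.relIndex_eq_one.1 ((Nat.mul_eq_right (pow_ne_zero _ hp.ne_zero)).1 h1)
    · have hi1 : i ≤ 1 := by omega
      have hcyc : IsCyclic (D ⧸ N) := by
        have hc : Nat.card (D ⧸ N) = p ^ i := hNi
        interval_cases i
        · rw [pow_zero] at hc
          have := (Nat.card_eq_one_iff_unique.1 hc).1
          exact isCyclic_of_subsingleton
        · rw [pow_one] at hc
          exact isCyclic_of_prime_card hc
      obtain ⟨g', hg'⟩ := hcyc.exists_generator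
      obtain ⟨g, rfl⟩ := QuotientGroup.mk_surjective g'
      have h1 : Subgroup.zpowers g ⊔ N = ⊤ := by
        rw [eq_top_iff]
        intro d _
        obtain ⟨k, hk⟩ := Subgroup.mem_zpowers_iff.1 (hg' (d : D ⧸ N))
        rw [← QuotientGroup.mk_zpow, QuotientGroup.eq] at hk
        have : d = g ^ k * ((g ^ k)⁻¹ * d) := by group
        rw [this]
        exact Subgroup.mul_mem_sup (Subgroup.zpow_mem_zpowers g k) hk
      have h2 : Subgroup.zpowers g ⊔ Subgroup.center D = ⊤ := by
        apply qg_supp p hp hD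
        rw [sup_assoc, sup_comm (Subgroup.center D), ← hN, h1]
      have h3 : Subgroup.zpowers g ⊔ Subgroup.center D ≤ Subgroup.centralizer {g} := by
        refine sup_le ?_ (Subgroup.center_le_centralizer _)
        rw [Subgroup.zpowers_le, Subgroup.mem_centralizer_singleton_iff]
      have hgc : g ∈ Subgroup.center D := by
        rw [Subgroup.mem_center_iff]
        intro d
        have : d ∈ Subgroup.centralizer {g} := h3 (h2 ▸ Subgroup.mem_top d)
        rw [Subgroup.mem_centralizer_singleton_iff] at this
        exact this
      have h4 : Subgroup.center D = ⊤ := by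
        rw [← h2]; symm
        exact sup_eq_right.2 (Subgroup.zpowers_le.2 hgc)
      rw [hK, h4]
      simp
  have h5 : y⁻¹ * (y * φ.symm (y⁻¹ * x) * x⁻¹) * y ∈ N := by
    simpa using hNn.conj_mem _ (hHN hxy) y⁻¹
  have h6 : φ.symm (y⁻¹ * x) * (y⁻¹ * x)⁻¹ ∈ N := by
    convert h5 using 1; group
  have h7 := hφN φ _ h6
  rw [map_mul, map_inv, MulEquiv.apply_symm_apply] at h7
  have h8 := hNK (hfpf _ h7)
  obtain ⟨h, hh, z, hz, hhz⟩ := Subgroup.mem_sup_of_normal_right.1 h8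
  exact ⟨h, hh, z, hz, hhz.symm⟩

/-- The permutations that normalise the left multiplications compatibly (automorphisms). -/
def qAut (Q : Type*) [Quandle Q] : Subgroup (Equiv.Perm Q) where
  carrier := {g | ∀ x, g * QL x = QL (g x) * g}
  one_mem' := by intro x; simp
  mul_mem' := by
    intro g h hg hh x
    rw [mul_assoc, hh, ← mul_assoc, hg, mul_assoc, Equiv.Perm.mul_apply]
  inv_mem' := by
    intro g hg x
    have := hg (g⁻¹ x)
    have hgx : g (g⁻¹ x) = x := Equiv.apply_symm_apply g x
    rw [hgx] at this
    rw [inv_mul_eq_iff_eq_mul, ← mul_assoc, this, mul_assoc, mul_inv_cancel, mul_one]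

lemma qAut_conj {Q : Type*} [Quandle Q] {g : Equiv.Perm Q} (hg : g ∈ qAut Q) (x : Q) :
    QL (g x) = g * QL x * g⁻¹ := by
  rw [eq_mul_inv_iff_mul_eq]; exact (hg x).symm

lemma QL_mem_qAut {Q : Type*} [Quandle Q] (a : Q) : QL a ∈ qAut Q := by
  intro x
  have := Rack.ad_conj a x
  rw [eq_mul_inv_iff_mul_eq] at this
  exact this.symm

lemma Dis_le_qAut (Q : Type*) [Quandle Q] : Dis Q ≤ qAut Q := by
  rw [Dis, Subgroup.closure_le]
  rintro _ ⟨a, b, rfl⟩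
  exact (qAut Q).mul_mem (QL_mem_qAut a) ((qAut Q).inv_mem (QL_mem_qAut b))

lemma QL_mul_inv_mem_Dis {Q : Type*} [Quandle Q] (a b : Q) : QL a * (QL b)⁻¹ ∈ Dis Q :=
  Subgroup.subset_closure ⟨a, b, rfl⟩

lemma qAut_conj_Dis {Q : Type*} [Quandle Q] {g : Equiv.Perm Q} (hg : g ∈ qAut Q)
    {d : Equiv.Perm Q} (hd : d ∈ Dis Q) : g * d * g⁻¹ ∈ Dis Q := by
  have h : Dis Q ≤ (Dis Q).comap (MulAut.conj g).toMonoidHom := by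
    conv_lhs => rw [Dis]
    rw [Subgroup.closure_le]
    rintro _ ⟨a, b, rfl⟩
    have : g * (QL a * (QL b)⁻¹) * g⁻¹ = QL (g a) * (QL (g b))⁻¹ := by
      rw [qAut_conj hg, qAut_conj hg]; group
    change g * (QL a * (QL b)⁻¹) * g⁻¹ ∈ Dis Q
    rw [this]
    exact QL_mul_inv_mem_Dis _ _
  exact h hd

lemma qAut_conj_Dis' {Q : Type*} [Quandle Q] {g : Equiv.Perm Q} (hg : g ∈ qAut Q)
    {d : Equiv.Perm Q} (hd : d ∈ Dis Q) : g⁻¹ * d * g ∈ Dis Q := by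
  simpa using qAut_conj_Dis ((qAut Q).inv_mem hg) hd

/-- Conjugation by an automorphism on the displacement group. -/
def qConj {Q : Type*} [Quandle Q] (g : Equiv.Perm Q) (hg : g ∈ qAut Q) : Dis Q ≃* Dis Q where
  toFun d := ⟨g * d * g⁻¹, qAut_conj_Dis hg d.2⟩
  invFun d := ⟨g⁻¹ * d * g, qAut_conj_Dis' hg d.2⟩
  left_inv d := Subtype.ext (by simp only; group)
  right_inv d := Subtype.ext (by simp only; group)
  map_mul' d d' := Subtype.ext (by simp only [Subgroup.coe_mul]; group)

theorem stmt15 (p : ℕ) (hp : p.Prime) (Q : Type*) [Quandle Q]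
    (hconn : ∀ x y : Q, ∃ g ∈ Dis Q, g x = y)
    (hcard : Nat.card Q = p ^ 3)
    (hfaith : Function.Injective (fun a : Q => QL a)) :
    ∀ a : Q, Function.Bijective (fun b : Q => b ◃ a) := by
  classical
  intro a
  have hfin : Finite Q := Nat.finite_of_card_ne_zero (by rw [hcard]; exact pow_ne_zero _ hp.ne_zero)
  have hfinD : Finite (Dis Q) := inferInstance
  have := Fintype.ofFinite (Dis Q)
  set φ := qConj (QL a) (QL_mem_qAut a) with hφ
  have hφv : ∀ x, ((φ x : Dis Q) : Equiv.Perm Q) = QL a * x * (QL a)⁻¹ := fun _ => rfl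
  have hφsv : ∀ x, ((φ.symm x : Dis Q) : Equiv.Perm Q) = (QL a)⁻¹ * x * QL a := fun _ => rfl
  have hconj : ∀ (x : Dis Q) (q : Q), QL ((x : Equiv.Perm Q) q) = x * QL q * (x : Equiv.Perm Q)⁻¹ :=
    fun x q => qAut_conj (Dis_le_qAut Q x.2) q
  have hBv : ∀ x : Dis Q, ((x * (φ x)⁻¹ : Dis Q) : Equiv.Perm Q)
      = QL ((x : Equiv.Perm Q) a) * (QL a)⁻¹ := by
    intro x
    rw [hconj, Subgroup.coe_mul, Subgroup.coe_inv, hφv]; group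
  set B : Finset (Dis Q) := Finset.univ.image (fun x => x * (φ x)⁻¹) with hBdef
  have hB : ∀ b, b ∈ B ↔ ∃ x, b = x * (φ x)⁻¹ := by
    intro b; simp [hBdef, eq_comm]
  have hBset : (B : Set (Dis Q)) = {b | ∃ x, b = x * (φ x)⁻¹} := by
    ext b; exact hB b
  have hBQ : Set.range (fun q : Q => (⟨QL q * (QL a)⁻¹, QL_mul_inv_mem_Dis q a⟩ : Dis Q)) = B := by
    ext b
    rw [Finset.mem_coe, hB]
    constructor
    · rintro ⟨q, rfl⟩
      obtain ⟨g, hg, hgq⟩ := hconn a q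
      exact ⟨⟨g, hg⟩, Subtype.ext (by rw [hBv]; simp [hgq])⟩
    · rintro ⟨x, rfl⟩
      exact ⟨(x : Equiv.Perm Q) a, Subtype.ext (by rw [hBv])⟩
  have hBcard : B.card = p ^ 3 := by
    rw [← hcard, ← Set.ncard_coe_finset, ← hBQ, ← Set.image_univ, Set.ncard_image_of_injective,
      Set.ncard_univ]
    intro q q' h
    exact hfaith (mul_right_cancel (congrArg Subtype.val h))
  have hgen : Subgroup.closure (B : Set (Dis Q)) = ⊤ := by
    have h1 : Dis Q ≤ (Subgroup.closure (B : Set (Dis Q))).map (Dis Q).subtype := by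
      conv_lhs => rw [Dis]
      rw [Subgroup.closure_le]
      rintro _ ⟨b, c, rfl⟩
      refine ⟨⟨QL b * (QL a)⁻¹, QL_mul_inv_mem_Dis b a⟩ * ⟨QL c * (QL a)⁻¹, QL_mul_inv_mem_Dis c a⟩⁻¹,
        Subgroup.mul_mem _ (Subgroup.subset_closure ?_)
          (Subgroup.inv_mem _ (Subgroup.subset_closure ?_)), ?_⟩
      · rw [← hBQ]; exact ⟨b, rfl⟩
      · rw [← hBQ]; exact ⟨c, rfl⟩
      · simp
    rw [eq_top_iff]
    intro d _
    obtain ⟨d', hd', h⟩ := h1 d.2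
    have : d' = d := Subtype.ext h
    exact this ▸ hd'
  have hP : IsPGroup p (Dis Q) := kz_main φ B hB p 3 hp hBcard hgen
  have hp3 : 1 < Nat.card Q := by rw [hcard]; exact Nat.one_lt_pow (by norm_num) hp.one_lt
  have hntQ : Nontrivial Q := Finite.one_lt_card_iff_nontrivial.1 hp3
  have hnt : Nontrivial (Dis Q) := by
    obtain ⟨q, hq⟩ := exists_ne a
    obtain ⟨g, hg, hgq⟩ := hconn a q
    refine ⟨⟨g, hg⟩, 1, fun h => hq ?_⟩
    have : g = 1 := congrArg Subtype.val h
    rw [← hgq, this]; rfl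
  have htrans : MulAction.IsPretransitive (Dis Q) Q := ⟨fun x y => by
    obtain ⟨g, hg, h⟩ := hconn x y
    exact ⟨⟨g, hg⟩, h⟩⟩
  set H : Subgroup (Dis Q) := MulAction.stabilizer (Dis Q) a with hH
  have hHmem : ∀ h : Dis Q, h ∈ H ↔ (h : Equiv.Perm Q) a = a := fun h => Iff.rfl
  have hidx : H.index = p ^ 3 := by
    rw [hH, MulAction.index_stabilizer_of_transitive, hcard]
  have hHφ : ∀ h ∈ H, φ h = h := by
    intro h hh
    apply Subtype.ext
    have h1 := hconj h a
    rw [(hHmem h).1 hh, eq_mul_inv_iff_mul_eq] at h1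
    rw [hφv, h1]; group
  have hsemi : ∀ z ∈ Subgroup.center (Dis Q), (z : Equiv.Perm Q) a = a → z = 1 := by
    intro z hz hza
    apply Subtype.ext
    ext q
    obtain ⟨g, hg, hgq⟩ := hconn a q
    have h1 := congrArg Subtype.val (Subgroup.mem_center_iff.1 hz ⟨g, hg⟩)
    have h2 := Equiv.congr_fun h1 a
    simp only [Subgroup.coe_mul, Equiv.Perm.mul_apply] at h2
    rw [hza, hgq] at h2
    exact h2.symm
  refine Finite.injective_iff_bijective.1 ?_
  intro b c hbc
  have hbc' : QL b a = QL c a := hbc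
  obtain ⟨x, hx, rfl⟩ := hconn a b
  obtain ⟨y, hy, rfl⟩ := hconn a c
  have hgv : ((⟨y, hy⟩ * φ.symm (⟨y, hy⟩⁻¹ * ⟨x, hx⟩) * ⟨x, hx⟩⁻¹ : Dis Q) : Equiv.Perm Q)
      = (QL (y a))⁻¹ * QL (x a) := by
    rw [hconj ⟨x, hx⟩, hconj ⟨y, hy⟩]
    simp only [Subgroup.coe_mul, Subgroup.coe_inv, hφsv]
    group
  have hfix : ((QL (y a))⁻¹ * QL (x a)) a = a := by
    rw [Equiv.Perm.mul_apply, hbc']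
    exact Equiv.symm_apply_apply _ _
  obtain ⟨h, hh, z, hz, hhz⟩ := qg_main p hp hP φ (hBset ▸ hgen) H hHφ
    (fun z hz hz' => hsemi z hz' hz) hidx ⟨x, hx⟩ ⟨y, hy⟩ (by rw [hHmem, hgv, hfix])
  have hxa : x a = (z : Equiv.Perm Q) (y a) := by
    have h1 : (⟨x, hx⟩ : Dis Q) = z * ⟨y, hy⟩ * h := by
      have h2 : (⟨x, hx⟩ : Dis Q) = ⟨y, hy⟩ * (h * z) := by rw [← hhz]; group
      rw [h2, ← mul_assoc, Subgroup.mem_center_iff.1 hz, mul_assoc]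
    have h3 : x = z * y * h := congrArg Subtype.val h1
    conv_lhs => rw [h3]
    simp only [Equiv.Perm.mul_apply]
    rw [(hHmem h).1 hh]
  set χ := qConj (QL (y a)) (QL_mem_qAut (y a)) with hχ
  have hz' : χ.symm z * z⁻¹ ∈ Subgroup.center (Dis Q) := by
    refine Subgroup.mul_mem _ ?_ (Subgroup.inv_mem _ hz)
    rw [Subgroup.mem_center_iff]
    intro g
    apply χ.injective
    rw [map_mul, map_mul, MulEquiv.apply_symm_apply]
    exact Subgroup.mem_center_iff.1 hz _
  have hv' : ((χ.symm z * z⁻¹ : Dis Q) : Equiv.Perm Q) = (QL (y a))⁻¹ * QL (x a) := by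
    rw [hxa, hconj z]
    change (QL (y a))⁻¹ * z * QL (y a) * (z : Equiv.Perm Q)⁻¹ = _
    group
  have hone := hsemi _ hz' (by rw [hv', hfix])
  have h9 : (QL (y a))⁻¹ * QL (x a) = 1 := by rw [← hv', hone]; rfl
  exact (hfaith (inv_mul_eq_one.1 h9)).symm
end

section
/- (Upper bound for the displacement group of latin p-quandles.) Let p be a prime, n ≥ 3, and let Q be a latin quandle with Nat.card Q = p^n. Then Nat.card (Dis Q) ≤ p^((n^2 + n - 4)/2). -/
open Quandles

lemma avg_eq_of_integral (N : ℕ) (hN : 0 < N) {d : ℕ} (hd : 0 < d) (r : Fin d → ℂ)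
    (hr : ∀ i, r i ^ N = 1) (hIntg : IsIntegral ℤ ((∑ i, r i) / (d : ℂ)))
    (hne : ∑ i, r i ≠ 0) : ∃ u : ℂ, ∀ i, r i = u := by
  have hdC : (d : ℂ) ≠ 0 := by exact_mod_cast hd.ne'
  let F := IntermediateField.adjoin ℚ (Set.range r)
  have hfin : FiniteDimensional ℚ F := by
    have : Finite (Set.range r) := Set.finite_range r
    apply IntermediateField.finiteDimensional_adjoin
    rintro x ⟨i, rfl⟩
    refine IsIntegral.of_pow hN ?_
    rw [hr]; exact isIntegral_one
  have : NumberField F := ⟨⟩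
  let r' : Fin d → F := fun i => ⟨r i, IntermediateField.subset_adjoin ℚ _ ⟨i, rfl⟩⟩
  let α : F := (∑ i, r' i) / (d : F)
  have hα : (α : ℂ) = (∑ i, r i) / (d : ℂ) := by
    simp [α, r']
  have hr' : ∀ i, r' i ^ N = 1 := fun i => Subtype.ext (by simpa [r'] using hr i)
  have hα0 : α ≠ 0 := by
    intro h
    rw [h] at hα
    have : (∑ i, r i) / (d : ℂ) ≠ 0 := div_ne_zero hne hdC
    exact this (by simpa using hα.symm)
  have hαi : IsIntegral ℤ α := by
    have : IsIntegral ℤ (algebraMap F ℂ α) := by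
      change IsIntegral ℤ (α : ℂ)
      rw [hα]; exact hIntg
    exact (isIntegral_algebraMap_iff (algebraMap F ℂ).injective).1 this
  obtain ⟨m, hm, hm1⟩ := NumberField.Embeddings.pow_eq_one_of_norm_le_one F ℂ hα0 hαi (by
    intro φ
    have h1 : φ α = (∑ i, φ (r' i)) / (d : ℂ) := by simp [α, map_sum]
    rw [h1, norm_div, Complex.norm_natCast, div_le_one (by exact_mod_cast hd)]
    refine (norm_sum_le _ _).trans ?_
    have h2 : ∀ i, ‖φ (r' i)‖ = 1 := by
      intro i
      refine Complex.norm_eq_one_of_pow_eq_one (n := N) ?_ hN.ne'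
      rw [← map_pow, hr', map_one]
    simp [h2])
  set u : ℂ := (∑ i, r i) / (d : ℂ) with hu
  have hu1 : ‖u‖ = 1 := by
    refine Complex.norm_eq_one_of_pow_eq_one (n := m) ?_ hm.ne'
    rw [← hα, ← SubmonoidClass.coe_pow, hm1]; rfl
  have hu0 : u ≠ 0 := by intro h; simp [h] at hu1
  refine ⟨u, ?_⟩
  have hn : ∀ i, ‖r i / u‖ = 1 := by
    intro i
    rw [norm_div, hu1, Complex.norm_eq_one_of_pow_eq_one (hr i) hN.ne', div_one]
  have hsum : ∑ i, (r i / u) = d := by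
    rw [← Finset.sum_div, div_eq_iff hu0, hu]; field_simp
  have hre : ∑ i, (1 - (r i / u).re) = 0 := by
    have := congrArg Complex.re hsum
    simp only [Complex.re_sum, Complex.natCast_re] at this
    simp [Finset.sum_sub_distrib, this]
  have h0 : ∀ i ∈ Finset.univ, 0 ≤ 1 - (r i / u).re := by
    intro i _
    have := (Complex.re_le_norm (r i / u)).trans_eq (hn i)
    linarith
  have h1 := (Finset.sum_eq_zero_iff_of_nonneg h0).1 hre
  intro i
  have h2 : (r i / u).re = 1 := by have := h1 i (Finset.mem_univ i); linarith
  have h3 : (r i / u) = 1 := by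
    have h4 := Complex.sq_norm (r i / u)
    rw [hn, Complex.normSq_apply, h2] at h4
    apply Complex.ext
    · simpa using h2
    · have : (r i / u).im * (r i / u).im = 0 := by linarith
      simpa using this
  rwa [div_eq_one_iff_eq hu0] at h3

/-- operator of finite order whose normalized trace is a nonzero algebraic integer is scalar -/
lemma scalar_of_integral_trace {U : Type*} [AddCommGroup U] [Module ℂ U] [FiniteDimensional ℂ U]
    (T : Module.End ℂ U) (N : ℕ) (hN : 0 < N) (hT : T ^ N = 1)
    (hd : 0 < Module.finrank ℂ U)
    (hIntg : IsIntegral ℤ (LinearMap.trace ℂ U T / (Module.finrank ℂ U : ℂ)))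
    (hne : LinearMap.trace ℂ U T ≠ 0) : ∃ u : ℂ, ∀ v, T v = u • v := by
  have hsplit : T.charpoly.Splits := IsAlgClosed.splits _
  have htr := Module.End.trace_eq_sum_roots_charpoly_of_splits hsplit
  have hcard : T.charpoly.roots.card = Module.finrank ℂ U := by
    rw [← hsplit.natDegree_eq_card_roots, LinearMap.charpoly_natDegree]
  have hroot : ∀ z ∈ T.charpoly.roots, z ^ N = 1 := by
    intro z hz
    have hz' : T.HasEigenvalue z := by
      rw [Module.End.hasEigenvalue_iff_isRoot_charpoly]
      exact (Polynomial.mem_roots'.1 hz).2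
    obtain ⟨v, hv⟩ := hz'.exists_hasEigenvector
    have h1 : (T ^ N) v = z ^ N • v := hv.pow_apply N
    rw [hT] at h1
    have h2 : (z ^ N - 1) • v = 0 := by rw [sub_smul, ← h1]; simp
    rcases smul_eq_zero.1 h2 with h | h
    · exact sub_eq_zero.1 h
    · exact absurd h hv.2
  obtain ⟨l, hl⟩ := Quot.exists_rep T.charpoly.roots
  have hl' : T.charpoly.roots = (l : Multiset ℂ) := hl.symm
  rw [hl'] at htr hcard hroot
  simp only [Multiset.coe_card] at hcard
  have hs : ∑ i : Fin l.length, l.get i = LinearMap.trace ℂ U T := by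
    rw [htr]; simp [← List.sum_ofFn]
  obtain ⟨u, hu⟩ := avg_eq_of_integral N hN (d := l.length) (by omega) (fun i => l.get i)
    (fun i => hroot _ (by simp)) (by rw [hs, hcard]; exact hIntg) (by rw [hs]; exact hne)
  refine ⟨u, ?_⟩
  have hall : ∀ z ∈ l, z = u := by
    intro z hz
    obtain ⟨i, hi⟩ := List.get_of_mem hz
    rw [← hi]; exact hu i
  have hl2 : (l : Multiset ℂ) = Multiset.replicate l.length u := by
    rw [Multiset.eq_replicate]; exact ⟨by simp, by simpa using hall⟩
  have hcp : T.charpoly = (Polynomial.X - Polynomial.C u) ^ l.length := by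
    rw [hsplit.eq_prod_roots_of_monic T.charpoly_monic, hl', hl2]
    simp
  have hss : T.IsSemisimple := by
    refine Module.End.isSemisimple_of_squarefree_aeval_eq_zero (p := Polynomial.X ^ N - 1) ?_ ?_
    · have : (Polynomial.X ^ N - 1 : Polynomial ℂ).Separable :=
        Polynomial.separable_X_pow_sub_C (1 : ℂ) (by exact_mod_cast hN.ne') one_ne_zero
      exact this.squarefree
    · simp [hT]
  have hnil : IsNilpotent (T - algebraMap ℂ (Module.End ℂ U) u) := by
    refine ⟨l.length, ?_⟩
    have := T.aeval_self_charpoly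
    rw [hcp] at this
    simpa using this
  have hss2 : (T - algebraMap ℂ (Module.End ℂ U) u).IsSemisimple := by
    exact (Module.End.isSemisimple_sub_algebraMap_iff).2 hss
  have h0 := Module.End.eq_zero_of_isNilpotent_isSemisimple hnil hss2
  intro v
  have := LinearMap.congr_fun h0 v
  simpa [sub_eq_zero] using this

section Rep
variable {X : Type} [Group X] [Finite X]

/-- class sum -/
noncomputable def clsSum (S : Type*) [CommRing S] {X : Type*} [Group X] (C : Finset X) :
    MonoidAlgebra S X :=
  ∑ c ∈ C, MonoidAlgebra.of S X c

lemma clsSum_comm (S : Type*) [CommRing S] {X : Type*} [Group X] (C : Finset X)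
    (hC : ∀ c ∈ C, ∀ x, x * c * x⁻¹ ∈ C) (a : MonoidAlgebra S X) :
    clsSum S C * a = a * clsSum S C := by
  induction a using MonoidAlgebra.induction_on with
  | of x =>
    simp only [clsSum, Finset.sum_mul, Finset.mul_sum, ← map_mul]
    symm
    refine Finset.sum_bij (fun c _ => x * c * x⁻¹) (fun c hc => hC c hc x) ?_ ?_ ?_
    · intro a _ b _ h; simpa using h
    · intro b hb
      exact ⟨x⁻¹ * b * x, by simpa using hC b hb x⁻¹, by group⟩
    · intro c _; simp
  | add f g hf hg => rw [mul_add, add_mul, hf, hg]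
  | smul r f hf => rw [mul_smul_comm, smul_mul_assoc, hf]

lemma clsSum_integral {X : Type*} [Group X] [Finite X] (C : Finset X) :
    IsIntegral ℤ (clsSum ℂ C) := by
  have h : IsIntegral ℤ (clsSum ℤ C) := by
    have : Module.Finite ℤ (MonoidAlgebra ℤ X) := inferInstance
    exact IsIntegral.of_finite ℤ _
  have h2 := h.map (MonoidAlgebra.mapRingHom X (Int.castRingHom ℂ)).toIntAlgHom
  convert h2 using 1
  simp [clsSum]

lemma burnside_simple {X : Type*} [Group X] [Finite X] (C : Finset X)
    (hC : ∀ c ∈ C, ∀ x, x * c * x⁻¹ ∈ C) (hC2 : ∀ c ∈ C, ∀ d ∈ C, IsConj c d)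
    (p n : ℕ) (hp : p.Prime) (hcard : C.card = p ^ n)
    (hgen : Subgroup.closure (C : Set X) = ⊤)
    {U : Type*} [AddCommGroup U] [Module (MonoidAlgebra ℂ X) U] [Module ℂ U]
    [IsScalarTower ℂ (MonoidAlgebra ℂ X) U] [FiniteDimensional ℂ U]
    [IsSimpleModule (MonoidAlgebra ℂ X) U]
    (hinj : ∀ u : U, clsSum ℂ C • u = 0 → u = 0)
    (hinv : ∀ u : U, (∀ x ∈ commutator X, MonoidAlgebra.of ℂ X x • u = u) → u = 0) :
    p ∣ Module.finrank ℂ U := by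
  by_contra hpd
  have hnt : Nontrivial U := IsSimpleModule.nontrivial (MonoidAlgebra ℂ X) U
  set d := Module.finrank ℂ U with hd
  have hd0 : 0 < d := Module.finrank_pos
  let ρ : MonoidAlgebra ℂ X →ₐ[ℂ] Module.End ℂ U := Algebra.lsmul ℂ ℂ U
  have hρ : ∀ a u, ρ a u = a • u := fun a u => rfl
  -- Schur
  let Z : Module.End (MonoidAlgebra ℂ X) U :=
    { toFun := fun u => clsSum ℂ C • u
      map_add' := fun u v => smul_add _ _ _
      map_smul' := fun a u => by
        simp only [RingHom.id_apply, ← mul_smul, clsSum_comm ℂ C hC] }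
  obtain ⟨w, hw⟩ := (IsSimpleModule.algebraMap_end_bijective_of_isAlgClosed
    (A := MonoidAlgebra ℂ X) (V := U) ℂ).2 Z
  have hw' : ∀ u : U, clsSum ℂ C • u = w • u := by
    intro u
    have := LinearMap.congr_fun hw u
    exact this.symm
  have hρw : ρ (clsSum ℂ C) = algebraMap ℂ _ w := by
    ext u; simp [hρ, hw', Module.algebraMap_end_apply]
  have hwi : IsIntegral ℤ w := by
    have h1 := (clsSum_integral C).map (ρ.restrictScalars ℤ)
    have h2 : (ρ.restrictScalars ℤ) (clsSum ℂ C) = algebraMap ℂ (Module.End ℂ U) w := hρw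
    rw [h2] at h1
    exact (isIntegral_algebraMap_iff (FaithfulSMul.algebraMap_injective ℂ _)).1 h1
  have hw0 : w ≠ 0 := by
    intro h
    obtain ⟨u, hu⟩ := exists_ne (0 : U)
    exact hu (hinj u (by rw [hw', h, zero_smul]))
  have hCne : C.Nonempty := by
    rw [← Finset.card_pos, hcard]; exact pow_pos hp.pos _
  obtain ⟨s, hs⟩ := hCne
  -- trace
  have htrc : ∀ c ∈ C, LinearMap.trace ℂ U (ρ (MonoidAlgebra.of ℂ X c)) =
      LinearMap.trace ℂ U (ρ (MonoidAlgebra.of ℂ X s)) := by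
    intro c hc
    obtain ⟨x, hx⟩ := isConj_iff.1 (hC2 s hs c hc)
    rw [← hx, map_mul, map_mul, LinearMap.trace_mul_comm, ← map_mul, ← map_mul]
    congr 3; group
  have htr : (p ^ n : ℂ) * LinearMap.trace ℂ U (ρ (MonoidAlgebra.of ℂ X s)) = w * d := by
    have h1 : LinearMap.trace ℂ U (ρ (clsSum ℂ C)) = w * d := by
      rw [hρw, Algebra.algebraMap_eq_smul_one, map_smul, LinearMap.trace_one, smul_eq_mul]
    rw [← h1, clsSum, map_sum, map_sum, Finset.sum_congr rfl htrc, Finset.sum_const, hcard]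
    simp
  set t := LinearMap.trace ℂ U (ρ (MonoidAlgebra.of ℂ X s)) with ht
  have hord : ∀ x : X, (ρ (MonoidAlgebra.of ℂ X x)) ^ Nat.card X = 1 := by
    intro x
    rw [← map_pow, ← map_pow, pow_card_eq_one', map_one, map_one]
  have hdC : (d : ℂ) ≠ 0 := by exact_mod_cast hd0.ne'
  have ht0 : t ≠ 0 := by
    intro h
    rw [h, mul_zero] at htr
    exact mul_ne_zero hw0 hdC htr.symm
  have hti : IsIntegral ℤ t := by
    rw [ht, Module.End.trace_eq_sum_roots_charpoly_of_splits (IsAlgClosed.splits _)]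
    refine IsIntegral.multiset_sum ?_
    intro z hz
    have hz' : (ρ (MonoidAlgebra.of ℂ X s)).HasEigenvalue z := by
      rw [Module.End.hasEigenvalue_iff_isRoot_charpoly]
      exact (Polynomial.mem_roots'.1 hz).2
    obtain ⟨v, hv⟩ := hz'.exists_hasEigenvector
    have h1 := hv.pow_apply (Nat.card X)
    rw [hord] at h1
    have h2 : (z ^ Nat.card X - 1) • v = 0 := by rw [sub_smul, ← h1]; simp
    have h3 : z ^ Nat.card X = 1 := by
      rcases smul_eq_zero.1 h2 with h | h
      · exact sub_eq_zero.1 h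
      · exact absurd h hv.2
    refine IsIntegral.of_pow Nat.card_pos (?_ : IsIntegral ℤ (z ^ Nat.card X))
    rw [h3]; exact isIntegral_one
  have hIntg : IsIntegral ℤ (t / d) := by
    have hcop : IsCoprime ((p : ℤ) ^ n) (d : ℤ) := by
      apply IsCoprime.pow_left
      rw [Nat.isCoprime_iff_coprime]
      exact (Nat.Prime.coprime_iff_not_dvd hp).2 hpd
    obtain ⟨a, b, hab⟩ := hcop
    have hab' : (a : ℂ) * (p : ℂ) ^ n + b * d = 1 := by exact_mod_cast hab
    have : t / d = a * w + b * t := by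
      rw [div_eq_iff hdC]
      linear_combination (-t) * hab' + (a : ℂ) * htr
    rw [this]
    have hai : ∀ a : ℤ, IsIntegral ℤ (a : ℂ) := fun a => isIntegral_algebraMap (R := ℤ) (x := a)
    exact ((hai a).mul hwi).add ((hai b).mul hti)
  have hsc : ∀ c ∈ C, ∃ u : ℂ, ∀ v : U, MonoidAlgebra.of ℂ X c • v = u • v := by
    intro c hc
    refine scalar_of_integral_trace (ρ (MonoidAlgebra.of ℂ X c)) (Nat.card X) Nat.card_pos
      (hord c) hd0 ?_ ?_
    · rw [htrc c hc]; exact hIntg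
    · rw [htrc c hc]; exact ht0
  have hcomm : ∀ x y : X, ρ (MonoidAlgebra.of ℂ X (x * y)) = ρ (MonoidAlgebra.of ℂ X (y * x)) := by
    have hall : ∀ x : X, ∃ u : ℂ, ∀ v : U, MonoidAlgebra.of ℂ X x • v = u • v := by
      intro x
      have hx : x ∈ Subgroup.closure (C : Set X) := by rw [hgen]; trivial
      induction hx using Subgroup.closure_induction with
      | mem c hc => exact hsc c hc
      | one => exact ⟨1, fun v => by rw [map_one, one_smul, one_smul]⟩
      | mul a b _ _ ha hb =>
        obtain ⟨u, hu⟩ := ha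
        obtain ⟨u', hu'⟩ := hb
        refine ⟨u' * u, fun v => ?_⟩
        rw [map_mul, mul_smul, hu', hu, smul_smul, mul_comm]
      | inv a _ ha =>
        obtain ⟨u, hu⟩ := ha
        refine ⟨u⁻¹, fun v => ?_⟩
        have h1 : MonoidAlgebra.of ℂ X a • (MonoidAlgebra.of ℂ X a⁻¹ • v) = v := by
          rw [← mul_smul, ← map_mul, mul_inv_cancel, map_one, one_smul]
        rw [hu] at h1
        have hu0 : u ≠ 0 := by
          intro h
          obtain ⟨v, hv⟩ := exists_ne (0 : U)
          have h3 : MonoidAlgebra.of ℂ X a⁻¹ • (MonoidAlgebra.of ℂ X a • v) = v := by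
            rw [← mul_smul, ← map_mul, inv_mul_cancel, map_one, one_smul]
          rw [hu, h, zero_smul, smul_zero] at h3
          exact hv h3.symm
        rw [eq_inv_smul_iff₀ hu0, h1]
    intro x y
    obtain ⟨u, hu⟩ := hall x
    obtain ⟨u', hu'⟩ := hall y
    ext v
    rw [hρ, hρ, map_mul, map_mul, mul_smul, mul_smul, hu', hu, hu, hu', smul_smul, smul_smul,
      mul_comm]
  obtain ⟨v, hv⟩ := exists_ne (0 : U)
  refine hv (hinv v ?_)
  let φ : X →* (Module.End ℂ U)ˣ := (ρ : MonoidAlgebra ℂ X →* Module.End ℂ U).comp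
    (MonoidAlgebra.of ℂ X) |>.toHomUnits
  have hk : commutator X ≤ φ.ker := by
    rw [commutator_def, Subgroup.commutator_le]
    intro x _ y _
    rw [MonoidHom.mem_ker, map_commutatorElement, commutatorElement_eq_one_iff_mul_comm,
      ← map_mul, ← map_mul]
    exact Units.ext (hcomm x y)
  intro x hx
  have := congrArg Units.val (MonoidHom.mem_ker.1 (hk hx))
  exact LinearMap.congr_fun this v

/-- no invariants under the commutator subgroup and injective class sum: dimension divisible. -/
lemma burnside_dvd {X : Type*} [Group X] [Finite X] (C : Finset X)
    (hC : ∀ c ∈ C, ∀ x, x * c * x⁻¹ ∈ C) (hC2 : ∀ c ∈ C, ∀ d ∈ C, IsConj c d)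
    (p n : ℕ) (hp : p.Prime) (hcard : C.card = p ^ n)
    (hgen : Subgroup.closure (C : Set X) = ⊤)
    {V : Type*} [AddCommGroup V] [Module (MonoidAlgebra ℂ X) V] [Module ℂ V]
    [IsScalarTower ℂ (MonoidAlgebra ℂ X) V] [FiniteDimensional ℂ V]
    (m : ℕ) (W : Submodule (MonoidAlgebra ℂ X) V)
    (hm : Module.finrank ℂ W = m)
    (hinj : ∀ u ∈ W, clsSum ℂ C • u = 0 → u = 0)
    (hinv : ∀ u ∈ W, (∀ x ∈ commutator X, MonoidAlgebra.of ℂ X x • u = u) → u = 0) :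
    p ∣ Module.finrank ℂ W := by
  induction m using Nat.strong_induction_on generalizing W with
  | _ m ih =>
    have hne : NeZero (Nat.card X : ℂ) := ⟨by exact_mod_cast Nat.card_pos.ne'⟩
    have hfd : ∀ W : Submodule (MonoidAlgebra ℂ X) V, FiniteDimensional ℂ W := fun W =>
      inferInstanceAs (FiniteDimensional ℂ (W.restrictScalars ℂ))
    rcases eq_or_ne W ⊥ with rfl | hW
    · have : Module.finrank ℂ (⊥ : Submodule (MonoidAlgebra ℂ X) V) = 0 :=
        Module.finrank_zero_of_subsingleton
      rw [this]; exact dvd_zero _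
    obtain ⟨U, hU, hUW⟩ := (IsAtomic.eq_bot_or_exists_atom_le W).resolve_left hW
    obtain ⟨U', hU'⟩ := exists_isCompl U
    have hdisj : Disjoint U (U' ⊓ W) := hU'.disjoint.mono_right inf_le_left
    have hsup : U ⊔ (U' ⊓ W) = W := by
      rw [← sup_inf_assoc_of_le U' hUW, hU'.sup_eq_top, top_inf_eq]
    have hsimple : IsSimpleModule (MonoidAlgebra ℂ X) U := isSimpleModule_iff_isAtom.2 hU
    have hadd : Module.finrank ℂ W = Module.finrank ℂ U + Module.finrank ℂ (U' ⊓ W : Submodule _ V) := by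
      have h := Submodule.finrank_sup_add_finrank_inf_eq (U.restrictScalars ℂ)
        ((U' ⊓ W).restrictScalars ℂ)
      have h1 : U.restrictScalars ℂ ⊔ (U' ⊓ W).restrictScalars ℂ = W.restrictScalars ℂ := by
        rw [← Submodule.restrictScalars_sup, hsup]
      have h2 : U.restrictScalars ℂ ⊓ (U' ⊓ W).restrictScalars ℂ = ⊥ := by
        rw [← Submodule.restrictScalars_inf, hdisj.eq_bot, Submodule.restrictScalars_bot]
      rw [h1, h2, finrank_bot, add_zero] at h
      exact h
    have hUpos : 0 < Module.finrank ℂ U := by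
      have := IsSimpleModule.nontrivial (MonoidAlgebra ℂ X) U
      exact Module.finrank_pos
    rw [hadd]
    refine dvd_add ?_ (ih _ (by omega) (U' ⊓ W) rfl (fun u hu => hinj u hu.2) (fun u hu => hinv u hu.2))
    refine burnside_simple C hC hC2 p n hp hcard hgen ?_ ?_
    · intro u hu
      exact Subtype.ext (hinj u (hUW u.2) (by simpa using congrArg Subtype.val hu))
    · intro u hu
      exact Subtype.ext (hinv u (hUW u.2) (fun x hx => by simpa using congrArg Subtype.val (hu x hx)))
end Rep

lemma repr_core {X : Type*} [Group X] [Finite X] (C : Finset X)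
    (hC : ∀ c ∈ C, ∀ x, x * c * x⁻¹ ∈ C) (hC2 : ∀ c ∈ C, ∀ d ∈ C, IsConj c d)
    (p n : ℕ) (hp : p.Prime) (hcard : C.card = p ^ n)
    (hgen : Subgroup.closure (C : Set X) = ⊤)
    {V : Type*} [AddCommGroup V] [Module ℂ V] [FiniteDimensional ℂ V]
    (ρ : Representation ℂ X V) (μ : ℂ) (hμ : μ ≠ 0) (L : Submodule ℂ V)
    (hL : ∀ v ∈ L, ∀ x, ρ x v ∈ L)
    (hLW : L ≤ Module.End.maxGenEigenspace (∑ c ∈ C, ρ c) μ)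
    (hinv : ∀ v ∈ Module.End.maxGenEigenspace (∑ c ∈ C, ρ c) μ,
      (∀ x ∈ commutator X, ρ x v = v) → v ∈ L) :
    ∃ k, (∑ c ∈ C, ρ c).charpoly.rootMultiplicity μ = Module.finrank ℂ L + p * k := by
  set T : Module.End ℂ V := ∑ c ∈ C, ρ c with hT
  rw [← LinearMap.finrank_maxGenEigenspace_eq]
  let inst : Module (MonoidAlgebra ℂ X) V := Module.compHom V ρ.asAlgebraHom.toRingHom
  have hsm : ∀ (a : MonoidAlgebra ℂ X) (v : V), a • v = ρ.asAlgebraHom a v := fun a v => rfl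
  have hof : ∀ (x : X) (v : V), MonoidAlgebra.of ℂ X x • v = ρ x v := by
    intro x v; rw [hsm, Representation.asAlgebraHom_of]
  have htower : IsScalarTower ℂ (MonoidAlgebra ℂ X) V := ⟨fun r a v => by
    rw [hsm, hsm, map_smul, LinearMap.smul_apply]⟩
  have hcs : ∀ v : V, clsSum ℂ C • v = T v := by
    intro v
    rw [hsm, clsSum, map_sum, hT]
    simp only [Representation.asAlgebraHom_of]
  -- submodules
  have mk : ∀ (L : Submodule ℂ V), (∀ v ∈ L, ∀ x, ρ x v ∈ L) →
      ∃ L' : Submodule (MonoidAlgebra ℂ X) V, L'.restrictScalars ℂ = L := by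
    intro L hL
    refine ⟨{ carrier := L, add_mem' := L.add_mem, zero_mem' := L.zero_mem, smul_mem' := ?_ }, ?_⟩
    · intro a v hv
      induction a using MonoidAlgebra.induction_on with
      | of x => rw [hof]; exact hL v hv x
      | add f g hf hg => rw [add_smul]; exact L.add_mem hf hg
      | smul r f hf => rw [smul_assoc]; exact L.smul_mem r hf
    · ext v; rfl
  have hcomm : ∀ x, Commute T (ρ x) := by
    intro x
    ext v
    have := clsSum_comm ℂ C hC (MonoidAlgebra.of ℂ X x)
    have h2 := congrArg (fun a => a • v) this
    simp only [mul_smul, hcs, hof] at h2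
    exact h2
  obtain ⟨W, hW⟩ := mk (T.maxGenEigenspace μ) (by
    intro v hv x
    exact Module.End.mapsTo_maxGenEigenspace_of_comm (hcomm x) μ hv)
  obtain ⟨L', hL'⟩ := mk L hL
  have hmW : ∀ v, v ∈ W ↔ v ∈ T.maxGenEigenspace μ := fun v => by rw [← hW]; rfl
  have hmL : ∀ v, v ∈ L' ↔ v ∈ L := fun v => by rw [← hL']; rfl
  have hne : NeZero (Nat.card X : ℂ) := ⟨by exact_mod_cast Nat.card_pos.ne'⟩
  obtain ⟨U, hU⟩ := exists_isCompl L'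
  have hLW' : L' ≤ W := fun v hv => (hmW v).2 (hLW ((hmL v).1 hv))
  have hdisj : Disjoint L' (U ⊓ W) := hU.disjoint.mono_right inf_le_left
  have hsup : L' ⊔ (U ⊓ W) = W := by
    rw [← sup_inf_assoc_of_le U hLW', hU.sup_eq_top, top_inf_eq]
  have hadd : Module.finrank ℂ (T.maxGenEigenspace μ) =
      Module.finrank ℂ L + Module.finrank ℂ (U ⊓ W : Submodule _ V) := by
    have h := Submodule.finrank_sup_add_finrank_inf_eq (L'.restrictScalars ℂ)
      ((U ⊓ W).restrictScalars ℂ)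
    have h1 : L'.restrictScalars ℂ ⊔ (U ⊓ W).restrictScalars ℂ = W.restrictScalars ℂ := by
      rw [← Submodule.restrictScalars_sup, hsup]
    have h2 : L'.restrictScalars ℂ ⊓ (U ⊓ W).restrictScalars ℂ = ⊥ := by
      rw [← Submodule.restrictScalars_inf, hdisj.eq_bot, Submodule.restrictScalars_bot]
    rw [h1, h2, finrank_bot, add_zero, hW, hL'] at h
    exact h
  have hdvd : p ∣ Module.finrank ℂ (U ⊓ W : Submodule _ V) := by
    refine burnside_dvd C hC hC2 p n hp hcard hgen _ (U ⊓ W) rfl ?_ ?_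
    · intro v hv h0
      rw [hcs] at h0
      obtain ⟨k, hk⟩ := (Module.End.mem_maxGenEigenspace T μ v).1 ((hmW v).1 hv.2)
      have h1 : ∀ k : ℕ, ((T - μ • (1 : Module.End ℂ V)) ^ k) v = (-μ) ^ k • v := by
        intro k
        induction k with
        | zero => simp
        | succ k ih =>
          rw [pow_succ', Module.End.mul_apply, ih, map_smul]
          simp [h0, pow_succ, smul_smul]
      rw [h1] at hk
      exact (smul_eq_zero.1 hk).resolve_left (pow_ne_zero _ (neg_ne_zero.2 hμ))
    · intro v hv h
      have h1 : v ∈ L' := (hmL v).2 (hinv v ((hmW v).1 hv.2) (fun x hx => by rw [← hof]; exact h x hx))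
      have : v ∈ L' ⊓ (U ⊓ W) := ⟨h1, hv⟩
      rw [hdisj.eq_bot] at this
      simpa using this
  obtain ⟨k, hk⟩ := hdvd
  exact ⟨k, by rw [hadd, hk]⟩

section Mono
variable {X : Type*} [Group X] (Y : Subgroup X)

open Classical in
/-- extension by zero of a character -/
noncomputable def extZ {S : Type*} [CommRing S] (φ : Y →* S) (g : X) : S :=
  if h : g ∈ Y then φ ⟨g, h⟩ else 0

lemma extZ_mem {S : Type*} [CommRing S] (φ : Y →* S) {g : X} (h : g ∈ Y) :
    extZ Y φ g = φ ⟨g, h⟩ := by simp [extZ, h]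

lemma extZ_not_mem {S : Type*} [CommRing S] (φ : Y →* S) {g : X} (h : g ∉ Y) :
    extZ Y φ g = 0 := by simp [extZ, h]

lemma extZ_mul {S : Type*} [CommRing S] (φ : Y →* S) (g : X) {h : X} (hh : h ∈ Y) :
    extZ Y φ (g * h) = extZ Y φ g * extZ Y φ h := by
  by_cases hg : g ∈ Y
  · rw [extZ_mem Y φ hg, extZ_mem Y φ hh, extZ_mem Y φ (Y.mul_mem hg hh), ← map_mul]; rfl
  · rw [extZ_not_mem Y φ hg, zero_mul, extZ_not_mem]
    rwa [Y.mul_mem_cancel_right hh]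

/-- matrices of the induced representation -/
noncomputable def monoM {S : Type*} [CommRing S] (φ : Y →* S) (x : X) :
    Matrix (X ⧸ Y) (X ⧸ Y) S :=
  fun u v => extZ Y φ ((Quotient.out u)⁻¹ * x * Quotient.out v)

lemma monoM_map {S S' : Type*} [CommRing S] [CommRing S'] (f : S →+* S') (φ : Y →* S) (x : X) :
    (monoM Y φ x).map f = monoM Y ((f : S →* S').comp φ) x := by
  ext u v
  simp only [Matrix.map_apply, monoM, extZ]
  split_ifs <;> simp

lemma out_mem_iff (g : X) (v : X ⧸ Y) : (Quotient.out v)⁻¹ * g ∈ Y ↔ v = (g : X ⧸ Y) := by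
  rw [← QuotientGroup.eq]
  have : ((Quotient.out v : X) : X ⧸ Y) = v := Quotient.out_eq' v
  rw [this]

lemma monoM_one [DecidableEq (X ⧸ Y)] {S : Type*} [CommRing S] (φ : Y →* S) :
    monoM Y φ 1 = 1 := by
  ext u v
  simp only [monoM, mul_one, Matrix.one_apply]
  have hv : ((Quotient.out v : X) : X ⧸ Y) = v := Quotient.out_eq' v
  split_ifs with h
  · subst h
    rw [inv_mul_cancel, extZ_mem Y φ Y.one_mem]
    exact map_one φ
  · rw [extZ_not_mem]
    rwa [out_mem_iff, hv]

lemma monoM_mul [Fintype (X ⧸ Y)] {S : Type*} [CommRing S] (φ : Y →* S) (x x' : X) :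
    monoM Y φ (x * x') = monoM Y φ x * monoM Y φ x' := by
  ext u w
  simp only [monoM, Matrix.mul_apply]
  rw [Finset.sum_eq_single ((x' * Quotient.out w : X) : X ⧸ Y)]
  · rw [← extZ_mul]
    · congr 1; group
    · rw [mul_assoc, out_mem_iff]
  · intro v _ hv
    rw [extZ_not_mem (g := (Quotient.out v)⁻¹ * x' * Quotient.out w), mul_zero]
    rwa [mul_assoc, out_mem_iff]
  · simp

/-- the induced representation -/
noncomputable def monoRep [Fintype (X ⧸ Y)] [DecidableEq (X ⧸ Y)] (φ : Y →* ℂ) :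
    Representation ℂ X (X ⧸ Y → ℂ) where
  toFun x := Matrix.toLin' (monoM Y φ x)
  map_one' := by rw [monoM_one, Matrix.toLin'_one]; rfl
  map_mul' x y := by rw [monoM_mul, Matrix.toLin'_mul]; rfl

lemma monoRep_apply [Fintype (X ⧸ Y)] [DecidableEq (X ⧸ Y)] (φ : Y →* ℂ) (x : X)
    (f : X ⧸ Y → ℂ) (u : X ⧸ Y) (v : X ⧸ Y)
    (h : (Quotient.out u)⁻¹ * x * Quotient.out v ∈ Y) :
    monoRep Y φ x f u = φ ⟨_, h⟩ * f v := by
  change (Matrix.toLin' (monoM Y φ x)) f u = _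
  rw [Matrix.toLin'_apply, Matrix.mulVec, dotProduct, Finset.sum_eq_single v]
  · rw [monoM, extZ_mem Y φ h]
  · intro w _ hw
    rw [monoM, extZ_not_mem, zero_mul]
    intro hm
    apply hw
    have h1 := Y.mul_mem (Y.inv_mem h) hm
    have h2 : (Quotient.out v)⁻¹ * Quotient.out w ∈ Y := by
      convert h1 using 1; group
    rw [out_mem_iff] at h2
    rw [h2]
    exact (Quotient.out_eq' w).symm
  · simp

end Mono

open Polynomial in
lemma roots_count {k : Type*} [Field k] (π : integralClosure ℤ ℂ →+* k)
    (P : Polynomial (integralClosure ℤ ℂ)) (hP : P.Monic) (t : k) :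
    ∃ F : Finset (integralClosure ℤ ℂ), (∀ r ∈ F, π r = t) ∧
      (∀ r, π r = t → r ∉ F →
        (P.map (algebraMap (integralClosure ℤ ℂ) ℂ)).rootMultiplicity (r : ℂ) = 0) ∧
      (P.map π).rootMultiplicity t =
        ∑ r ∈ F, (P.map (algebraMap (integralClosure ℤ ℂ) ℂ)).rootMultiplicity (r : ℂ) := by
  classical
  have hinj : Function.Injective (algebraMap (integralClosure ℤ ℂ) ℂ) := Subtype.val_injective
  have hs : P.Splits := by
    refine Splits.of_splits_map_of_injective (i := algebraMap (integralClosure ℤ ℂ) ℂ) hinj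
      (IsAlgClosed.splits _) ?_
    intro a ha
    have hr : (P.map (algebraMap (integralClosure ℤ ℂ) ℂ)).IsRoot a :=
      (mem_roots'.1 ha).2
    have hIntg : IsIntegral (integralClosure ℤ ℂ) a := by
      refine ⟨P, hP, ?_⟩
      rw [IsRoot, eval_map] at hr
      exact hr
    have : IsIntegral ℤ a := isIntegral_trans (R := ℤ) (A := integralClosure ℤ ℂ) a hIntg
    exact ⟨⟨a, this⟩, rfl⟩
  refine ⟨P.roots.toFinset.filter (fun r => π r = t), ?_, ?_, ?_⟩
  · intro r hr
    exact (Finset.mem_filter.1 hr).2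
  · intro r hr hF
    have h1 : r ∉ P.roots := by
      intro h
      exact hF (Finset.mem_filter.2 ⟨Multiset.mem_toFinset.2 h, hr⟩)
    have h2 := eq_rootMultiplicity_map (p := P) hinj r
    have h3 : P.rootMultiplicity r = 0 := by
      rw [← count_roots]; exact Multiset.count_eq_zero.2 h1
    rw [h3] at h2
    exact h2.symm
  · have hm : ∀ r : integralClosure ℤ ℂ,
        (P.map (algebraMap (integralClosure ℤ ℂ) ℂ)).rootMultiplicity (r : ℂ) = P.roots.count r := by
      intro r
      rw [count_roots]
      exact (eq_rootMultiplicity_map (p := P) hinj r).symm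
    simp_rw [hm]
    rw [← count_roots, hs.roots_map_of_ne_zero (hP.map π).ne_zero, Multiset.count_map]
    rw [← Multiset.toFinset_sum_count_eq, Multiset.toFinset_filter]
    have : ∀ a : integralClosure ℤ ℂ, (t = π a) = (π a = t) := fun a => propext eq_comm
    simp_rw [this]
    refine Finset.sum_congr rfl (fun r hr => ?_)
    rw [Multiset.count_filter, if_pos (Finset.mem_filter.1 hr).2]

section Mono2
variable {X : Type*} [Group X] (Y : Subgroup X)

lemma sum_monoRep [Fintype (X ⧸ Y)] [DecidableEq (X ⧸ Y)] (φ : Y →* ℂ) (C : Finset X) :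
    (∑ c ∈ C, monoRep Y φ c) = Matrix.toLin' (∑ c ∈ C, monoM Y φ c) := by
  rw [map_sum]; rfl

lemma mono_nontriv [Finite X] [Fintype (X ⧸ Y)] [DecidableEq (X ⧸ Y)] (C : Finset X)
    (hC : ∀ c ∈ C, ∀ x, x * c * x⁻¹ ∈ C) (hC2 : ∀ c ∈ C, ∀ d ∈ C, IsConj c d)
    (p n : ℕ) (hp : p.Prime) (hcard : C.card = p ^ n)
    (hgen : Subgroup.closure (C : Set X) = ⊤) (φ : Y →* ℂ) (y : X) (hy : y ∈ Y)
    (hyX : y ∈ commutator X) (hφ : φ ⟨y, hy⟩ ≠ 1) (μ : ℂ) (hμ : μ ≠ 0) :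
    p ∣ (∑ c ∈ C, monoM Y φ c).charpoly.rootMultiplicity μ := by
  have key := repr_core C hC hC2 p n hp hcard hgen (monoRep Y φ) μ hμ ⊥
    (by intro v hv x; rw [Submodule.mem_bot] at hv ⊢; rw [hv, map_zero]) bot_le ?_
  · obtain ⟨k, hk⟩ := key
    rw [finrank_bot, zero_add, sum_monoRep, Matrix.charpoly_toLin'] at hk
    exact ⟨k, hk⟩
  · intro v _ hv
    rw [Submodule.mem_bot]
    funext u
    have hx : Quotient.out u * y * (Quotient.out u)⁻¹ ∈ commutator X :=
      (inferInstance : (commutator X).Normal).conj_mem y hyX _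
    have e : (Quotient.out u)⁻¹ * (Quotient.out u * y * (Quotient.out u)⁻¹) * Quotient.out u = y := by
      group
    have h1 := monoRep_apply Y φ (Quotient.out u * y * (Quotient.out u)⁻¹) v u u (by rwa [e])
    rw [hv _ hx] at h1
    have h2 : φ ⟨_, (by rwa [e] : (Quotient.out u)⁻¹ * (Quotient.out u * y * (Quotient.out u)⁻¹)
      * Quotient.out u ∈ Y)⟩ = φ ⟨y, hy⟩ := by
      congr 1; exact Subtype.ext e
    rw [h2] at h1
    by_contra h0
    have h0 : v u ≠ 0 := h0
    apply hφ
    have h3 : (φ ⟨y, hy⟩ - 1) * v u = 0 := by rw [sub_mul, ← h1]; ring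
    exact sub_eq_zero.1 ((mul_eq_zero.1 h3).resolve_right h0)

lemma mono_one_apply [Fintype (X ⧸ Y)] [DecidableEq (X ⧸ Y)] (x : X)
    (f : X ⧸ Y → ℂ) (g : X) : monoRep Y 1 x f (g : X ⧸ Y) = f ((x⁻¹ * g : X) : X ⧸ Y) := by
  rw [monoRep_apply Y 1 x f (g : X ⧸ Y) ((x⁻¹ * g : X) : X ⧸ Y), MonoidHom.one_apply, one_mul]
  rw [mul_assoc, out_mem_iff, eq_comm, QuotientGroup.eq]
  have h : (((Quotient.out ((x⁻¹ * g : X) : X ⧸ Y)) : X) : X ⧸ Y) = ((x⁻¹ * g : X) : X ⧸ Y) :=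
    Quotient.out_eq' _
  rw [QuotientGroup.eq] at h
  convert h using 1; group

lemma mono_triv [Finite X] [Fintype (X ⧸ Y)] [DecidableEq (X ⧸ Y)] (C : Finset X)
    (hC : ∀ c ∈ C, ∀ x, x * c * x⁻¹ ∈ C) (hC2 : ∀ c ∈ C, ∀ d ∈ C, IsConj c d)
    (p n : ℕ) (hp : p.Prime) (hcard : C.card = p ^ n)
    (hgen : Subgroup.closure (C : Set X) = ⊤) (c : X) (hc : c ∈ C) (hcY : c ∈ Y)
    (μ : ℂ) (hμ : μ ≠ 0) :
    ∃ k, (∑ c ∈ C, monoM Y (1 : Y →* ℂ) c).charpoly.rootMultiplicity μ =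
      (if μ = (p : ℂ) ^ n then 1 else 0) + p * k := by
  have htop : commutator X ⊔ Y = ⊤ := by
    rw [eq_top_iff, ← hgen, Subgroup.closure_le]
    intro d hd
    obtain ⟨g, hg⟩ := isConj_iff.1 (hC2 c hc d hd)
    have : d = (g * c * g⁻¹ * c⁻¹) * c := by rw [← hg]; group
    rw [this]
    refine Subgroup.mul_mem _ (Subgroup.mem_sup_left ?_) (Subgroup.mem_sup_right hcY)
    exact Subgroup.commutator_mem_commutator (Subgroup.mem_top g) (Subgroup.mem_top c)
  have hconst : ∀ v : X ⧸ Y → ℂ, (∀ x ∈ commutator X, monoRep Y 1 x v = v) →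
      ∀ g : X, v (g : X ⧸ Y) = v ((1 : X) : X ⧸ Y) := by
    intro v hv g
    have hg : g ∈ commutator X ⊔ Y := by rw [htop]; trivial
    obtain ⟨a, ha, b, hb, rfl⟩ := Subgroup.mem_sup_of_normal_left.1 hg
    have h1 : ((a * b : X) : X ⧸ Y) = (a : X ⧸ Y) := by
      rw [QuotientGroup.eq]; simpa using hb
    rw [h1, ← congrFun (hv a ha) (a : X ⧸ Y), mono_one_apply, inv_mul_cancel]
  have hone : ∀ x : X, monoRep Y 1 x (fun _ => (1 : ℂ)) = fun _ => 1 := by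
    intro x; funext u
    obtain ⟨g, rfl⟩ := QuotientGroup.mk_surjective u
    rw [mono_one_apply]
  have heig : (∑ c ∈ C, monoRep Y 1 c) (fun _ => (1 : ℂ)) = ((p : ℂ) ^ n) • (fun _ => (1 : ℂ)) := by
    rw [LinearMap.sum_apply, Finset.sum_congr rfl (fun c _ => hone c), Finset.sum_const, hcard]
    funext u; simp
  by_cases hμp : μ = (p : ℂ) ^ n
  · subst hμp
    rw [if_pos rfl]
    have key := repr_core C hC hC2 p n hp hcard hgen (monoRep Y 1) _ hμ
      (ℂ ∙ (fun _ : X ⧸ Y => (1 : ℂ))) ?_ ?_ ?_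
    · obtain ⟨k, hk⟩ := key
      rw [sum_monoRep, Matrix.charpoly_toLin', finrank_span_singleton] at hk
      · exact ⟨k, hk⟩
      · intro h
        exact one_ne_zero (congrFun h ((1 : X) : X ⧸ Y))
    · intro v hv x
      obtain ⟨a, rfl⟩ := Submodule.mem_span_singleton.1 hv
      rw [map_smul, hone]
      exact hv
    · rw [Submodule.span_singleton_le_iff_mem]
      rw [Module.End.mem_maxGenEigenspace]
      refine ⟨1, ?_⟩
      rw [pow_one, LinearMap.sub_apply, heig]
      simp
    · intro v _ hv
      rw [Submodule.mem_span_singleton]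
      refine ⟨v ((1 : X) : X ⧸ Y), ?_⟩
      funext u
      obtain ⟨g, rfl⟩ := QuotientGroup.mk_surjective u
      rw [hconst v hv g]
      simp
  · rw [if_neg hμp]
    have key := repr_core C hC hC2 p n hp hcard hgen (monoRep Y 1) μ hμ ⊥
      (by intro v hv x; rw [Submodule.mem_bot] at hv ⊢; rw [hv, map_zero]) bot_le ?_
    · obtain ⟨k, hk⟩ := key
      rw [finrank_bot, sum_monoRep, Matrix.charpoly_toLin'] at hk
      exact ⟨k, hk⟩
    · intro v hvW hv
      rw [Submodule.mem_bot]
      have hve : v = v ((1 : X) : X ⧸ Y) • (fun _ => (1 : ℂ)) := by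
        funext u
        obtain ⟨g, rfl⟩ := QuotientGroup.mk_surjective u
        rw [hconst v hv g]
        simp
      have hev : (∑ c ∈ C, monoRep Y 1 c) v = ((p : ℂ) ^ n) • v := by
        rw [hve, map_smul, heig, smul_comm]
      obtain ⟨k, hk⟩ := (Module.End.mem_maxGenEigenspace _ μ v).1 hvW
      have h1 : ∀ k : ℕ, (((∑ c ∈ C, monoRep Y 1 c) - μ • (1 : Module.End ℂ (X ⧸ Y → ℂ))) ^ k) v
          = ((p : ℂ) ^ n - μ) ^ k • v := by
        intro k
        induction k with
        | zero => simp
        | succ k ih =>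
          rw [pow_succ', Module.End.mul_apply, ih, map_smul, LinearMap.sub_apply, hev,
            LinearMap.smul_apply, Module.End.one_apply, ← sub_smul, smul_smul, pow_succ]
      rw [h1] at hk
      exact (smul_eq_zero.1 hk).resolve_left (pow_ne_zero _ (sub_ne_zero.2 (Ne.symm hμp)))

end Mono2

lemma prime_not_unit_integralClosure (q : ℕ) (hq : q.Prime) :
    ¬ IsUnit ((q : ℕ) : integralClosure ℤ ℂ) := by
  intro h
  obtain ⟨x, hx⟩ := h.exists_right_inv
  have hq0 : (q : ℂ) ≠ 0 := by exact_mod_cast hq.ne_zero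
  have h1 : (q : ℂ) * (x : ℂ) = 1 := by
    have := congrArg (Subtype.val) hx
    simpa using this
  have h2 : (x : ℂ) = algebraMap ℚ ℂ ((q : ℚ)⁻¹) := by
    rw [map_inv₀]
    simp only [map_natCast]
    field_simp
    linear_combination h1
  have h3 : IsIntegral ℤ ((q : ℚ)⁻¹) := by
    have h4 : IsIntegral ℤ (x : ℂ) := x.2
    rw [h2] at h4
    exact (isIntegral_algebraMap_iff (algebraMap ℚ ℂ).injective).1 h4
  obtain ⟨m, hm⟩ := IsIntegrallyClosed.isIntegral_iff.1 h3
  have hq0' : (q : ℚ) ≠ 0 := by exact_mod_cast hq.ne_zero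
  have h5 : (m : ℚ) * q = 1 := by
    have : (m : ℚ) = (q : ℚ)⁻¹ := by simpa using hm
    rw [this, inv_mul_cancel₀ hq0']
  have h6 : m * (q : ℤ) = 1 := by exact_mod_cast h5
  have h7 : (q : ℤ) ∣ 1 := ⟨m, by rw [← h6]; ring⟩
  have h8 : q ∣ 1 := by exact_mod_cast h7
  exact hq.one_lt.ne' (Nat.dvd_one.1 h8)

lemma K_core {X : Type*} [Group X] [Finite X] (Y : Subgroup X) (C : Finset X)
    (hC : ∀ c ∈ C, ∀ x, x * c * x⁻¹ ∈ C) (hC2 : ∀ c ∈ C, ∀ d ∈ C, IsConj c d)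
    (p n : ℕ) (hp : p.Prime) (hcard : C.card = p ^ n)
    (hgen : Subgroup.closure (C : Set X) = ⊤) (φ : Y →* integralClosure ℤ ℂ) (y : X) (hy : y ∈ Y)
    (hyX : y ∈ commutator X) (hφ : φ ⟨y, hy⟩ ≠ 1) (q : ℕ) (hq : q.Prime) (hqp : q ≠ p)
    (hφq : ∀ z, ∃ a : ℕ, φ z ^ q ^ a = 1) (c : X) (hc : c ∈ C) (hcY : c ∈ Y) : False := by
  classical
  haveI : Fintype (X ⧸ Y) := Fintype.ofFinite _
  haveI : Fact q.Prime := ⟨hq⟩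
  obtain ⟨M, hM, hqM⟩ := exists_max_ideal_of_mem_nonunits
    (show ((q : ℕ) : integralClosure ℤ ℂ) ∈ nonunits _ from prime_not_unit_integralClosure q hq)
  letI : Field (integralClosure ℤ ℂ ⧸ M) := Ideal.Quotient.field M
  let π := Ideal.Quotient.mk M
  have hπq : ((q : ℕ) : integralClosure ℤ ℂ ⧸ M) = 0 := by
    rw [← map_natCast π]
    exact Ideal.Quotient.eq_zero_iff_mem.2 hqM
  haveI : CharP (integralClosure ℤ ℂ ⧸ M) q := (CharP.charP_iff_prime_eq_zero hq).2 hπq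
  have hpn : ((p : integralClosure ℤ ℂ ⧸ M)) ^ n ≠ 0 := by
    apply pow_ne_zero
    rw [Ne, CharP.cast_eq_zero_iff (integralClosure ℤ ℂ ⧸ M) q]
    intro h
    exact hqp ((Nat.prime_dvd_prime_iff_eq hq hp).1 h)
  have hcomp : ((π : integralClosure ℤ ℂ →* (integralClosure ℤ ℂ ⧸ M)).comp φ) =
      ((π : integralClosure ℤ ℂ →* (integralClosure ℤ ℂ ⧸ M)).comp (1 : Y →* integralClosure ℤ ℂ)) := by
    ext z
    obtain ⟨a, ha⟩ := hφq z
    have h1 : (π (φ z) - 1) ^ q ^ a = 0 := by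
      rw [sub_pow_char_pow, ← map_pow, ha]; simp
    have h2 := sub_eq_zero.1 (eq_zero_of_pow_eq_zero h1)
    simpa using h2
  have hred : ∀ ψ : Y →* integralClosure ℤ ℂ, (∑ d ∈ C, monoM Y ψ d).charpoly.map π =
      (∑ d ∈ C, monoM Y ((π : integralClosure ℤ ℂ →* (integralClosure ℤ ℂ ⧸ M)).comp ψ) d).charpoly := by
    intro ψ
    rw [← Matrix.charpoly_map]
    congr 1
    have := map_sum (RingHom.mapMatrix (m := X ⧸ Y) π) (fun d => monoM Y ψ d) C
    simp only [RingHom.mapMatrix_apply] at this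
    rw [this]
    exact Finset.sum_congr rfl (fun d _ => monoM_map Y π ψ d)
  let ι := algebraMap (integralClosure ℤ ℂ) ℂ
  have hemb : ∀ ψ : Y →* integralClosure ℤ ℂ, (∑ d ∈ C, monoM Y ψ d).charpoly.map ι =
      (∑ d ∈ C, monoM Y ((ι : integralClosure ℤ ℂ →* ℂ).comp ψ) d).charpoly := by
    intro ψ
    rw [← Matrix.charpoly_map]
    congr 1
    have := map_sum (RingHom.mapMatrix (m := X ⧸ Y) ι) (fun d => monoM Y ψ d) C
    simp only [RingHom.mapMatrix_apply] at this
    rw [this]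
    exact Finset.sum_congr rfl (fun d _ => monoM_map Y ι ψ d)
  have heq : (∑ d ∈ C, monoM Y φ d).charpoly.map π =
      (∑ d ∈ C, monoM Y (1 : Y →* integralClosure ℤ ℂ) d).charpoly.map π := by
    rw [hred, hred, hcomp]
  obtain ⟨F, hF1, hF2, hF3⟩ := roots_count π (∑ d ∈ C, monoM Y φ d).charpoly
    (Matrix.charpoly_monic _) (p ^ n)
  obtain ⟨G, hG1, hG2, hG3⟩ := roots_count π
    (∑ d ∈ C, monoM Y (1 : Y →* integralClosure ℤ ℂ) d).charpoly
    (Matrix.charpoly_monic _) (p ^ n)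
  have hne : ∀ r : integralClosure ℤ ℂ, π r = p ^ n → (r : ℂ) ≠ 0 := by
    intro r hr h0
    have : r = 0 := Subtype.ext h0
    rw [this, map_zero] at hr
    exact hpn hr.symm
  have hd1 : p ∣ ((∑ d ∈ C, monoM Y φ d).charpoly.map π).rootMultiplicity
      ((p : integralClosure ℤ ℂ ⧸ M) ^ n) := by
    rw [hF3]
    refine Finset.dvd_sum (fun r hr => ?_)
    change p ∣ Polynomial.rootMultiplicity (r : ℂ) (Polynomial.map ι _)
    rw [hemb]
    refine mono_nontriv Y C hC hC2 p n hp hcard hgen _ y hy hyX ?_ _ (hne r (hF1 r hr))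
    intro h
    apply hφ
    exact Subtype.ext h
  have hone : ((ι : integralClosure ℤ ℂ →* ℂ).comp (1 : Y →* integralClosure ℤ ℂ)) = 1 := by
    ext z; simp
  have hrm : ∀ r : integralClosure ℤ ℂ, (r : ℂ) ≠ 0 → ∃ k,
      ((∑ d ∈ C, monoM Y (1 : Y →* integralClosure ℤ ℂ) d).charpoly.map ι).rootMultiplicity (r : ℂ)
      = (if (r : ℂ) = (p : ℂ) ^ n then 1 else 0) + p * k := by
    intro r hr
    rw [hemb, hone]
    exact mono_triv Y C hC hC2 p n hp hcard hgen c hc hcY _ hr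
  have hpG : (p : integralClosure ℤ ℂ) ^ n ∈ G := by
    by_contra h
    have h1 := hG2 ((p : integralClosure ℤ ℂ) ^ n) (by simp) h
    obtain ⟨k, hk⟩ := hrm ((p : integralClosure ℤ ℂ) ^ n) (hne _ (by simp))
    change Polynomial.rootMultiplicity _ (Polynomial.map ι _) = 0 at h1
    rw [h1, if_pos (by push_cast; rfl)] at hk
    omega
  rw [heq, hG3, ← Finset.add_sum_erase _ _ hpG] at hd1
  have hd2 : p ∣ ∑ x ∈ G.erase ((p : integralClosure ℤ ℂ) ^ n), Polynomial.rootMultiplicity (x : ℂ)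
      (Polynomial.map ι (∑ d ∈ C, monoM Y (1 : Y →* integralClosure ℤ ℂ) d).charpoly) := by
    refine Finset.dvd_sum (fun r hr => ?_)
    obtain ⟨k, hk⟩ := hrm r (hne r (hG1 r (Finset.mem_of_mem_erase hr)))
    rw [hk, if_neg]
    · simp
    · intro h
      apply Finset.ne_of_mem_erase hr
      apply Subtype.ext
      rw [h]; push_cast; rfl
  have hd3 := (Nat.dvd_add_left hd2).1 hd1
  obtain ⟨k, hk⟩ := hrm ((p : integralClosure ℤ ℂ) ^ n) (hne _ (by simp))
  change p ∣ Polynomial.rootMultiplicity _ (Polynomial.map ι _) at hd3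
  rw [hk, if_pos (by push_cast; rfl)] at hd3
  have hd4 := (Nat.dvd_add_left (Dvd.intro k rfl)).1 hd3
  exact hp.one_lt.ne' (Nat.dvd_one.1 hd4)

theorem commutator_isPGroup {X : Type*} [Group X] [Finite X] (C : Finset X)
    (hC : ∀ c ∈ C, ∀ x, x * c * x⁻¹ ∈ C) (hC2 : ∀ c ∈ C, ∀ d ∈ C, IsConj c d)
    (p n : ℕ) (hp : p.Prime) (hcard : C.card = p ^ n)
    (hgen : Subgroup.closure (C : Set X) = ⊤) : IsPGroup p (commutator X) := by
  classical
  refine IsPGroup.of_card (n := (Nat.card (commutator X)).primeFactorsList.length) ?_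
  refine Nat.eq_prime_pow_of_unique_prime_dvd Nat.card_pos.ne' ?_
  intro q hq hqd
  by_contra hqp
  haveI : Fact q.Prime := ⟨hq⟩
  obtain ⟨y', hy'⟩ := exists_prime_orderOf_dvd_card' q hqd
  obtain ⟨y, hyX⟩ := y'
  have hyo : orderOf y = q := by rw [← hy']; exact (Subgroup.orderOf_mk y hyX).symm
  have hqgrp : IsPGroup q (Subgroup.zpowers y) := by
    refine IsPGroup.of_card (n := 1) ?_
    rw [Nat.card_zpowers, hyo, pow_one]
  -- the conjugation action on C
  letI act : MulAction (Subgroup.zpowers y) C :=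
    { smul := fun g c => ⟨(g : X) * c * (g : X)⁻¹, hC c c.2 g⟩
      one_smul := fun c => Subtype.ext (by
        change ((1 : Subgroup.zpowers y) : X) * c * ((1 : Subgroup.zpowers y) : X)⁻¹ = c
        simp)
      mul_smul := fun g h c => Subtype.ext (by
        change ((g * h : Subgroup.zpowers y) : X) * c * ((g * h : Subgroup.zpowers y) : X)⁻¹ =
          (g : X) * ((h : X) * c * (h : X)⁻¹) * (g : X)⁻¹
        push_cast; group) }
  have hfix := hqgrp.nonempty_fixed_point_of_prime_not_dvd_card C (by
    rw [Nat.card_eq_fintype_card, Fintype.card_coe, hcard]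
    intro h
    exact hqp ((Nat.prime_dvd_prime_iff_eq hq hp).1 (hq.dvd_of_dvd_pow h)))
  obtain ⟨⟨c, hc⟩, hfix⟩ := hfix
  have hyc : y * c = c * y := by
    have h1 := congrArg Subtype.val (hfix ⟨y, Subgroup.mem_zpowers y⟩)
    have h2 : y * c * y⁻¹ = c := h1
    exact mul_inv_eq_iff_eq_mul.1 h2
  let Y := Subgroup.closure ({y, c} : Set X)
  have hcommset : ∀ a ∈ ({y, c} : Set X), ∀ b ∈ ({y, c} : Set X), a * b = b * a := by
    intro a ha b hb
    simp only [Set.mem_insert_iff, Set.mem_singleton_iff] at ha hb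
    rcases ha with rfl | rfl <;> rcases hb with rfl | rfl <;> simp [hyc]
  letI : CommGroup Y :=
    { (inferInstance : Group Y) with
      mul_comm := (Subgroup.isMulCommutative_closure hcommset).is_comm.comm }
  have hy : y ∈ Y := Subgroup.subset_closure (by simp)
  have hcY : c ∈ Y := Subgroup.subset_closure (by simp)
  have hy1 : (⟨y, hy⟩ : Y) ≠ 1 := by
    intro h
    have : y = 1 := congrArg Subtype.val h
    rw [this, orderOf_one] at hyo
    exact hq.one_lt.ne hyo
  haveI : NeZero (Monoid.exponent Y : ℂ) := ⟨by
    exact_mod_cast (Monoid.exponent_ne_zero_of_finite (G := Y))⟩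
  obtain ⟨φ0, hφ0⟩ := CommGroup.exists_apply_ne_one_of_hasEnoughRootsOfUnity Y ℂ hy1
  obtain ⟨a, N, hN, hYc⟩ := Nat.exists_eq_pow_mul_and_not_dvd
    (Nat.card_pos (α := Y)).ne' q hq.one_lt.ne'
  have hpw : ∀ z : Y, ((φ0 z : ℂ) ^ N) ^ q ^ a = 1 := by
    intro z
    rw [← pow_mul, mul_comm N, ← hYc, ← Units.val_pow_eq_pow_val, ← map_pow, pow_card_eq_one']
    simp
  let φ : Y →* integralClosure ℤ ℂ :=
    { toFun := fun z => ⟨(φ0 z : ℂ) ^ N, IsIntegral.of_pow (pow_pos hq.pos a) (by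
        rw [hpw z]; exact isIntegral_one)⟩
      map_one' := by apply Subtype.ext; simp
      map_mul' := fun z w => by apply Subtype.ext; simp [mul_pow] }
  refine K_core Y C hC hC2 p n hp hcard hgen φ y hy hyX ?_ q hq hqp ?_ c hc hcY
  · intro h
    have h1 : (φ0 ⟨y, hy⟩ : ℂ) ^ N = 1 := congrArg Subtype.val h
    have h2 : (φ0 ⟨y, hy⟩) ^ N = 1 := by
      apply Units.ext; rw [Units.val_pow_eq_pow_val, h1, Units.val_one]
    have h3 : (φ0 ⟨y, hy⟩) ^ q = 1 := by
      rw [← map_pow]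
      have : (⟨y, hy⟩ : Y) ^ q = 1 := by
        apply Subtype.ext
        change y ^ q = 1
        rw [← hyo, pow_orderOf_eq_one]
      rw [this, map_one]
    apply hφ0
    have h4 := Nat.dvd_gcd (orderOf_dvd_of_pow_eq_one h2) (orderOf_dvd_of_pow_eq_one h3)
    rw [(Nat.coprime_comm.1 ((Nat.Prime.coprime_iff_not_dvd hq).2 hN)), Nat.dvd_one] at h4
    exact orderOf_eq_one_iff.1 h4
  · intro z
    exact ⟨a, Subtype.ext (hpw z)⟩

section QuandleBasics
variable {Q : Type*} [Quandle Q]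

lemma QL_apply (a b : Q) : QL a b = a ◃ b := rfl

/-- the inner automorphism group -/
def InnQ (Q : Type*) [Quandle Q] : Subgroup (Equiv.Perm Q) :=
  Subgroup.closure (Set.range (QL : Q → Equiv.Perm Q))

lemma QL_mem_InnQ (a : Q) : QL a ∈ InnQ Q := Subgroup.subset_closure ⟨a, rfl⟩

lemma Dis_le_InnQ : Dis Q ≤ InnQ Q := by
  rw [Dis, Subgroup.closure_le]
  rintro g ⟨a, b, rfl⟩
  exact (InnQ Q).mul_mem (QL_mem_InnQ a) ((InnQ Q).inv_mem (QL_mem_InnQ b))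

lemma InnQ_conj {g : Equiv.Perm Q} (hg : g ∈ InnQ Q) : ∀ x : Q, g * QL x * g⁻¹ = QL (g x) := by
  unfold InnQ at hg
  induction hg using Subgroup.closure_induction with
  | mem g hg =>
    obtain ⟨a, rfl⟩ := hg
    intro x
    rw [mul_inv_eq_iff_eq_mul]
    ext y
    simp only [Equiv.Perm.mul_apply, QL_apply]
    exact Shelf.self_distrib
  | one => intro x; simp
  | mul g h _ _ ihg ihh =>
    intro x
    rw [Equiv.Perm.mul_apply, ← ihg, ← ihh]; group
  | inv g _ ih =>
    intro x
    have := ih (g⁻¹ x)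
    have h0 : g (g⁻¹ x) = x := g.apply_symm_apply x
    rw [h0] at this
    rw [← this]; group

lemma InnQ_map {g : Equiv.Perm Q} (hg : g ∈ InnQ Q) (x y : Q) : g (x ◃ y) = g x ◃ g y := by
  have h := InnQ_conj hg x
  rw [mul_inv_eq_iff_eq_mul] at h
  exact DFunLike.congr_fun h y

lemma Dis_gen (a b : Q) : QL a * (QL b)⁻¹ ∈ Dis Q := Subgroup.subset_closure ⟨a, b, rfl⟩

lemma Dis_conj {g h : Equiv.Perm Q} (hg : g ∈ InnQ Q) (hh : h ∈ Dis Q) : g * h * g⁻¹ ∈ Dis Q := by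
  unfold Dis at hh
  induction hh using Subgroup.closure_induction with
  | mem h hh =>
    obtain ⟨a, b, rfl⟩ := hh
    have : g * (QL a * (QL b)⁻¹) * g⁻¹ = QL (g a) * (QL (g b))⁻¹ := by
      rw [← InnQ_conj hg, ← InnQ_conj hg]; group
    rw [this]; exact Dis_gen _ _
  | one => simp
  | mul a b _ _ ha hb =>
    have : g * (a * b) * g⁻¹ = (g * a * g⁻¹) * (g * b * g⁻¹) := by group
    rw [this]; exact (Dis Q).mul_mem ha hb
  | inv a _ ha =>
    have : g * a⁻¹ * g⁻¹ = (g * a * g⁻¹)⁻¹ := by group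
    rw [this]; exact (Dis Q).inv_mem ha

/-- latin -/
def Latin (Q : Type*) [Quandle Q] : Prop := ∀ a : Q, Function.Bijective (fun b : Q => b ◃ a)

/-- the displacement group of a latin quandle is transitive -/
lemma Dis_trans (hL : Latin Q) (x y : Q) : ∃ g ∈ Dis Q, g x = y := by
  obtain ⟨b, hb⟩ := (hL x).2 y
  refine ⟨QL b * (QL x)⁻¹, Dis_gen _ _, ?_⟩
  have : (QL x)⁻¹ x = x := by
    rw [Equiv.Perm.inv_eq_iff_eq, QL_apply, Quandle.fix]
  rw [Equiv.Perm.mul_apply, this]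
  exact hb

lemma QL_inj (hL : Latin Q) : Function.Injective (QL : Q → Equiv.Perm Q) := by
  intro a b h
  exact (hL a).1 (DFunLike.congr_fun h a)

theorem Dis_isPGroup [Finite Q] (hL : Latin Q) (p n : ℕ) (hp : p.Prime)
    (hcard : Nat.card Q = p ^ n) : IsPGroup p (Dis Q) := by
  classical
  haveI : Fintype Q := Fintype.ofFinite Q
  let ql : Q → InnQ Q := fun a => ⟨QL a, QL_mem_InnQ a⟩
  have hql : Function.Injective ql := fun a b h => QL_inj hL (congrArg Subtype.val h)
  have hconj : ∀ (x : InnQ Q) (a : Q), x * ql a * x⁻¹ = ql ((x : Equiv.Perm Q) a) :=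
    fun x a => Subtype.ext (InnQ_conj x.2 a)
  have key := commutator_isPGroup (X := InnQ Q) (Finset.univ.image ql) (by
      intro c hc x
      obtain ⟨a, _, rfl⟩ := Finset.mem_image.1 hc
      rw [hconj]
      exact Finset.mem_image_of_mem _ (Finset.mem_univ _)) (by
      intro c hc d hd
      obtain ⟨a, _, rfl⟩ := Finset.mem_image.1 hc
      obtain ⟨b, _, rfl⟩ := Finset.mem_image.1 hd
      obtain ⟨g, hg, hgab⟩ := Dis_trans hL a b
      rw [isConj_iff]
      exact ⟨⟨g, Dis_le_InnQ hg⟩, by rw [hconj]; congr 1⟩)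
    p n hp (by
      rw [Finset.card_image_of_injective _ hql, Finset.card_univ, ← Nat.card_eq_fintype_card, hcard])
    (by
      rw [Finset.coe_image, Finset.coe_univ, Set.image_univ]
      rw [eq_top_iff]
      rintro ⟨g, hg⟩ -
      have h1 : Set.range (QL : Q → Equiv.Perm Q) = (InnQ Q).subtype '' Set.range ql := by
        rw [← Set.range_comp]; rfl
      have h2 : g ∈ (Subgroup.closure (Set.range ql)).map (InnQ Q).subtype := by
        rw [MonoidHom.map_closure, ← h1]; exact hg
      obtain ⟨g', hg', he⟩ := h2
      have : g' = ⟨g, hg⟩ := Subtype.ext he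
      rw [← this]; exact hg')
  have key2 := key.map (InnQ Q).subtype
  refine key2.to_le ?_
  rw [Dis, Subgroup.closure_le]
  rintro g ⟨a, b, rfl⟩
  obtain ⟨h, hh, hab⟩ := Dis_trans hL b a
  refine ⟨ql a * (ql b)⁻¹, ?_, rfl⟩
  have : ql a = (⟨h, Dis_le_InnQ hh⟩ : InnQ Q) * ql b * (⟨h, Dis_le_InnQ hh⟩ : InnQ Q)⁻¹ := by
    rw [hconj]; congr 1; exact hab.symm
  rw [this]
  exact Subgroup.commutator_mem_commutator (Subgroup.mem_top _) (Subgroup.mem_top _)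

end QuandleBasics

open scoped commutatorElement

lemma cyc_ab {G : Type*} [Group G] [Group.IsNilpotent G] [IsCyclic (G ⧸ commutator G)] :
    commutator G = ⊥ := by
  have h12 : commutator G ≤ ⁅commutator G, (⊤ : Subgroup G)⁆ := by
    let K : Subgroup G := ⁅commutator G, (⊤ : Subgroup G)⁆
    have hKle : K ≤ commutator G := Subgroup.commutator_le_left _ _
    let f : G ⧸ K →* G ⧸ commutator G := QuotientGroup.map K (commutator G) (MonoidHom.id G) hKle
    have hf : f.ker ≤ Subgroup.center (G ⧸ K) := by
      intro x hx
      obtain ⟨x, rfl⟩ := QuotientGroup.mk_surjective x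
      have hx : x ∈ commutator G := (QuotientGroup.eq_one_iff x).1 hx
      rw [Subgroup.mem_center_iff]
      intro y
      obtain ⟨y, rfl⟩ := QuotientGroup.mk_surjective y
      rw [← QuotientGroup.mk_mul, ← QuotientGroup.mk_mul, eq_comm, QuotientGroup.eq]
      have : (x * y)⁻¹ * (y * x) = ⁅y⁻¹, x⁻¹⁆ := by rw [commutatorElement_def]; group
      rw [this, ← inv_mem_iff, commutatorElement_inv]
      exact Subgroup.commutator_mem_commutator (inv_mem hx) (Subgroup.mem_top _)
    have hcomm := (MonoidHom.isMulCommutative_of_isCyclic_of_ker_le_center f hf).is_comm.comm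
    rw [commutator_def, Subgroup.commutator_le]
    intro x _ y _
    have h1 := hcomm (x : G ⧸ K) (y : G ⧸ K)
    change ⁅x, y⁆ ∈ K
    rw [← QuotientGroup.eq_one_iff]
    change ((x * y * x⁻¹ * y⁻¹ : G) : G ⧸ K) = 1
    rw [QuotientGroup.mk_mul, QuotientGroup.mk_mul, QuotientGroup.mk_mul, h1,
      QuotientGroup.mk_inv, QuotientGroup.mk_inv]
    group
  have hall : ∀ n, commutator G ≤ Subgroup.lowerCentralSeries (⊤ : Subgroup G) n := by
    intro n
    induction n with
    | zero => exact le_top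
    | succ n ih =>
      rw [Subgroup.lowerCentralSeries_succ]
      exact h12.trans (Subgroup.commutator_mono ih le_rfl)
  obtain ⟨n, hn⟩ := Subgroup.nilpotent_iff_lowerCentralSeries.1 (inferInstance : Group.IsNilpotent G)
  rw [eq_bot_iff, ← hn]
  exact hall n

lemma class_two {H : Type*} [Group H] (hc : commutator H ≤ Subgroup.center H) (a b : H)
    (h : Subgroup.closure {a, b} ⊔ commutator H = ⊤) :
    commutator H ≤ Subgroup.zpowers ⁅a, b⁆ := by
  let E := Subgroup.zpowers ⁅a, b⁆
  have hEc : E ≤ Subgroup.center H := by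
    rw [Subgroup.zpowers_le]
    exact hc (Subgroup.commutator_mem_commutator (Subgroup.mem_top a) (Subgroup.mem_top b))
  have hEn : E.Normal := ⟨fun x hx g => by
    rw [Subgroup.mem_center_iff.1 (hEc hx) g, mul_inv_cancel_right]; exact hx⟩
  -- the set of elements commuting with x modulo E
  have key : ∀ x : H, ⁅x, a⁆ ∈ E → ⁅x, b⁆ ∈ E → ∀ y, ⁅x, y⁆ ∈ E := by
    intro x hxa hxb y
    let Cx : Subgroup H := (Subgroup.centralizer {(x : H ⧸ E)}).comap (QuotientGroup.mk' E)
    have hmem : ∀ y, y ∈ Cx ↔ ⁅x, y⁆ ∈ E := by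
      intro y
      rw [Subgroup.mem_comap, Subgroup.mem_centralizer_singleton_iff, ← QuotientGroup.eq_one_iff,
        QuotientGroup.mk'_apply]
      have : ((⁅x, y⁆ : H) : H ⧸ E) = ⁅(x : H ⧸ E), (y : H ⧸ E)⁆ := rfl
      rw [this, commutatorElement_eq_one_iff_mul_comm, eq_comm]
    rw [← hmem]
    have : Cx = ⊤ := by
      rw [eq_top_iff, ← h, sup_le_iff, Subgroup.closure_le]
      constructor
      · rintro z (rfl | rfl)
        · exact (hmem _).2 hxa
        · exact (hmem _).2 hxb
      · intro z hz
        rw [hmem]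
        have : ⁅x, z⁆ = 1 := by
          rw [commutatorElement_eq_one_iff_mul_comm]
          exact (Subgroup.mem_center_iff.1 (hc hz) x)
        rw [this]; exact E.one_mem
    rw [this]; trivial
  have hinv : ∀ x y : H, ⁅x, y⁆ ∈ E → ⁅y, x⁆ ∈ E := by
    intro x y hxy
    rw [← commutatorElement_inv]; exact E.inv_mem hxy
  have hab : ⁅a, b⁆ ∈ E := Subgroup.mem_zpowers _
  have ha := key a (by rw [commutatorElement_self]; exact E.one_mem) hab
  have hb := key b (hinv _ _ hab) (by rw [commutatorElement_self]; exact E.one_mem)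
  rw [commutator_def, Subgroup.commutator_le]
  intro x _ y _
  exact key x (hinv _ _ (ha x)) (hinv _ _ (hb x)) y

lemma two_gen {G : Type*} [Group G] [Finite G] (p : ℕ) (hp : p.Prime) (K : Subgroup G)
    (hK : K.index = p ^ 2) : ∃ a b : G, Subgroup.closure {a, b} ⊔ K = ⊤ := by
  have step : ∀ K : Subgroup G, K ≠ ⊤ → ∃ a : G, (K ⊔ Subgroup.zpowers a).index ∣ K.index ∧
      (K ⊔ Subgroup.zpowers a).index < K.index := by
    intro K hK
    obtain ⟨a, ha⟩ : ∃ a, a ∉ K := by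
      by_contra hcon
      push Not at hcon
      exact hK (eq_top_iff.2 (fun x _ => hcon x))
    refine ⟨a, Subgroup.index_dvd_of_le le_sup_left, ?_⟩
    have h1 := Subgroup.relIndex_mul_index (le_sup_left : K ≤ K ⊔ Subgroup.zpowers a)
    have h2 : K.relIndex (K ⊔ Subgroup.zpowers a) ≠ 1 := by
      rw [Ne, Subgroup.relIndex_eq_one]
      intro hle
      exact ha (hle (Subgroup.mem_sup_right (Subgroup.mem_zpowers a)))
    have h3 : 0 < (K ⊔ Subgroup.zpowers a).index := Nat.pos_of_ne_zero Subgroup.FiniteIndex.index_ne_zero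
    have h4 : 0 < K.index := Nat.pos_of_ne_zero Subgroup.FiniteIndex.index_ne_zero
    have h5 : K.relIndex (K ⊔ Subgroup.zpowers a) ≠ 0 := by
      intro h0; rw [h0] at h1; omega
    have h6 : 2 ≤ K.relIndex (K ⊔ Subgroup.zpowers a) := by omega
    nlinarith
  have hKt : K ≠ ⊤ := by
    rintro rfl
    rw [Subgroup.index_top] at hK
    have := Nat.one_lt_pow (n := 2) two_ne_zero hp.one_lt
    omega
  obtain ⟨a, ha1, ha2⟩ := step K hKt
  by_cases h1 : K ⊔ Subgroup.zpowers a = ⊤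
  · refine ⟨a, a, ?_⟩
    rw [eq_top_iff, ← h1, sup_le_iff]
    refine ⟨le_sup_right, le_trans ?_ le_sup_left⟩
    rw [Subgroup.zpowers_le]
    exact Subgroup.subset_closure (by simp)
  · obtain ⟨b, hb1, hb2⟩ := step _ h1
    refine ⟨a, b, ?_⟩
    have hle : K ⊔ Subgroup.zpowers a ⊔ Subgroup.zpowers b ≤ Subgroup.closure {a, b} ⊔ K := by
      refine sup_le (sup_le le_sup_right (le_trans ?_ le_sup_left)) (le_trans ?_ le_sup_left)
      · rw [Subgroup.zpowers_le]
        exact Subgroup.subset_closure (by simp)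
      · rw [Subgroup.zpowers_le]
        exact Subgroup.subset_closure (by simp)
    rw [eq_top_iff]
    refine le_trans ?_ hle
    rw [← eq_top_iff, ← Subgroup.index_eq_one]
    rw [hK] at ha1 ha2
    obtain ⟨i, hi, hi2⟩ := (Nat.dvd_prime_pow hp).1 ha1
    obtain ⟨j, hj, hj2⟩ := (Nat.dvd_prime_pow hp).1 (hi2 ▸ hb1)
    rw [hi2] at ha2 hb2
    rw [hj2] at hb2 ⊢
    have h3 := (Nat.pow_lt_pow_iff_right hp.one_lt).1 ha2
    have h4 := (Nat.pow_lt_pow_iff_right hp.one_lt).1 hb2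
    have : j = 0 := by omega
    rw [this, pow_zero]

lemma normal_of_le_center' {G : Type*} [Group G] {E : Subgroup G} (hEc : E ≤ Subgroup.center G) :
    E.Normal := ⟨fun x hx g => by
    rw [Subgroup.mem_center_iff.1 (hEc hx) g, mul_inv_cancel_right]; exact hx⟩

lemma center_inf_ne_bot {G : Type*} [Group G] [Finite G] (p : ℕ) (hp : p.Prime)
    (hG : IsPGroup p G) (K : Subgroup G) [K.Normal] (hK : K ≠ ⊥) :
    Subgroup.center G ⊓ K ≠ ⊥ := by
  haveI : Fact p.Prime := ⟨hp⟩
  have hdvd : p ∣ Nat.card K := by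
    obtain ⟨k, hk⟩ := IsPGroup.iff_card.1 (hG.to_subgroup K)
    rw [hk]
    refine dvd_pow_self p ?_
    rintro rfl
    exact hK (Subgroup.card_eq_one.1 (by rw [hk, pow_zero]))
  obtain ⟨b, hb, hne⟩ := (hG.of_equiv
    ConjAct.toConjAct).exists_fixed_point_of_prime_dvd_card_of_fixed_point K hdvd
    (a := 1) (by intro g; simp)
  intro h
  apply hne
  have hb1 : (b : G) ∈ Subgroup.center G ⊓ K := by
    refine Subgroup.mem_inf.2 ⟨?_, b.2⟩
    rw [Subgroup.mem_center_iff]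
    intro g
    have := congrArg Subtype.val (hb (ConjAct.toConjAct g))
    rw [ConjAct.Subgroup.val_conj_smul, ConjAct.smul_def, ConjAct.ofConjAct_toConjAct] at this
    exact mul_inv_eq_iff_eq_mul.1 this
  rw [h, Subgroup.mem_bot] at hb1
  exact (Subtype.ext hb1).symm

section GrpSmall
variable {G : Type*} [Group G] [Finite G] (f : G ≃* G) (F : Subgroup G)

lemma fix_le_commutator
    (hF : ∀ g, g ∈ F ↔ f g = g)
    (hgen : Subgroup.closure {x | ∃ g : G, x = g * (f g)⁻¹} = ⊤) :
    F ≤ commutator G := by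
  let ψ : Abelianization G →* Abelianization G :=
    { toFun := fun a => a * (Abelianization.map f.toMonoidHom a)⁻¹
      map_one' := by simp
      map_mul' := fun a b => by rw [map_mul, mul_inv]; exact mul_mul_mul_comm _ _ _ _ }
  have hsurj : Function.Surjective ψ := by
    rw [← MonoidHom.range_eq_top]
    have h1 : (ψ.range.comap Abelianization.of) = ⊤ := by
      rw [eq_top_iff, ← hgen, Subgroup.closure_le]
      rintro x ⟨g, rfl⟩
      exact ⟨Abelianization.of g, by
        change Abelianization.of g * (Abelianization.map f.toMonoidHom (Abelianization.of g))⁻¹ = _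
        rw [Abelianization.map_of, map_mul, map_inv]; rfl⟩
    rw [eq_top_iff]
    intro a _
    obtain ⟨g, rfl⟩ := QuotientGroup.mk_surjective a
    have : g ∈ (ψ.range.comap Abelianization.of) := by rw [h1]; trivial
    exact this
  have hinj : Function.Injective ψ := Finite.injective_iff_surjective.2 hsurj
  intro g hg
  have h2 : ψ (Abelianization.of g) = 1 := by
    change Abelianization.of g * (Abelianization.map f.toMonoidHom (Abelianization.of g))⁻¹ = _
    rw [Abelianization.map_of]
    change Abelianization.of g * (Abelianization.of (f g))⁻¹ = 1
    rw [(hF g).1 hg, mul_inv_cancel]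
  have h3 := hinj (h2.trans (map_one ψ).symm)
  exact (QuotientGroup.eq_one_iff g).1 h3

theorem grp_small
    (hF : ∀ g, g ∈ F ↔ f g = g)
    (hgen : Subgroup.closure {x | ∃ g : G, x = g * (f g)⁻¹} = ⊤)
    (p m : ℕ) (hp : p.Prime) (hG : IsPGroup p G)
    (hidx : F.index = p ^ m) (hcore : ∀ N : Subgroup G, N.Normal → N ≤ F → N = ⊥) :
    (m ≤ 2 → Nat.card G = p ^ m) ∧ (m = 3 → Nat.card G ≤ p ^ 4) := by
  haveI : Fact p.Prime := ⟨hp⟩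
  haveI : Group.IsNilpotent G := hG.isNilpotent
  have hFle := fix_le_commutator f F hF hgen
  have hab : commutator G = ⊥ → Nat.card G = p ^ m := by
    intro h
    rw [h, le_bot_iff] at hFle
    rw [← hidx, hFle, Subgroup.index_bot]
  have hmul := Subgroup.relIndex_mul_index hFle
  rw [hidx] at hmul
  obtain ⟨i, hi, hi2⟩ := (Nat.dvd_prime_pow hp).1 (Dvd.intro_left _ hmul)
  obtain ⟨j, hj, hj2⟩ := (Nat.dvd_prime_pow hp).1 (Dvd.intro _ hmul)
  have hij : j + i = m := by
    rw [hi2, hj2, ← pow_add] at hmul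
    exact Nat.pow_right_injective hp.two_le hmul
  have hi1 : i ≤ 1 → commutator G = ⊥ := by
    intro hi1
    haveI : IsCyclic (G ⧸ commutator G) := by
      apply isCyclic_of_card_dvd_prime (p := p)
      rw [← Subgroup.index_eq_card, hi2]
      exact pow_dvd_pow p hi1 |>.trans (by rw [pow_one])
    exact cyc_ab
  have hj0 : j = 0 → commutator G = ⊥ := by
    rintro rfl
    rw [pow_zero, Subgroup.relIndex_eq_one] at hj2
    exact hcore _ inferInstance hj2
  refine ⟨fun hm => hab ?_, ?_⟩
  · by_cases h : i ≤ 1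
    · exact hi1 h
    · exact hj0 (by omega)
  · intro hm
    by_cases hb : commutator G = ⊥
    · rw [hab hb, hm]
      exact Nat.pow_le_pow_right hp.pos (by norm_num)
    have h1 : ¬ i ≤ 1 := fun h => hb (hi1 h)
    have h2 : ¬ j = 0 := fun h => hb (hj0 h)
    have hi : i = 2 := by omega
    have hj : j = 1 := by omega
    subst hi hj
    rw [pow_one] at hj2
    set N : Subgroup G := Subgroup.center G ⊓ commutator G with hN
    have hNb : N ≠ ⊥ := center_inf_ne_bot p hp hG _ hb
    have hNc : N ≤ Subgroup.center G := inf_le_left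
    have hNG : N ≤ commutator G := inf_le_right
    haveI hNn : N.Normal := normal_of_le_center' hNc
    have hFN : F ⊓ N = ⊥ :=
      hcore _ (normal_of_le_center' (inf_le_right.trans hNc)) inf_le_left
    have hrel : F.relIndex N = Nat.card N := by
      rw [← Subgroup.inf_relIndex_right, hFN, Subgroup.relIndex_bot_left]
    have hNle : Nat.card N ≤ p := by
      rw [← hrel, ← hj2]
      exact Subgroup.relIndex_le_of_le_right hNG (by rw [hj2]; exact hp.ne_zero)
    have hNp : Nat.card N = p := by
      obtain ⟨k, hk⟩ := IsPGroup.iff_card.1 (hG.to_subgroup N)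
      have hk0 : k ≠ 0 := by
        rintro rfl
        exact hNb (Subgroup.card_eq_one.1 (by rw [hk, pow_zero]))
      refine le_antisymm hNle ?_
      rw [hk]
      exact Nat.le_self_pow hk0 p
    have hsup : commutator G ≤ N ⊔ F := by
      have h3 : N ⊔ F ≤ commutator G := sup_le hNG hFle
      have h4 := Subgroup.relIndex_mul_relIndex F (N ⊔ F) (commutator G) le_sup_right h3
      rw [hj2] at h4
      have h5 : p ≤ F.relIndex (N ⊔ F) := by
        rw [← hNp, ← hrel]
        refine Subgroup.relIndex_le_of_le_right le_sup_left ?_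
        intro h0; rw [h0, zero_mul] at h4; exact hp.ne_zero h4.symm
      rw [← Subgroup.relIndex_eq_one]
      have hp0 := hp.pos
      rcases Nat.lt_trichotomy ((N ⊔ F).relIndex (commutator G)) 1 with h6 | h6 | h6
      · have : (N ⊔ F).relIndex (commutator G) = 0 := by omega
        rw [this] at h4; omega
      · exact h6
      · nlinarith
    have hdec : ∀ x ∈ commutator G, ∃ z ∈ N, ∃ h ∈ F, z * h = x := fun x hx =>
      Subgroup.mem_sup_of_normal_left.1 (hsup hx)
    have hzp : ∀ z ∈ N, z ^ p = 1 := by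
      intro z hz
      have : (⟨z, hz⟩ : N) ^ p = 1 := by rw [← hNp]; exact pow_card_eq_one'
      exact congrArg Subtype.val this
    have hpF : ∀ x ∈ commutator G, x ^ p ∈ F := by
      intro x hx
      obtain ⟨z, hz, h, hh, rfl⟩ := hdec x hx
      have hc : Commute z h := (Subgroup.mem_center_iff.1 (hNc hz) h).symm
      rw [hc.mul_pow, hzp z hz, one_mul]
      exact F.pow_mem hh p
    have hp1 : ∀ x ∈ commutator G, x ^ p = 1 := by
      intro x hx
      have h3 : Subgroup.normalClosure {x ^ p} = ⊥ := by
        apply hcore _ Subgroup.normalClosure_normal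
        rw [Subgroup.normalClosure, Subgroup.closure_le]
        intro y hy
        rw [Group.mem_conjugatesOfSet_iff] at hy
        obtain ⟨a, ha, hay⟩ := hy
        rw [Set.mem_singleton_iff] at ha
        subst ha
        obtain ⟨g, rfl⟩ := isConj_iff.1 hay
        rw [← conj_pow]
        exact hpF _ ((inferInstance : (commutator G).Normal).conj_mem x hx g)
      have h4 : x ^ p ∈ Subgroup.normalClosure {x ^ p} :=
        Subgroup.subset_normalClosure (Set.mem_singleton _)
      rw [h3] at h4
      exact h4
    let π := QuotientGroup.mk' N
    have hfG : ∀ x ∈ commutator G, f x ∈ commutator G := by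
      intro x hx
      have h3 : (commutator G).map f.toMonoidHom = commutator G := by
        rw [commutator_def, Subgroup.map_commutator, Subgroup.map_top_of_surjective _ f.surjective]
      rw [← h3]
      exact ⟨x, hx, rfl⟩
    have hfc : ∀ z ∈ Subgroup.center G, f z ∈ Subgroup.center G := by
      intro z hz
      rw [Subgroup.mem_center_iff] at hz ⊢
      intro g
      have := congrArg f (hz (f.symm g))
      simpa using this
    have hfN : ∀ z ∈ N, f z ∈ N := fun z hz => ⟨hfc z hz.1, hfG z hz.2⟩
    have hπ1 : ∀ z ∈ N, π z = 1 := fun z hz => (QuotientGroup.eq_one_iff z).2 hz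
    have hfπ : ∀ x ∈ commutator G, π (f x) = π x := by
      intro x hx
      obtain ⟨z, hz, h, hh, rfl⟩ := hdec x hx
      rw [map_mul, map_mul, map_mul, hπ1 _ (hfN z hz), hπ1 z hz, (hF h).1 hh]
    have hcent : ((Subgroup.centralizer (π '' (commutator G : Set G))).comap π) = ⊤ := by
      rw [eq_top_iff, ← hgen, Subgroup.closure_le]
      rintro y ⟨g, rfl⟩
      rw [SetLike.mem_coe, Subgroup.mem_comap, Subgroup.mem_centralizer_iff]
      rintro _ ⟨c, hc, rfl⟩
      have h3 : g⁻¹ * c * g ∈ commutator G := by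
        have := (inferInstance : (commutator G).Normal).conj_mem c hc g⁻¹
        rwa [inv_inv] at this
      have h4 := hfπ _ h3
      simp only [map_mul, map_inv] at h4
      rw [hfπ c hc] at h4
      rw [map_mul, map_inv]
      calc π c * (π g * (π (f g))⁻¹)
          = π g * ((π g)⁻¹ * π c * π g) * (π (f g))⁻¹ := by group
        _ = π g * ((π (f g))⁻¹ * π c * π (f g)) * (π (f g))⁻¹ := by rw [h4]
        _ = π g * (π (f g))⁻¹ * π c := by group
    have hπs : Function.Surjective π := QuotientGroup.mk'_surjective N
    have hmap : (commutator G).map π = commutator (G ⧸ N) := by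
      rw [commutator_def, Subgroup.map_commutator, Subgroup.map_top_of_surjective _ hπs]
      rfl
    have hc2 : commutator (G ⧸ N) ≤ Subgroup.center (G ⧸ N) := by
      rw [← hmap]
      rintro _ ⟨c, hc, rfl⟩
      rw [Subgroup.mem_center_iff]
      intro g
      obtain ⟨g, rfl⟩ := hπs g
      have hg : g ∈ ((Subgroup.centralizer (π '' (commutator G : Set G))).comap π) := by
        rw [hcent]; trivial
      rw [Subgroup.mem_comap, Subgroup.mem_centralizer_iff] at hg
      exact (hg _ ⟨c, hc, rfl⟩).symm
    obtain ⟨a, b, hab2⟩ := two_gen p hp (commutator G) hi2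
    have hcl := class_two hc2 (π a) (π b) (by
      have := congrArg (Subgroup.map π) hab2
      rw [Subgroup.map_sup, hmap, Subgroup.map_top_of_surjective _ hπs, MonoidHom.map_closure,
        Set.image_pair] at this
      exact this)
    have hcard1 : Nat.card (commutator (G ⧸ N)) ≤ p := by
      refine (Nat.card_le_card_of_injective _ (Subgroup.inclusion_injective hcl)).trans ?_
      rw [Nat.card_zpowers]
      refine Nat.le_of_dvd hp.pos (orderOf_dvd_of_pow_eq_one ?_)
      have h3 : ⁅π a, π b⁆ = π ⁅a, b⁆ := (map_commutatorElement π a b).symm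
      rw [h3, ← map_pow, hp1, map_one]
      exact Subgroup.commutator_mem_commutator (Subgroup.mem_top a) (Subgroup.mem_top b)
    have hcard2 : Nat.card (commutator G) = Nat.card N * Nat.card (commutator (G ⧸ N)) := by
      have h3 := Subgroup.relIndex_mul_relIndex ⊥ N (commutator G) bot_le hNG
      rw [Subgroup.relIndex_bot_left, Subgroup.relIndex_bot_left] at h3
      rw [← h3, ← hmap, ← Subgroup.relIndex_ker (commutator G) π, QuotientGroup.ker_mk']
    rw [← Subgroup.card_mul_index (commutator G), hi2, hcard2, hNp]
    calc p * Nat.card (commutator (G ⧸ N)) * p ^ 2 ≤ p * p * p ^ 2 := by gcongr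
      _ = p ^ 4 := by ring

end GrpSmall

section QuandleSmall
variable {Q : Type*} [Quandle Q]

/-- conjugation by a left multiplication -/
def conjF (e : Q) : Dis Q ≃* Dis Q where
  toFun g := ⟨QL e * g * (QL e)⁻¹, Dis_conj (QL_mem_InnQ e) g.2⟩
  invFun g := ⟨(QL e)⁻¹ * g * QL e, by
    have := Dis_conj ((InnQ Q).inv_mem (QL_mem_InnQ e)) g.2
    rwa [inv_inv] at this⟩
  left_inv g := Subtype.ext (by
    change (QL e)⁻¹ * (QL e * g * (QL e)⁻¹) * QL e = g
    group)
  right_inv g := Subtype.ext (by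
    change QL e * ((QL e)⁻¹ * g * QL e) * (QL e)⁻¹ = g
    group)
  map_mul' g h := Subtype.ext (by
    change QL e * (g * h : Equiv.Perm Q) * (QL e)⁻¹ =
      (QL e * (g : Equiv.Perm Q) * (QL e)⁻¹) * (QL e * (h : Equiv.Perm Q) * (QL e)⁻¹)
    group)

lemma conjF_coe (e : Q) (g : Dis Q) :
    ((conjF e g : Dis Q) : Equiv.Perm Q) = QL e * g * (QL e)⁻¹ := rfl

theorem Dis_small [Finite Q] (hL : Latin Q) (p n : ℕ) (hp : p.Prime)
    (hcard : Nat.card Q = p ^ n) :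
    (n ≤ 2 → Nat.card (Dis Q) = p ^ n) ∧ (n = 3 → Nat.card (Dis Q) ≤ p ^ 4) := by
  have hne : Nonempty Q := by
    have : 0 < Nat.card Q := by rw [hcard]; exact pow_pos hp.pos n
    exact (Nat.card_pos_iff.1 this).1
  obtain ⟨e⟩ := hne
  haveI : MulAction.IsPretransitive (Dis Q) Q := ⟨fun x y => by
    obtain ⟨g, hg, h⟩ := Dis_trans hL x y
    exact ⟨⟨g, hg⟩, h⟩⟩
  refine grp_small (conjF e) (MulAction.stabilizer (Dis Q) e) ?_ ?_ p n hp
    (Dis_isPGroup hL p n hp hcard) ?_ ?_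
  · intro g
    rw [MulAction.mem_stabilizer_iff]
    have h1 : g • e = (g : Equiv.Perm Q) e := rfl
    have h2 := InnQ_conj (Dis_le_InnQ g.2) e
    rw [h1]
    constructor
    · intro h
      rw [h, mul_inv_eq_iff_eq_mul] at h2
      apply Subtype.ext
      rw [conjF_coe, mul_inv_eq_iff_eq_mul, h2]
    · intro h
      have h3 := congrArg Subtype.val h
      rw [conjF_coe, mul_inv_eq_iff_eq_mul] at h3
      rw [← h3, mul_inv_cancel_right] at h2
      exact (QL_inj hL h2).symm
  · have hmem : ∀ a : Q, (⟨QL a * (QL e)⁻¹, Dis_gen a e⟩ : Dis Q) ∈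
        Subgroup.closure {x | ∃ g : Dis Q, x = g * (conjF e g)⁻¹} := by
      intro a
      obtain ⟨g, hg, h⟩ := Dis_trans hL e a
      refine Subgroup.subset_closure ⟨⟨g, hg⟩, ?_⟩
      apply Subtype.ext
      change QL a * (QL e)⁻¹ = g * (QL e * g * (QL e)⁻¹)⁻¹
      rw [← h, ← InnQ_conj (Dis_le_InnQ hg)]
      group
    rw [eq_top_iff]
    have h1 : Dis Q ≤ (Subgroup.closure {x | ∃ g : Dis Q, x = g * (conjF e g)⁻¹}).map
        (Dis Q).subtype := by
      conv_lhs => rw [Dis]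
      rw [Subgroup.closure_le]
      rintro _ ⟨a, b, rfl⟩
      refine ⟨⟨QL a * (QL e)⁻¹, Dis_gen a e⟩ * (⟨QL b * (QL e)⁻¹, Dis_gen b e⟩ : Dis Q)⁻¹,
        Subgroup.mul_mem _ (hmem a) (Subgroup.inv_mem _ (hmem b)), ?_⟩
      change QL a * (QL e)⁻¹ * (QL b * (QL e)⁻¹)⁻¹ = _
      group
    intro g _
    obtain ⟨g', hg', h⟩ := h1 g.2
    have : g' = g := Subtype.ext h
    rw [← this]; exact hg'
  · rw [MulAction.index_stabilizer_of_transitive, hcard]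
  · intro N hN hle
    rw [eq_bot_iff]
    intro x hx
    rw [Subgroup.mem_bot]
    apply Subtype.ext
    ext y
    obtain ⟨g, hg, h⟩ := Dis_trans hL e y
    have h1 := hle (hN.conj_mem x hx (⟨g, hg⟩ : Dis Q)⁻¹)
    rw [MulAction.mem_stabilizer_iff] at h1
    have h2 : g⁻¹ ((x : Equiv.Perm Q) (g e)) = e := by
      rw [inv_inv] at h1; exact h1
    rw [Equiv.Perm.inv_eq_iff_eq, h] at h2
    exact h2

lemma surj_of_inj_set {X : Type*} [Finite X] (S : Set X) (f : X → X) (hm : Set.MapsTo f S S)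
    (hf : Function.Injective f) : ∀ s ∈ S, ∃ b ∈ S, f b = s := by
  intro s hs
  have h : f '' S = S := Set.eq_of_subset_of_ncard_le hm.image_subset
    (by rw [Set.ncard_image_of_injective _ hf])
  rw [← h] at hs
  exact hs

/-- closed under the operation -/
def ClosedQ (S : Set Q) : Prop := ∀ a ∈ S, ∀ b ∈ S, a ◃ b ∈ S

lemma closed_card [Finite Q] (hL : Latin Q) (p : ℕ) (hp : p.Prime) (hG : IsPGroup p (Dis Q))
    (S : Set Q) (hS : ClosedQ S) (e : Q) (he : e ∈ S) : ∃ k, S.ncard = p ^ k := by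
  haveI : Fact p.Prime := ⟨hp⟩
  let H : Subgroup (Equiv.Perm Q) :=
    Subgroup.closure {g | ∃ a ∈ S, ∃ b ∈ S, g = QL a * (QL b)⁻¹}
  have hH : H ≤ Dis Q := by
    rw [Subgroup.closure_le]
    rintro g ⟨a, _, b, _, rfl⟩
    exact Dis_gen a b
  have hbij : ∀ a ∈ S, ∀ y, QL a y ∈ S → y ∈ S := by
    intro a ha y hy
    have hm : Set.MapsTo (QL a) S S := fun b hb => hS a ha b hb
    obtain ⟨b, hb, hbs⟩ := surj_of_inj_set S (QL a) hm (QL a).injective _ hy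
    rw [← (QL a).injective hbs]; exact hb
  have hpres : ∀ g ∈ H, ∀ x, g x ∈ S ↔ x ∈ S := by
    intro g hg
    induction hg using Subgroup.closure_induction with
    | mem g hg =>
      obtain ⟨a, ha, b, hb, rfl⟩ := hg
      intro x
      have hx : x = QL b ((QL b)⁻¹ x) := ((QL b).apply_symm_apply x).symm
      constructor
      · intro h
        have := hbij a ha _ h
        rw [hx]
        exact hS b hb _ this
      · intro h
        rw [hx] at h
        exact hS a ha _ (hbij b hb _ h)
    | one => intro x; rfl
    | mul g h _ _ ihg ihh => intro x; rw [Equiv.Perm.mul_apply, ihg, ihh]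
    | inv g _ ih =>
      intro x
      rw [← ih]
      have : g (g⁻¹ x) = x := g.apply_symm_apply x
      rw [this]
  have horb : MulAction.orbit H e = S := by
    ext s
    constructor
    · rintro ⟨g, rfl⟩
      exact (hpres g g.2 e).2 he
    · intro hs
      have hm : Set.MapsTo (fun b : Q => b ◃ e) S S := fun b hb => hS b hb e he
      obtain ⟨b, hb, hbs⟩ := surj_of_inj_set S _ hm (hL e).1 _ hs
      refine ⟨⟨QL b * (QL e)⁻¹, Subgroup.subset_closure ⟨b, hb, e, he, rfl⟩⟩, ?_⟩
      have : (QL e)⁻¹ e = e := by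
        rw [Equiv.Perm.inv_eq_iff_eq, QL_apply, Quandle.fix]
      change (QL b) ((QL e)⁻¹ e) = s
      rw [this]
      exact hbs
  have hHp : IsPGroup p H := hG.to_le hH
  obtain ⟨k, hk⟩ := hHp.card_orbit e
  rw [horb] at hk
  exact ⟨k, by rw [← hk]; rfl⟩

end QuandleSmall

section Gens
variable {Q : Type*} [Quandle Q]

lemma gens_aux [Finite Q] (hL : Latin Q) (p : ℕ) (hp : p.Prime) (hG : IsPGroup p (Dis Q))
    (e : Q) (k : ℕ) : ∃ T : Finset Q, T.card ≤ k ∧ ∀ S : Set Q, ClosedQ S → e ∈ S → ↑T ⊆ S →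
      p ^ k ≤ S.ncard ∨ S = Set.univ := by
  classical
  induction k with
  | zero =>
    refine ⟨∅, by simp, fun S _ he _ => Or.inl ?_⟩
    rw [pow_zero]
    exact (Set.ncard_pos (Set.toFinite S)).2 ⟨e, he⟩
  | succ k ih =>
    obtain ⟨T, hT, h⟩ := ih
    let S0 : Set Q := {x | ∀ S : Set Q, ClosedQ S → e ∈ S → ↑T ⊆ S → x ∈ S}
    have hS0 : ClosedQ S0 := fun a ha b hb S h1 h2 h3 =>
      h1 a (ha S h1 h2 h3) b (hb S h1 h2 h3)
    have he0 : e ∈ S0 := fun S _ h2 _ => h2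
    have hT0 : ↑T ⊆ S0 := fun x hx S _ _ h3 => h3 hx
    by_cases hu : S0 = Set.univ
    · refine ⟨T, by omega, fun S h1 h2 h3 => Or.inr ?_⟩
      rw [Set.eq_univ_iff_forall] at hu ⊢
      exact fun x => hu x S h1 h2 h3
    · obtain ⟨x, hx⟩ := (Set.ne_univ_iff_exists_notMem _).1 hu
      refine ⟨insert x T, (Finset.card_insert_le _ _).trans (by omega), fun S h1 h2 h3 => ?_⟩
      rw [Finset.coe_insert, Set.insert_subset_iff] at h3
      left
      have hsub : S0 ⊂ S := by
        refine ⟨fun y hy => hy S h1 h2 h3.2, fun hh => hx (hh h3.1)⟩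
      have hlt := Set.ncard_lt_ncard hsub (Set.toFinite S)
      have hk : p ^ k ≤ S0.ncard := (h S0 hS0 he0 hT0).resolve_right hu
      obtain ⟨j, hj⟩ := closed_card hL p hp hG S h1 e h2
      rw [hj] at hlt ⊢
      have : k < j := (Nat.pow_lt_pow_iff_right hp.one_lt).1 (hk.trans_lt hlt)
      exact Nat.pow_le_pow_right hp.pos this

lemma gens [Finite Q] (hL : Latin Q) (p m : ℕ) (hp : p.Prime) (hcard : Nat.card Q = p ^ m)
    (e : Q) : ∃ T : Finset Q, T.card ≤ m ∧ ∀ S : Set Q, ClosedQ S → e ∈ S → ↑T ⊆ S →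
      S = Set.univ := by
  obtain ⟨T, hT, h⟩ := gens_aux hL p hp (Dis_isPGroup hL p m hp hcard) e m
  refine ⟨T, hT, fun S h1 h2 h3 => ?_⟩
  rcases h S h1 h2 h3 with h4 | h4
  · apply Set.eq_of_subset_of_ncard_le (Set.subset_univ _)
    rw [Set.ncard_univ, hcard]; exact h4
  · exact h4

end Gens

section Quot
variable {Q Q' : Type*} [Quandle Q] [Quandle Q']

lemma dis_descend (π : Q → Q')
    (hπ : ∀ a b, π (a ◃ b) = π a ◃ π b) {g : Equiv.Perm Q} (hg : g ∈ Dis Q) :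
    ∃ g' ∈ Dis Q', ∀ x, π (g x) = g' (π x) := by
  unfold Dis at hg
  induction hg using Subgroup.closure_induction with
  | mem g hg =>
    obtain ⟨a, b, rfl⟩ := hg
    refine ⟨QL (π a) * (QL (π b))⁻¹, Dis_gen _ _, fun x => ?_⟩
    have hx : x = QL b ((QL b)⁻¹ x) := ((QL b).apply_symm_apply x).symm
    have h1 : (QL (π b))⁻¹ (π x) = π ((QL b)⁻¹ x) := by
      rw [Equiv.Perm.inv_eq_iff_eq, QL_apply, ← hπ]
      conv_lhs => rw [hx]
      rfl
    rw [Equiv.Perm.mul_apply, Equiv.Perm.mul_apply, h1, QL_apply, QL_apply, hπ]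
  | one => exact ⟨1, (Dis Q').one_mem, fun x => rfl⟩
  | mul g h _ _ ihg ihh =>
    obtain ⟨g', hg', h1⟩ := ihg
    obtain ⟨h', hh', h2⟩ := ihh
    exact ⟨g' * h', (Dis Q').mul_mem hg' hh', fun x => by
      rw [Equiv.Perm.mul_apply, Equiv.Perm.mul_apply, h1, h2]⟩
  | inv g _ ih =>
    obtain ⟨g', hg', h1⟩ := ih
    refine ⟨g'⁻¹, (Dis Q').inv_mem hg', fun x => ?_⟩
    symm
    rw [Equiv.Perm.inv_eq_iff_eq, ← h1]
    exact congrArg π (g.apply_symm_apply x).symm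

lemma latin_quot [Finite Q'] (hL : Latin Q) (π : Q → Q') (hs : Function.Surjective π)
    (hπ : ∀ a b, π (a ◃ b) = π a ◃ π b) : Latin Q' := by
  intro a'
  rw [← Finite.surjective_iff_bijective]
  intro b'
  obtain ⟨a, rfl⟩ := hs a'
  obtain ⟨b, rfl⟩ := hs b'
  obtain ⟨c, hc⟩ := (hL a).2 b
  refine ⟨π c, ?_⟩
  change π c ◃ π a = π b
  rw [← hπ]
  exact congrArg π hc

theorem dis_quot_bound [Finite Q] (π : Q → Q') (hs : Function.Surjective π)
    (hπ : ∀ a b, π (a ◃ b) = π a ◃ π b) (Z : Subgroup (Equiv.Perm Q))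
    (hcen : ∀ z ∈ Z, ∀ g ∈ Dis Q, z * g = g * z)
    (hZ : ∀ x y, π x = π y ↔ ∃ z ∈ Z, z x = y)
    (e' : Q') (T : Finset Q') (m : ℕ) (hT : T.card ≤ m)
    (hgen : ∀ S : Set Q', ClosedQ S → e' ∈ S → ↑T ⊆ S → S = Set.univ) :
    Nat.card (Dis Q) ≤ Nat.card Z ^ (m + 1) * Nat.card (Dis Q') := by
  classical
  haveI : Finite Q' := Finite.of_surjective π hs
  choose φ hφ1 hφ2 using fun g : Dis Q => dis_descend π hπ g.2
  let Φ : Dis Q →* Dis Q' := MonoidHom.mk' (fun g => ⟨φ g, hφ1 g⟩) (by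
    intro g h
    apply Subtype.ext
    ext x'
    obtain ⟨x, rfl⟩ := hs x'
    change φ (g * h) (π x) = φ g (φ h (π x))
    rw [← hφ2, ← hφ2, ← hφ2]
    rfl)
  have hker : ∀ g ∈ Φ.ker, ∀ x, π x = π ((g : Equiv.Perm Q) x) := by
    intro g hg x
    have h1 : φ g = 1 := congrArg Subtype.val (MonoidHom.mem_ker.1 hg)
    rw [hφ2, h1]; rfl
  have hex : ∀ (g : Φ.ker) (t : (insert e' T : Finset Q')),
      ∃ z : Z, (z : Equiv.Perm Q) (Function.surjInv hs t) =
        ((g : Dis Q) : Equiv.Perm Q) (Function.surjInv hs t) := by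
    intro g t
    obtain ⟨z, hz, h⟩ := (hZ _ _).1 (hker g g.2 (Function.surjInv hs t))
    exact ⟨⟨z, hz⟩, h⟩
  choose ζ hζ using hex
  have hinj : Function.Injective ζ := by
    intro g h hgh
    let S : Set Q' := {q | ∀ x, π x = q →
      ((g : Dis Q) : Equiv.Perm Q) x = ((h : Dis Q) : Equiv.Perm Q) x}
    have hprop : ∀ x y, π x = π y →
        ((g : Dis Q) : Equiv.Perm Q) x = ((h : Dis Q) : Equiv.Perm Q) x →
        ((g : Dis Q) : Equiv.Perm Q) y = ((h : Dis Q) : Equiv.Perm Q) y := by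
      intro x y hxy hx
      obtain ⟨z, hz, rfl⟩ := (hZ _ _).1 hxy
      have h1 := DFunLike.congr_fun (hcen z hz _ (g : Dis Q).2) x
      have h2 := DFunLike.congr_fun (hcen z hz _ (h : Dis Q).2) x
      rw [Equiv.Perm.mul_apply, Equiv.Perm.mul_apply] at h1 h2
      rw [← h1, ← h2, hx]
    have hmem : ∀ t ∈ insert e' T, t ∈ S := by
      intro t ht x hx
      refine hprop (Function.surjInv hs t) x ?_ ?_
      · exact (Function.surjInv_eq hs t).trans hx.symm
      · rw [← hζ g ⟨t, ht⟩, ← hζ h ⟨t, ht⟩, hgh]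
    have hS : ClosedQ S := by
      intro a' ha b' hb x hx
      obtain ⟨a, rfl⟩ := hs a'
      obtain ⟨b, rfl⟩ := hs b'
      refine hprop (a ◃ b) x ?_ ?_
      · rw [hπ, hx]
      · rw [InnQ_map (Dis_le_InnQ (g : Dis Q).2), InnQ_map (Dis_le_InnQ (h : Dis Q).2),
          ha a rfl, hb b rfl]
    have hu := hgen S hS (hmem _ (Finset.mem_insert_self _ _))
      (fun t ht => hmem t (Finset.mem_insert_of_mem ht))
    apply Subtype.ext
    apply Subtype.ext
    ext x
    exact (Set.eq_univ_iff_forall.1 hu (π x)) x rfl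
  have hkc : Nat.card Φ.ker ≤ Nat.card Z ^ (m + 1) := by
    refine (Nat.card_le_card_of_injective ζ hinj).trans ?_
    rw [Nat.card_fun, Nat.card_eq_fintype_card (α := (insert e' T : Finset Q')),
      Fintype.card_coe]
    exact Nat.pow_le_pow_right Nat.card_pos ((Finset.card_insert_le _ _).trans (by omega))
  rw [← Subgroup.card_mul_index Φ.ker, Subgroup.index_ker]
  exact Nat.mul_le_mul hkc (Nat.card_le_card_of_injective _ Subtype.val_injective)

end Quot

section QuotQuandle
variable {Q : Type*} [Quandle Q]

/-- the quotient quandle by the orbits of a normal subgroup of the inner group -/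
@[reducible] def quotQuandle (Z : Subgroup (Equiv.Perm Q)) (hZ : Z ≤ InnQ Q)
    (hn : ∀ g ∈ InnQ Q, ∀ z ∈ Z, g * z * g⁻¹ ∈ Z) :
    Quandle (Quotient (MulAction.orbitRel Z Q)) where
  act := Quotient.map₂ (fun a b => a ◃ b) (by
    rintro _ a ⟨⟨z, hz⟩, rfl⟩ _ b ⟨⟨w, hw⟩, rfl⟩
    refine ⟨⟨z * (QL a * (z⁻¹ * w) * (QL a)⁻¹), Z.mul_mem hz
      (hn _ (QL_mem_InnQ a) _ (Z.mul_mem (Z.inv_mem hz) hw))⟩, ?_⟩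
    change (z * (QL a * (z⁻¹ * w) * (QL a)⁻¹)) (QL a b) = QL (z a) (w b)
    rw [← InnQ_conj (hZ hz), ← Equiv.Perm.mul_apply, ← Equiv.Perm.mul_apply]
    congr 1
    group)
  invAct := Quotient.map₂ (fun a b => a ◃⁻¹ b) (by
    rintro _ a ⟨⟨z, hz⟩, rfl⟩ _ b ⟨⟨w, hw⟩, rfl⟩
    refine ⟨⟨z * ((QL a)⁻¹ * (z⁻¹ * w) * (QL a)⁻¹⁻¹), Z.mul_mem hz
      (hn _ ((InnQ Q).inv_mem (QL_mem_InnQ a)) _ (Z.mul_mem (Z.inv_mem hz) hw))⟩, ?_⟩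
    change (z * ((QL a)⁻¹ * (z⁻¹ * w) * (QL a)⁻¹⁻¹)) ((QL a)⁻¹ b) = (QL (z a))⁻¹ (w b)
    rw [← InnQ_conj (hZ hz), ← Equiv.Perm.mul_apply, ← Equiv.Perm.mul_apply]
    congr 1
    group)
  self_distrib := by
    rintro ⟨x⟩ ⟨y⟩ ⟨z⟩
    exact congrArg (Quotient.mk (MulAction.orbitRel Z Q)) Shelf.self_distrib
  left_inv := by
    rintro ⟨x⟩ ⟨y⟩
    exact congrArg (Quotient.mk (MulAction.orbitRel Z Q)) (Rack.left_inv x y)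
  right_inv := by
    rintro ⟨x⟩ ⟨y⟩
    exact congrArg (Quotient.mk (MulAction.orbitRel Z Q)) (Rack.right_inv x y)
  fix := by
    rintro ⟨x⟩
    exact congrArg (Quotient.mk (MulAction.orbitRel Z Q)) Quandle.fix

/-- the centre of the displacement group -/
def ZD (Q : Type*) [Quandle Q] : Subgroup (Equiv.Perm Q) :=
  (Subgroup.center (Dis Q)).map (Dis Q).subtype

lemma ZD_le : ZD Q ≤ Dis Q := by
  rintro _ ⟨z, _, rfl⟩; exact z.2

lemma ZD_mem {z : Equiv.Perm Q} : z ∈ ZD Q ↔ z ∈ Dis Q ∧ ∀ g ∈ Dis Q, z * g = g * z := by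
  constructor
  · rintro ⟨z, hz, rfl⟩
    refine ⟨z.2, fun g hg => ?_⟩
    exact (congrArg Subtype.val (Subgroup.mem_center_iff.1 hz ⟨g, hg⟩)).symm
  · rintro ⟨h1, h2⟩
    refine ⟨⟨z, h1⟩, ?_, rfl⟩
    exact Subgroup.mem_center_iff.2 fun g => Subtype.ext (h2 g g.2).symm

lemma ZD_conj (g : Equiv.Perm Q) (hg : g ∈ InnQ Q) (z : Equiv.Perm Q) (hz : z ∈ ZD Q) :
    g * z * g⁻¹ ∈ ZD Q := by
  rw [ZD_mem] at hz ⊢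
  refine ⟨Dis_conj hg hz.1, fun h hh => ?_⟩
  have h1 := hz.2 _ (Dis_conj ((InnQ Q).inv_mem hg) hh)
  calc g * z * g⁻¹ * h = g * (z * (g⁻¹ * h * g⁻¹⁻¹)) * g⁻¹ := by group
    _ = h * (g * z * g⁻¹) := by rw [h1]; group

lemma ZD_free (hL : Latin Q) (x : Q) : MulAction.stabilizer (ZD Q) x = ⊥ := by
  rw [eq_bot_iff]
  rintro ⟨z, hz⟩ h
  rw [Subgroup.mem_bot]
  apply Subtype.ext
  ext y
  have hx : z x = x := h
  obtain ⟨g, hg, rfl⟩ := Dis_trans hL x y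
  have h1 := DFunLike.congr_fun ((ZD_mem.1 hz).2 g hg) x
  rw [Equiv.Perm.mul_apply, Equiv.Perm.mul_apply, hx] at h1
  exact h1

end QuotQuandle

/-- exponent bound -/
def bnd (n : ℕ) : ℕ := if n ≤ 2 then n else (n ^ 2 + n - 4) / 2

lemma bnd_arith (m k : ℕ) (hk : 1 ≤ k) (hn : 4 ≤ m + k) :
    k * (m + 1) + bnd m ≤ bnd (m + k) := by
  have h1 : ¬ (m + k ≤ 2) := by omega
  have h2 : bnd (m + k) = ((m + k) ^ 2 + (m + k) - 4) / 2 := by rw [bnd, if_neg h1]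
  rw [h2, Nat.le_div_iff_mul_le (by norm_num)]
  apply Nat.le_sub_of_add_le
  have h3 : 2 * bnd m ≤ m ^ 2 + m - 4 ∨ m ≤ 2 ∧ bnd m = m := by
    unfold bnd
    split_ifs with h
    · exact Or.inr ⟨h, rfl⟩
    · left; omega
  rcases h3 with h3 | ⟨h3, h4⟩
  · by_cases hm : m ≤ 2
    · have hb : bnd m = m := by rw [bnd, if_pos hm]
      rw [hb]
      obtain ⟨j, rfl⟩ : ∃ j, k = j + 1 := ⟨k - 1, by omega⟩
      interval_cases m <;> nlinarith
    · have : 4 ≤ m ^ 2 + m := by nlinarith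
      have h5 : 2 * bnd m + 4 ≤ m ^ 2 + m := by omega
      nlinarith
  · rw [h4]
    interval_cases m
    · nlinarith
    · nlinarith
    · nlinarith

theorem dis_bound.{u} (p : ℕ) (hp : p.Prime) (n : ℕ) : ∀ (Q : Type u) [Quandle Q] [Finite Q],
    Latin Q → Nat.card Q = p ^ n → Nat.card (Dis Q) ≤ p ^ bnd n := by
  induction n using Nat.strong_induction_on with
  | _ n ih =>
    intro Q _ _ hL hcard
    haveI : Fact p.Prime := ⟨hp⟩
    by_cases hn2 : n ≤ 2
    · rw [bnd, if_pos hn2, (Dis_small hL p n hp hcard).1 hn2]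
    by_cases hn3 : n = 3
    · have := (Dis_small hL p n hp hcard).2 hn3
      subst hn3
      exact this
    have hG := Dis_isPGroup hL p n hp hcard
    have hQ1 : 1 < Nat.card Q := by rw [hcard]; exact Nat.one_lt_pow (by omega) hp.one_lt
    haveI : Nontrivial Q := Finite.one_lt_card_iff_nontrivial.1 hQ1
    haveI : Nontrivial (Dis Q) := by
      obtain ⟨x, y, hxy⟩ := exists_pair_ne Q
      obtain ⟨g, hg, h⟩ := Dis_trans hL x y
      refine ⟨⟨g, hg⟩, 1, fun h1 => hxy ?_⟩
      have h2 : g = 1 := congrArg Subtype.val h1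
      rw [← h, h2]; rfl
    haveI : Nontrivial (Subgroup.center (Dis Q)) := hG.center_nontrivial
    have hZc : Nat.card (ZD Q) = Nat.card (Subgroup.center (Dis Q)) :=
      Subgroup.card_map_of_injective Subtype.val_injective
    obtain ⟨k, hk⟩ : ∃ k, Nat.card (ZD Q) = p ^ k :=
      (hG.to_le ZD_le).exists_card_eq
    have hk1 : 1 ≤ k := by
      by_contra h0
      have h0 : k = 0 := by omega
      rw [h0, pow_zero, hZc] at hk
      have := Finite.one_lt_card (α := Subgroup.center (Dis Q))
      omega
    letI : Quandle (Quotient (MulAction.orbitRel (ZD Q) Q)) :=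
      quotQuandle (ZD Q) (ZD_le.trans Dis_le_InnQ) ZD_conj
    have hc2 : p ^ n = Nat.card (Quotient (MulAction.orbitRel (ZD Q) Q)) * p ^ k := by
      rw [← hcard, ← hk, ← Nat.card_prod]
      exact Nat.card_congr (MulAction.selfEquivOrbitsQuotientProd (ZD_free hL))
    obtain ⟨m, hm, hm2⟩ := (Nat.dvd_prime_pow hp).1 (Dvd.intro _ hc2.symm)
    have hmk : n = m + k := by
      rw [hm2, ← pow_add] at hc2
      exact Nat.pow_right_injective hp.two_le hc2
    let π : Q → Quotient (MulAction.orbitRel (ZD Q) Q) := Quotient.mk _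
    have hs : Function.Surjective π := Quotient.mk_surjective
    have hπ : ∀ a b, π (a ◃ b) = π a ◃ π b := fun _ _ => rfl
    have hL' := latin_quot hL π hs hπ
    obtain ⟨e⟩ : Nonempty Q := inferInstance
    obtain ⟨T, hT, hgen⟩ := gens hL' p m hp hm2 (π e)
    have hb := dis_quot_bound π hs hπ (ZD Q) (fun z hz => (ZD_mem.1 hz).2) (by
      intro x y
      constructor
      · intro h
        obtain ⟨z, hz⟩ := Quotient.exact h.symm
        exact ⟨z, z.2, hz⟩
      · rintro ⟨z, hz, rfl⟩
        exact (Quotient.sound ⟨⟨z, hz⟩, rfl⟩ : π (z x) = π x).symm) (π e) T m hT hgen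
    refine hb.trans ?_
    have hI := ih m (by omega) _ hL' hm2
    refine (Nat.mul_le_mul_left _ hI).trans ?_
    rw [hk, ← pow_mul, ← pow_add]
    apply Nat.pow_le_pow_right hp.pos
    rw [hmk]
    exact bnd_arith m k hk1 (by omega)

theorem stmt17 (p n : ℕ) (hp : p.Prime) (hn : 3 ≤ n) (Q : Type*) [Quandle Q]
    (hlatin : ∀ a : Q, Function.Bijective (fun b : Q => b ◃ a))
    (hcard : Nat.card Q = p ^ n) :
    Nat.card ↥(Dis Q) ≤ p ^ ((n ^ 2 + n - 4) / 2) := by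
  haveI : Finite Q := by
    apply Nat.finite_of_card_ne_zero
    rw [hcard]
    exact pow_ne_zero _ hp.ne_zero
  have h := dis_bound p hp n Q hlatin hcard
  rwa [bnd, if_neg (by omega)] at h
end
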